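/- Let q be a prime power and r ≥ 1. Let f(X) ∈ F_{q^r}[X] be a monic q-polynomial with nonzero coefficient of X and with coefficient of X^{q^2} equal to 0. If f is an exceptional scattered polynomial of index 2, then either f(X) = X, or f(X) = δ·X + X^{q^4} for some nonzero δ ∈ F_{q^r} (i.e., f is of the type δx^{q^s} + x^{q^{n−s}} of the known family, written in index-2 normalized form). -/

import Mathlib

namespace Scat
open Polynomial

/-- A filtered domain over a field, with linear growth of dimensions. -/
structure FilData (K S : Type*) [Field K] [CommRing S] [Algebra K S]
    (fil : ℕ → Submodule K S) (N C : ℕ) : Prop where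
  mono : Monotone fil
  fin : ∀ n, FiniteDimensional K (fil n)
  dim : ∀ n, Module.finrank K (fil n) = N * n
  mul : ∀ n m x y, x ∈ fil n → y ∈ fil m → x * y ∈ fil (n + m + C)
  exh : ∀ x, ∃ n, x ∈ fil n

section
variable {K S : Type*} [Field K] [CommRing S] [IsDomain S] [Algebra K S]
  {fil : ℕ → Submodule K S} {N C : ℕ}

theorem FilData.zero_lemma (h : FilData K S fil N C) {u : S} (hu : u ≠ 0) {a : ℕ}
    (hua : u ∈ fil a) {W : Type*} [AddCommGroup W] [Module K W] [FiniteDimensional K W]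
    (π : S →ₗ[K] W) (hπ : Function.Surjective π) (h0 : ∀ x, π (u * x) = 0) :
    Module.finrank K W ≤ N * (a + C) := by
  classical
  -- some fil n surjects
  obtain ⟨n, hn⟩ : ∃ n, (fil n).map π = ⊤ := by
    let bW := Module.finBasis K W
    choose t ht using fun i => hπ (bW i)
    choose n hn using fun i => h.exh (t i)
    refine ⟨Finset.univ.sup n, ?_⟩
    rw [eq_top_iff, ← bW.span_eq, Submodule.span_le]
    rintro _ ⟨i, rfl⟩
    exact ⟨t i, h.mono (Finset.le_sup (Finset.mem_univ i)) (hn i), ht i⟩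
  have := h.fin n
  have := h.fin (n + a + C)
  let f : fil (n + a + C) →ₗ[K] W := π.domRestrict _
  have hf : LinearMap.range f = ⊤ := by
    rw [eq_top_iff, ← hn]
    rintro _ ⟨x, hx, rfl⟩
    exact ⟨⟨x, h.mono (by omega) hx⟩, rfl⟩
  have hmulm : ∀ x ∈ fil n, u * x ∈ fil (n + a + C) := by
    intro x hx
    have := h.mul a n u x hua hx
    rwa [add_comm a n] at this
  let g : fil n →ₗ[K] LinearMap.ker f :=
    { toFun := fun x => ⟨⟨u * x, hmulm x x.2⟩, h0 x⟩
      map_add' := by intro x y; ext; simp [mul_add]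
      map_smul' := by intro c x; ext; simp }
  have hg : Function.Injective g := by
    intro x y hxy
    have : u * (x : S) = u * y := congrArg (fun z : LinearMap.ker f => ((z : fil (n+a+C)) : S)) hxy
    exact Subtype.ext (mul_left_cancel₀ hu this)
  have h1 := LinearMap.finrank_le_finrank_of_injective hg
  have h2 := f.finrank_range_add_finrank_ker
  rw [hf, finrank_top] at h2
  rw [h.dim] at h1 h2
  have : N * (n + a + C) = N * n + N * (a + C) := by ring
  omega

theorem FilData.homs_bound (h : FilData K S fil N C) {u : S} (hu : u ≠ 0) {a : ℕ}
    (hua : u ∈ fil a) (Z : Finset (S →ₐ[K] K)) (hZ : ∀ χ ∈ Z, χ u = 0) :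
    Z.card ≤ N * (a + C) := by
  classical
  let π : S →ₗ[K] (Z → K) := LinearMap.pi fun χ => χ.1.toLinearMap
  have hπ : Function.Surjective π := by
    rw [← LinearMap.range_eq_top]
    by_contra hne
    obtain ⟨f, hf0, hf⟩ := Submodule.exists_le_ker_of_lt_top _ (lt_top_iff_ne_top.mpr hne)
    have hind : LinearIndependent K (fun χ : Z => ((χ.1 : S →* K) : S → K)) := by
      refine (linearIndependent_monoidHom S K).comp (fun χ : Z => (χ.1 : S →* K)) ?_
      intro χ χ' hh
      apply Subtype.ext
      ext x
      exact DFunLike.congr_fun hh x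
    rw [Fintype.linearIndependent_iff] at hind
    apply hf0
    have key := hind (fun χ => f (fun j => if χ = j then 1 else 0)) (by
      ext x
      have : f (π x) = 0 := hf ⟨x, rfl⟩
      rw [LinearMap.pi_apply_eq_sum_univ] at this
      simpa [π, mul_comm] using this)
    apply LinearMap.ext
    intro x
    rw [LinearMap.pi_apply_eq_sum_univ]
    simp only [key]
    simp
  have := h.zero_lemma hu hua π hπ (by
    intro x; ext χ
    simp [π, hZ χ.1 χ.2])
  simpa using this

theorem FilData.order_bound (h : FilData K S fil N C) (j : S →ₐ[K] PowerSeries K)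
    {τ : S} (hτ : j τ = PowerSeries.X) {u : S} (hu : u ≠ 0) {a k : ℕ}
    (hua : u ∈ fil a) (hk : ∀ i < k, PowerSeries.coeff i (j u) = 0) :
    k ≤ N * (a + C) := by
  let π : S →ₗ[K] (Fin k → K) :=
    LinearMap.pi fun i => (PowerSeries.coeff (i:ℕ)).comp j.toLinearMap
  have hX : PowerSeries.X ^ k ∣ j u := PowerSeries.X_pow_dvd_iff.mpr hk
  have hπ : Function.Surjective π := by
    intro f
    refine ⟨∑ i, f i • τ ^ (i:ℕ), ?_⟩
    ext i
    simp only [π, LinearMap.pi_apply, LinearMap.comp_apply, AlgHom.toLinearMap_apply, map_sum,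
      map_smul, map_pow, hτ, PowerSeries.coeff_X_pow, smul_eq_mul]
    rw [Finset.sum_eq_single i]
    · simp
    · intro b _ hb
      rw [if_neg (fun h => hb (Fin.ext h.symm)), mul_zero]
    · simp
  have := h.zero_lemma hu hua π hπ (by
    intro x; ext i
    have := PowerSeries.X_pow_dvd_iff.mp (hX.mul_right (j x)) i i.2
    simpa [π] using this)
  simpa using this

theorem FilData.pow_mem (h : FilData K S fil N C) {a : ℕ} {x : S} (hx : x ∈ fil a) (n : ℕ)
    (hn : 1 ≤ n) : x ^ n ∈ fil (n * (a + C)) := by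
  induction n, hn using Nat.le_induction with
  | base => simpa using h.mono (by omega) hx
  | succ n hn ih =>
    rw [pow_succ]
    have := h.mul _ _ _ _ ih hx
    exact h.mono (by ring_nf; omega) this

theorem exists_orders (h : FilData K S fil N C) (j : S →ₐ[K] PowerSeries K)
    (hj : Function.Injective j) {τ : S} (hτ : j τ = PowerSeries.X) (B : ℕ) :
    ∃ (O : Finset ℕ) (w : ℕ → S), N * B ≤ O.card ∧ (∀ o ∈ O, w o ∈ fil B) ∧
      (∀ o ∈ O, (j (w o)).order = o) := by
  classical
  let O : Finset ℕ := (Finset.range (N * (B + C) + 1)).filter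
    fun o => ∃ w ∈ fil B, (j w).order = o
  have hO : ∀ o ∈ O, ∃ w ∈ fil B, (j w).order = o := fun o ho => (Finset.mem_filter.mp ho).2
  have hO' : ∀ w ∈ fil B, w ≠ 0 → ∃ o ∈ O, (j w).order = o := by
    intro w hw hw0
    have hne : (j w).order ≠ ⊤ := by
      rw [Ne, PowerSeries.order_eq_top]
      exact fun h => hw0 (hj (h.trans (map_zero j).symm))
    obtain ⟨o, ho⟩ := ENat.ne_top_iff_exists.mp hne
    refine ⟨o, Finset.mem_filter.mpr ⟨?_, w, hw, ho.symm⟩, ho.symm⟩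
    rw [Finset.mem_range]
    have := h.order_bound j hτ hw0 hw (k := o) (by
      intro i hi
      apply PowerSeries.coeff_of_lt_order
      rw [← ho]; exact_mod_cast hi)
    omega
  choose! w hw hw' using hO
  refine ⟨O, w, ?_, hw, hw'⟩
  have := h.fin B
  let f : fil B →ₗ[K] (O → K) :=
    LinearMap.pi fun i => ((PowerSeries.coeff (i:ℕ)).comp j.toLinearMap).comp (fil B).subtype
  have hf : Function.Injective f := by
    rw [← LinearMap.ker_eq_bot, LinearMap.ker_eq_bot']
    intro x hx
    by_contra hne
    obtain ⟨o, ho, ho'⟩ := hO' x x.2 (fun h => hne (Subtype.ext h))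
    have h1 : PowerSeries.coeff o (j x) = 0 := congrFun hx ⟨o, ho⟩
    exact (PowerSeries.order_eq_nat.mp ho').1 h1
  have := LinearMap.finrank_le_finrank_of_injective hf
  rw [h.dim] at this
  simpa using this


theorem order_sum_ne (j : S →ₐ[K] PowerSeries K) (Q' : ℕ) (O : Finset ℕ) (w v : ℕ → S)
    (hw : ∀ o ∈ O, (j (w o)).order = o)
    (hv : ∀ o ∈ O, v o ≠ 0 → (j (v o)).order < Q') (hne : ∃ o ∈ O, v o ≠ 0) :
    ∑ o ∈ O, v o * w o ^ Q' ≠ 0 := by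
  classical
  obtain ⟨o, ho, hmin⟩ := Finset.exists_min_image (O.filter fun o => v o ≠ 0) id
    (by obtain ⟨o, ho, h⟩ := hne; exact ⟨o, Finset.mem_filter.mpr ⟨ho, h⟩⟩)
  rw [Finset.mem_filter] at ho
  intro hsum
  have hlt := hv o ho.1 ho.2
  obtain ⟨k, hk⟩ := ENat.ne_top_iff_exists.mp hlt.ne_top
  rw [← hk] at hlt
  have hlt' : k < Q' := by exact_mod_cast hlt
  have hj0 : ∑ o ∈ O, j (v o) * j (w o) ^ Q' = 0 := by
    have := congrArg j hsum
    simpa using this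
  have hc := congrArg (PowerSeries.coeff (k + Q' * o)) hj0
  rw [map_sum, Finset.sum_eq_single o] at hc
  · have : (j (v o) * j (w o) ^ Q').order = ((k + Q' * o : ℕ) : ℕ∞) := by
      rw [PowerSeries.order_mul, PowerSeries.order_pow, hw o ho.1, ← hk]
      simp
    exact (PowerSeries.order_eq_nat.mp this).1 (by simpa using hc)
  · intro b hb hbo
    by_cases hvb : v b = 0
    · simp [hvb]
    · apply PowerSeries.coeff_of_lt_order
      have hob : o ≤ b := hmin b (Finset.mem_filter.mpr ⟨hb, hvb⟩)
      have hob' : o + 1 ≤ b := by omega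
      rw [PowerSeries.order_mul, PowerSeries.order_pow, hw b hb]
      refine lt_of_lt_of_le ?_ le_add_self
      simp only [nsmul_eq_mul]
      norm_cast
      nlinarith
  · intro h; exact absurd ho.1 h

theorem stepanov_aux (p : ℕ) [Fact p.Prime] [CharP K p] [IsAlgClosed K]
    (h : FilData K S fil N C) (j : S →ₐ[K] PowerSeries K)
    (hj : Function.Injective j) {τ : S} (hτ : j τ = PowerSeries.X) (hN : 0 < N)
    (C' μ Q' A B : ℕ) (hB : p ^ μ < N * B)
    (hA : p ^ μ * C + B + C' + C < A) (hQ' : N * (A + C) < Q')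
    (s : S →+* S) (hsK : ∀ k : K, s (algebraMap K S k) = algebraMap K S (k ^ (p ^ μ * Q')))
    (hsf : ∀ n, ∀ x ∈ fil n, s x ∈ fil (n + C'))
    (Z : Finset (S →ₐ[K] K)) (hZ : ∀ χ ∈ Z, ∀ w, χ (s w) = χ w ^ (p ^ μ * Q')) :
    Z.card ≤ N * (A + Q' * (B + C) + C + C) := by
  classical
  have hM : 1 ≤ p ^ μ := Nat.one_le_pow _ _ (Fact.out : p.Prime).pos
  set M := p ^ μ with hMdef
  obtain ⟨O, w, hO, hw, hw'⟩ := exists_orders h j hj hτ B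
  have := h.fin A
  let ε := Module.finBasis K (fil A)
  let I := Fin (Module.finrank K (fil A))
  let D := M * (A + C) + (B + C') + C
  have := h.fin D
  have hterm : ∀ (i : I) (o : O), ((ε i : fil A) : S) ^ M * s (w o) ∈ fil D := by
    intro i o
    exact h.mul _ _ _ _ (h.pow_mem (ε i).2 M hM) (hsf _ _ (hw o o.2))
  let Λ : (I × O → K) →ₗ[K] fil D :=
    Fintype.linearCombination K (fun io : I × O => (⟨_, hterm io.1 io.2⟩ : fil D))
  have hker : ∃ c' : I × O → K, c' ≠ 0 ∧ Λ c' = 0 := by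
    by_contra hcon
    push Not at hcon
    have hinj : Function.Injective Λ := by
      rw [← LinearMap.ker_eq_bot, LinearMap.ker_eq_bot']
      intro m hm
      by_contra hm0
      exact hcon m hm0 hm
    have h1 := LinearMap.finrank_le_finrank_of_injective hinj
    rw [h.dim, Module.finrank_fintype_fun_eq_card, Fintype.card_prod, Fintype.card_fin,
      Fintype.card_coe, h.dim] at h1
    have h2 : N * A * (M + 1) ≤ N * A * O.card := Nat.mul_le_mul_left _ (by omega)
    have h3 : N * (A * (M + 1)) ≤ N * D := by rw [← mul_assoc]; exact h2.trans h1
    have h4 := Nat.le_of_mul_le_mul_left h3 hN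
    have h5 : D = A * M + (M * C + B + C' + C) := by simp only [D]; ring
    have h6 : A * (M + 1) = A * M + A := by ring
    omega
  obtain ⟨c', hc0, hc'⟩ := hker
  have hroot : ∀ io, ∃ c : K, c ^ M = c' io := fun io => IsAlgClosed.exists_pow_nat_eq _ hM
  choose c hc using hroot
  let v : ℕ → S := fun o => if ho : o ∈ O then ∑ i : I, c (i, ⟨o, ho⟩) • ((ε i : fil A) : S) else 0
  have hvA : ∀ o, v o ∈ fil A := by
    intro o
    simp only [v]
    split_ifs
    · exact Submodule.sum_mem _ fun i _ => Submodule.smul_mem _ _ (ε i).2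
    · exact Submodule.zero_mem _
  have hv : ∀ o ∈ O, v o ≠ 0 → (j (v o)).order < Q' := by
    intro o _ hne
    by_contra hge
    push Not at hge
    have := h.order_bound j hτ hne (hvA o) (k := Q') (by
      intro i hi
      apply PowerSeries.coeff_of_lt_order
      refine lt_of_lt_of_le ?_ hge
      exact_mod_cast hi)
    omega
  have hvne : ∃ o ∈ O, v o ≠ 0 := by
    by_contra hcon
    push Not at hcon
    apply hc0
    funext ⟨i, o⟩
    have h1 := hcon o o.2
    simp only [v, o.2, dif_pos] at h1
    have h2 : ∑ i : I, c (i, o) • ε i = 0 := by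
      apply Subtype.ext
      simpa using h1
    have h3 := Fintype.linearIndependent_iff.mp ε.linearIndependent _ h2 i
    rw [← hc, h3, zero_pow (by omega)]
    rfl
  have hΨ := order_sum_ne j Q' O w v hw' hv hvne
  set Ψ := ∑ o ∈ O, v o * w o ^ Q' with hΨdef
  have hΨf : Ψ ∈ fil (A + Q' * (B + C) + C) := by
    refine Submodule.sum_mem _ fun o ho => ?_
    exact h.mul _ _ _ _ (hvA o) (h.pow_mem (hw o ho) Q' (by omega))
  refine h.homs_bound hΨ hΨf Z ?_
  intro χ hχ
  have hexp : ExpChar K p := ExpChar.prime Fact.out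
  have hpow : (χ Ψ) ^ M = 0 := by
    have hΛ : χ ((Λ c' : fil D) : S) = 0 := by rw [hc']; simp
    simp only [Λ, Fintype.linearCombination_apply, Submodule.coe_sum, Submodule.coe_smul,
      map_sum, map_smul, map_mul, map_pow, hZ χ hχ] at hΛ
    rw [hΨdef, map_sum, hMdef, sum_pow_char_pow, ← hMdef, ← Finset.sum_coe_sort O, ← hΛ,
      Fintype.sum_prod_type, Finset.sum_comm]
    refine Finset.sum_congr rfl fun o _ => ?_
    simp only [v, o.2, dif_pos, map_mul, map_sum, map_smul, map_pow]
    rw [Finset.sum_mul, hMdef, sum_pow_char_pow, ← hMdef]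
    refine Finset.sum_congr rfl fun i _ => ?_
    rw [smul_eq_mul, smul_eq_mul, ← hc]
    ring
  exact pow_eq_zero_iff (by omega) |>.mp hpow

/-- uniform Stepanov bound -/
theorem stepanov (p : ℕ) [Fact p.Prime] [CharP K p] [IsAlgClosed K]
    (h : FilData K S fil N C) (j : S →ₐ[K] PowerSeries K)
    (hj : Function.Injective j) {τ : S} (hτ : j τ = PowerSeries.X) (hN : 0 < N)
    (C' R : ℕ) : ∃ Q0 : ℕ, ∀ n : ℕ, Q0 ≤ p ^ n →
    ∀ s : S →+* S, (∀ k : K, s (algebraMap K S k) = algebraMap K S (k ^ p ^ n)) →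
    (∀ n, ∀ x ∈ fil n, s x ∈ fil (n + C')) →
    ∀ Z : Finset (S →ₐ[K] K), (∀ χ ∈ Z, ∀ w, χ (s w) = χ w ^ p ^ n) →
    R * Z.card ≤ p ^ n * (R + 1) := by
  have hp : 1 < p := (Fact.out : p.Prime).one_lt
  obtain ⟨μ, hμ⟩ : ∃ μ, R * (N + N * C) + 1 < p ^ μ := pow_unbounded_of_one_lt _ hp
  let B := p ^ μ / N + 1
  let A := p ^ μ * C + B + C' + C + 1
  let L := R * (N * (A + C + C)) + N * (A + C) + 1
  have hMp : 0 < p ^ μ := by positivity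
  refine ⟨p ^ μ * L, fun n hn s hs hsf Z hZ => ?_⟩
  have hμn : μ ≤ n := by
    rw [← Nat.pow_le_pow_iff_right hp]
    refine le_trans ?_ hn
    exact Nat.le_mul_of_pos_right _ (by simp [L])
  obtain ⟨k, rfl⟩ := Nat.exists_eq_add_of_le hμn
  rw [pow_add] at hn
  have hL : L ≤ p ^ k := Nat.le_of_mul_le_mul_left hn hMp
  have hB : p ^ μ < N * B := Nat.lt_mul_div_succ _ hN
  have hB' : N * B ≤ p ^ μ + N := by
    simp only [B, mul_add]
    have := Nat.mul_div_le (p ^ μ) N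
    omega
  have key := stepanov_aux p h j hj hτ hN C' μ (p ^ k) A B hB (by simp only [A]; omega)
    (by simp only [L] at hL; omega) s (by simpa [pow_add] using hs) hsf Z
    (by simpa [pow_add] using hZ)
  rw [pow_add]
  set Q' := p ^ k
  set M := p ^ μ
  calc R * Z.card ≤ R * (N * (A + Q' * (B + C) + C + C)) := Nat.mul_le_mul_left _ key
    _ = R * (N * (A + C + C)) + Q' * (R * (N * B)) + Q' * (R * (N * C)) := by ring
    _ ≤ Q' + Q' * (R * (M + N)) + Q' * (R * (N * C)) := by
        gcongr
        simp only [L] at hL; omega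
    _ = Q' * M * R + Q' * (R * (N + N * C) + 1) := by ring
    _ ≤ Q' * M * R + Q' * M := by gcongr
    _ = M * Q' * (R + 1) := by ring
end
end Scat

namespace Scat
open Polynomial

section
variable {K S ι : Type*} [Field K] [CommRing S] [Algebra K S] [Algebra K[X] S]
  [IsScalarTower K K[X] S] [Fintype ι] (b : Module.Basis ι K[X] S)

noncomputable def filt (n : ℕ) : Submodule K S :=
  (Submodule.pi Set.univ (fun _ : ι => degreeLT K n)).comap
    (b.equivFun.toLinearMap.restrictScalars K)

theorem mem_filt {n : ℕ} {x : S} : x ∈ filt b n ↔ ∀ i, b.equivFun x i ∈ degreeLT K n := by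
  simp [filt, Submodule.mem_pi]

theorem filt_mono : Monotone (filt (K := K) b) := by
  intro m n h x hx
  rw [mem_filt] at *
  exact fun i => degreeLT_mono h (hx i)

theorem filt_smul {n m : ℕ} {P : K[X]} {x : S} (hP : P ∈ degreeLT K n) (hx : x ∈ filt b m) :
    P • x ∈ filt b (n + m) := by
  rw [mem_filt] at *
  intro i
  have := hx i
  rw [map_smul, Pi.smul_apply, smul_eq_mul]
  rw [mem_degreeLT] at *
  rcases eq_or_ne P 0 with rfl | hP0
  · simp
  rcases eq_or_ne (b.equivFun x i) 0 with h0 | h0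
  · simp [h0]
  rw [degree_mul, degree_eq_natDegree hP0, degree_eq_natDegree h0] at *
  norm_cast at *
  omega

noncomputable def filtEquiv (n : ℕ) : filt (K := K) b n ≃ₗ[K] (ι → Fin n → K) :=
  LinearEquiv.trans
    { toFun := fun x => fun i => (⟨b.equivFun x i, (mem_filt b).mp x.2 i⟩ : degreeLT K n)
      map_add' := by intro x y; ext; simp
      map_smul' := by
        intro c x
        have : b.equivFun (c • (x:S)) = c • b.equivFun (x:S) :=
          (b.equivFun.toLinearMap.restrictScalars K).map_smul c (x:S)
        ext i
        simp [this]
      invFun := fun f => ⟨b.equivFun.symm (fun i => (f i : K[X])), by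
        rw [mem_filt]; intro i; rw [LinearEquiv.apply_symm_apply]; exact (f i).2⟩
      left_inv := by intro x; ext; simp
      right_inv := by
        intro x; funext i; apply Subtype.ext
        exact congrFun (b.equivFun.apply_symm_apply (fun i => (x i : K[X]))) i }
    (LinearEquiv.piCongrRight (fun _ => degreeLTEquiv K n))

theorem filt_data : ∃ C, FilData K S (filt b) (Fintype.card ι) C := by
  classical
  have hex : ∀ x : S, ∃ n, x ∈ filt b n := by
    intro x
    refine ⟨Finset.univ.sup (fun i => (b.equivFun x i).natDegree + 1), ?_⟩
    rw [mem_filt]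
    intro i
    rw [mem_degreeLT]
    refine lt_of_le_of_lt degree_le_natDegree ?_
    have : (b.equivFun x i).natDegree + 1 ≤
      Finset.univ.sup (fun i => (b.equivFun x i).natDegree + 1) :=
      Finset.le_sup (f := fun i => (b.equivFun x i).natDegree + 1) (Finset.mem_univ i)
    exact_mod_cast this
  choose cc hcc using hex
  let C := Finset.univ.sup (fun ij : ι × ι => cc (b ij.1 * b ij.2))
  have hC : ∀ i k, b i * b k ∈ filt b C := by
    intro i k
    exact filt_mono b (Finset.le_sup (f := fun ij : ι × ι => cc (b ij.1 * b ij.2))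
      (Finset.mem_univ (i, k))) (hcc _)
  refine ⟨C, filt_mono b, fun n => ?_, fun n => ?_, ?_, fun x => ⟨cc x, hcc x⟩⟩
  · exact Module.Finite.equiv (filtEquiv b n).symm
  · rw [(filtEquiv b n).finrank_eq, Module.finrank_pi_fintype]
    simp
  · intro n m x y hx hy
    rw [← b.sum_equivFun x, ← b.sum_equivFun y, Finset.sum_mul_sum]
    refine Submodule.sum_mem _ fun i _ => Submodule.sum_mem _ fun k _ => ?_
    rw [smul_mul_smul_comm, mul_smul, add_assoc]
    exact filt_smul b ((mem_filt b).mp hx i) (filt_smul b ((mem_filt b).mp hy k) (hC i k))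

theorem filt_map (σ : K →+* K) (s : S →+* S)
    (hs : ∀ P, s (algebraMap K[X] S P) = algebraMap K[X] S (P.map σ)) {C0 : ℕ}
    (hC0 : ∀ i, s (b i) ∈ filt b C0) {n : ℕ} {x : S} (hx : x ∈ filt b n) :
    s x ∈ filt b (n + C0) := by
  rw [← b.sum_equivFun x, map_sum]
  refine Submodule.sum_mem _ fun i _ => ?_
  rw [Algebra.smul_def, map_mul, hs, ← Algebra.smul_def]
  refine filt_smul b ?_ (hC0 i)
  have := (mem_filt b).mp hx i
  rw [mem_degreeLT] at *
  exact degree_map_le.trans_lt this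

theorem stepanov_alg (p : ℕ) [Fact p.Prime] [CharP K p] [IsAlgClosed K] [IsDomain S]
    [Module.Finite K[X] S] [Module.Free K[X] S] (j : S →ₐ[K] PowerSeries K)
    (hj : Function.Injective j) {τ : S} (hτ : j τ = PowerSeries.X)
    (V : Set S) (hVf : V.Finite) (hV : Algebra.adjoin K[X] V = ⊤) (R : ℕ) :
    ∃ Q0 : ℕ, ∀ n : ℕ, Q0 ≤ p ^ n → ∀ s : S →+* S,
    (∀ P, s (algebraMap K[X] S P) = algebraMap K[X] S (P.map (iterateFrobenius K p n))) →
    (∀ v ∈ V, s v ∈ V) →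
    ∀ Z : Finset (S →ₐ[K] K), (∀ χ ∈ Z, ∀ w, χ (s w) = χ w ^ p ^ n) →
    R * Z.card ≤ p ^ n * (R + 1) := by
  classical
  let b := Module.Free.chooseBasis K[X] S
  obtain ⟨C, hfil⟩ := filt_data (K := K) b
  have hunif : ∀ w : S, ∃ Cw, ∀ n : ℕ, ∀ s : S →+* S,
      (∀ P, s (algebraMap K[X] S P) = algebraMap K[X] S (P.map (iterateFrobenius K p n))) →
      (∀ v ∈ V, s v ∈ V) → s w ∈ filt b Cw := by
    intro w
    have hw : w ∈ Algebra.adjoin K[X] V := hV ▸ Algebra.mem_top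
    induction hw using Algebra.adjoin_induction with
    | mem v hv =>
      choose cc hcc using hfil.exh
      refine ⟨hVf.toFinset.sup cc, fun n s _ hs => ?_⟩
      exact filt_mono b (Finset.le_sup (by simpa using hs v hv)) (hcc _)
    | algebraMap P =>
      obtain ⟨c1, hc1⟩ := hfil.exh (1 : S)
      refine ⟨P.natDegree + 1 + c1, fun n s hs _ => ?_⟩
      rw [hs, Algebra.algebraMap_eq_smul_one]
      refine filt_smul b ?_ hc1
      rw [mem_degreeLT]
      refine degree_map_le.trans_lt (degree_le_natDegree.trans_lt ?_)
      norm_cast; omega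
    | add x y _ _ hx hy =>
      obtain ⟨c1, h1⟩ := hx
      obtain ⟨c2, h2⟩ := hy
      refine ⟨c1 + c2, fun n s hs hs' => ?_⟩
      rw [map_add]
      exact Submodule.add_mem _ (filt_mono b (by omega) (h1 n s hs hs'))
        (filt_mono b (by omega) (h2 n s hs hs'))
    | mul x y _ _ hx hy =>
      obtain ⟨c1, h1⟩ := hx
      obtain ⟨c2, h2⟩ := hy
      refine ⟨c1 + c2 + C, fun n s hs hs' => ?_⟩
      rw [map_mul]
      exact hfil.mul _ _ _ _ (h1 n s hs hs') (h2 n s hs hs')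
  choose cc hcc using hunif
  let C' := Finset.univ.sup (fun i => cc (b i))
  have hN : 0 < Fintype.card (Module.Free.ChooseBasisIndex K[X] S) := Fintype.card_pos
  obtain ⟨Q0, hQ0⟩ := stepanov p hfil j hj hτ hN C' R
  refine ⟨Q0, fun n hn s hs hsV Z hZ => hQ0 n hn s ?_ ?_ Z hZ⟩
  · intro k
    have := hs (Polynomial.C k)
    rw [map_C, iterateFrobenius_def] at this
    rw [IsScalarTower.algebraMap_apply K K[X] S, IsScalarTower.algebraMap_apply K K[X] S]
    exact this
  · intro m x hx
    refine filt_map b _ s hs (fun i => ?_) hx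
    exact filt_mono b (Finset.le_sup (f := fun i => cc (b i)) (Finset.mem_univ i))
      (hcc _ n s hs hsV)

end
end Scat

namespace Scat
open Polynomial

/-- evaluation of the `q`-polynomial with coefficients `φ 0, …, φ k` -/
def ev {A : Type*} [CommRing A] (q k : ℕ) (φ : ℕ → A) (z : A) : A :=
  ∑ i ∈ Finset.range (k + 1), φ i * z ^ q ^ i

noncomputable def evp {A : Type*} [CommRing A] (q k : ℕ) (φ : ℕ → A) : A[X] :=
  ∑ i ∈ Finset.range (k + 1), Polynomial.C (φ i) * X ^ q ^ i

section
variable {A B : Type*} [CommRing A] [CommRing B]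

theorem eval_evp (q k : ℕ) (φ : ℕ → A) (z : A) : (evp q k φ).eval z = ev q k φ z := by
  simp [evp, ev, eval_finsetSum]

theorem map_evp (q k : ℕ) (φ : ℕ → A) (f : A →+* B) :
    (evp q k φ).map f = evp q k (fun i => f (φ i)) := by
  simp [evp, Polynomial.map_sum]

theorem map_ev (q k : ℕ) (φ : ℕ → A) (f : A →+* B) (z : A) :
    f (ev q k φ z) = ev q k (fun i => f (φ i)) (f z) := by
  simp [ev]

theorem ev_congr {q k : ℕ} {φ ψ : ℕ → A} (h : ∀ i ≤ k, φ i = ψ i) (z : A) :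
    ev q k φ z = ev q k ψ z := by
  refine Finset.sum_congr rfl fun i hi => ?_
  rw [h i (by simpa [Nat.lt_succ_iff] using hi)]

variable {p e q : ℕ} [Fact p.Prime] [CharP A p]

theorem add_pow_q (hq : q = p ^ e) (i : ℕ) (x y : A) :
    (x + y) ^ q ^ i = x ^ q ^ i + y ^ q ^ i := by
  have : ExpChar A p := ExpChar.prime Fact.out
  rw [hq, ← pow_mul]; exact add_pow_char_pow x y p _

theorem sub_pow_q (hq : q = p ^ e) (i : ℕ) (x y : A) :
    (x - y) ^ q ^ i = x ^ q ^ i - y ^ q ^ i := by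
  have : ExpChar A p := ExpChar.prime Fact.out
  rw [hq, ← pow_mul]; exact sub_pow_char_pow x y _

theorem neg_pow_q (hq : q = p ^ e) (i : ℕ) (x : A) :
    (-x) ^ q ^ i = -x ^ q ^ i := by
  have h := sub_pow_q hq i 0 x
  have hq0 : q ^ i ≠ 0 := by
    have := (Fact.out : p.Prime).pos
    rw [hq]; positivity
  simpa [zero_pow hq0] using h

theorem ev_add (hq : q = p ^ e) (k : ℕ) (φ : ℕ → A) (x y : A) :
    ev q k φ (x + y) = ev q k φ x + ev q k φ y := by
  simp only [ev, add_pow_q hq, mul_add, Finset.sum_add_distrib]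

theorem ev_sub (hq : q = p ^ e) (k : ℕ) (φ : ℕ → A) (x y : A) :
    ev q k φ (x - y) = ev q k φ x - ev q k φ y := by
  simp only [ev, sub_pow_q hq, mul_sub, Finset.sum_sub_distrib]

theorem ev_zero (hq0 : q ≠ 0) (k : ℕ) (φ : ℕ → A) : ev q k φ 0 = 0 := by
  refine Finset.sum_eq_zero fun i _ => ?_
  rw [zero_pow (pow_ne_zero _ hq0), mul_zero]

theorem pow_q_pow {c : A} (hc : c ^ q = c) (i : ℕ) : c ^ q ^ i = c := by
  induction i with
  | zero => simp
  | succ i ih => rw [pow_succ, pow_mul, ih, hc]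

theorem ev_smul {c : A} (hc : c ^ q = c) (k : ℕ) (φ : ℕ → A) (x : A) :
    ev q k φ (c * x) = c * ev q k φ x := by
  simp only [ev, Finset.mul_sum, mul_pow, pow_q_pow hc]
  exact Finset.sum_congr rfl fun i _ => by ring

end

section
variable {A : Type*} [Field A] {p e q : ℕ} [Fact p.Prime] [CharP A p]

theorem one_lt_q (he : 0 < e) (hq : q = p ^ e) : 1 < q := by
  rw [hq]; exact Nat.one_lt_pow he.ne' (Fact.out : p.Prime).one_lt

theorem evp_coeff (hq1 : 1 < q) (k : ℕ) (φ : ℕ → A) (i : ℕ) (hi : i ≤ k) :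
    (evp q k φ).coeff (q ^ i) = φ i := by
  simp only [evp, finsetSum_coeff, coeff_C_mul, coeff_X_pow]
  rw [Finset.sum_eq_single i]
  · simp
  · intro b _ hb
    rw [if_neg, mul_zero]
    intro h
    exact hb (Nat.pow_right_injective hq1 h).symm
  · intro h; simp at h; omega

theorem evp_natDegree_le (hq1 : 1 < q) (k : ℕ) (φ : ℕ → A) : (evp q k φ).natDegree ≤ q ^ k := by
  refine natDegree_sum_le_of_forall_le _ _ fun i hi => ?_
  refine (natDegree_C_mul_X_pow_le _ _).trans ?_
  exact Nat.pow_le_pow_right (by omega) (by simpa [Nat.lt_succ_iff] using hi)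

theorem evp_natDegree (hq1 : 1 < q) (k : ℕ) (φ : ℕ → A) (hk : φ k ≠ 0) :
    (evp q k φ).natDegree = q ^ k := by
  refine le_antisymm (evp_natDegree_le hq1 k φ) (le_natDegree_of_ne_zero ?_)
  rwa [evp_coeff hq1 k φ k le_rfl]

theorem evp_ne_zero (hq1 : 1 < q) (k : ℕ) (φ : ℕ → A) {i : ℕ} (hi : i ≤ k) (hk : φ i ≠ 0) :
    evp q k φ ≠ 0 := by
  intro h
  apply hk
  rw [← evp_coeff hq1 k φ i hi, h, coeff_zero]

theorem evp_derivative (he : 0 < e) (hq : q = p ^ e) (k : ℕ) (φ : ℕ → A) :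
    derivative (evp q k φ) = Polynomial.C (φ 0) := by
  simp only [evp, derivative_sum, derivative_C_mul_X_pow]
  rw [Finset.sum_eq_single 0]
  · simp
  · intro b _ hb
    have : ((q ^ b : ℕ) : A) = 0 := by
      rw [CharP.cast_eq_zero_iff A p, hq, ← pow_mul]
      exact dvd_pow_self p (by positivity)
    rw [this]; simp
  · simp

theorem evp_separable (he : 0 < e) (hq : q = p ^ e) (k : ℕ) (φ : ℕ → A) (h0 : φ 0 ≠ 0) :
    (evp q k φ).Separable := by
  rw [Polynomial.Separable, evp_derivative he hq]
  exact isCoprime_of_isUnit_right (isUnit_C.mpr (isUnit_iff_ne_zero.mpr h0))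
where
  isCoprime_of_isUnit_right {R : Type _} [CommRing R] {a b : R} (h : IsUnit b) : IsCoprime a b :=
    (isCoprime_comm.mp ⟨h.unit⁻¹.val, 0, by simp⟩)

def rts (q k : ℕ) (φ : ℕ → A) : Set A := {x | ev q k φ x = 0}

theorem rts_eq (hq1 : 1 < q) (k : ℕ) (φ : ℕ → A) {i : ℕ} (hi : i ≤ k) (hk : φ i ≠ 0) :
    rts q k φ = (evp q k φ).rootSet A := by
  ext x
  rw [mem_rootSet_of_ne (evp_ne_zero hq1 k φ hi hk), coe_aeval_eq_eval, eval_evp]; rfl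

theorem rts_finite (hq1 : 1 < q) (k : ℕ) (φ : ℕ → A) {i : ℕ} (hi : i ≤ k) (hk : φ i ≠ 0) :
    (rts q k φ).Finite := by
  rw [rts_eq hq1 k φ hi hk]; exact rootSet_finite _ _

theorem rts_card_le (hq1 : 1 < q) (k : ℕ) (φ : ℕ → A) {i : ℕ} (hi : i ≤ k) (hk : φ i ≠ 0) :
    (rts q k φ).ncard ≤ q ^ k := by
  rw [rts_eq hq1 k φ hi hk]
  exact (ncard_rootSet_le _ _).trans (evp_natDegree_le hq1 k φ)

theorem rts_card_of_splits (he : 0 < e) (hq : q = p ^ e) (k : ℕ) (φ : ℕ → A) (h0 : φ 0 ≠ 0)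
    (hk : φ k ≠ 0) (hs : (evp q k φ).Splits) : (rts q k φ).ncard = q ^ k := by
  have hq1 := one_lt_q (p := p) he hq
  rw [rts_eq hq1 k φ le_rfl hk, ← evp_natDegree hq1 k φ hk, Set.ncard_eq_toFinset_card',
    Set.toFinset_card]
  exact card_rootSet_eq_natDegree (evp_separable he hq k φ h0) (by simpa using hs)

end

section
variable {K : Type*} [Field K] {p e q : ℕ} [Fact p.Prime] [CharP K p]

open PowerSeries in
theorem X_pow_all {z : PowerSeries K} (h : ∀ n, (PowerSeries.X : PowerSeries K) ^ n ∣ z) :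
    z = 0 := by
  ext n
  exact X_pow_dvd_iff.mp (h (n + 1)) n (Nat.lt_succ_self n)

instance instCharPPowerSeries : CharP (PowerSeries K) p :=
  charP_of_injective_algebraMap (algebraMap K (PowerSeries K)).injective p

/-- the contraction map -/
noncomputable def ctr (q k : ℕ) (φ : ℕ → PowerSeries K) (z : PowerSeries K) : PowerSeries K :=
  -((φ 0)⁻¹ * ∑ i ∈ Finset.range k, φ (i + 1) * z ^ q ^ (i + 1))

theorem ev_ctr (q k : ℕ) (φ : ℕ → PowerSeries K) (h0 : PowerSeries.constantCoeff (φ 0) ≠ 0)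
    (z : PowerSeries K) : ev q k φ z = φ 0 * (z - ctr q k φ z) := by
  rw [ev, Finset.sum_range_succ', ctr, sub_neg_eq_add, mul_add, ← mul_assoc,
    PowerSeries.mul_inv_cancel _ h0]
  simp [add_comm]

theorem ctr_dvd (he : 0 < e) (hq : q = p ^ e) (k : ℕ) (φ : ℕ → PowerSeries K)
    {x y : PowerSeries K} {m : ℕ} (hm : 1 ≤ m) (h : PowerSeries.X ^ m ∣ x - y) :
    PowerSeries.X ^ (m + 1) ∣ ctr q k φ x - ctr q k φ y := by
  have hq1 := one_lt_q (p := p) he hq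
  have : ctr q k φ x - ctr q k φ y =
      -((φ 0)⁻¹ * ∑ i ∈ Finset.range k, φ (i + 1) * (x - y) ^ q ^ (i + 1)) := by
    simp only [ctr, sub_pow_q (p := p) hq, mul_sub, Finset.sum_sub_distrib]
    ring
  rw [this, dvd_neg]
  refine Dvd.dvd.mul_left (Finset.dvd_sum fun i _ => Dvd.dvd.mul_left ?_ _) _
  have h2 := pow_dvd_pow_of_dvd h (q ^ (i + 1))
  rw [← pow_mul] at h2
  refine (pow_dvd_pow _ ?_).trans h2
  have : 2 ≤ q ^ (i + 1) := by
    rw [pow_succ]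
    have : 1 ≤ q ^ i := Nat.one_le_pow _ _ (by omega)
    nlinarith
  nlinarith

theorem hensel_unique (he : 0 < e) (hq : q = p ^ e) (k : ℕ) (φ : ℕ → PowerSeries K)
    (h0 : PowerSeries.constantCoeff (φ 0) ≠ 0) {x y : PowerSeries K}
    (hx : ev q k φ x = 0) (hy : ev q k φ y = 0)
    (hxy : PowerSeries.constantCoeff x = PowerSeries.constantCoeff y) : x = y := by
  have hφ : φ 0 ≠ 0 := fun h => h0 (by simp [h])
  rw [ev_ctr q k φ h0, mul_eq_zero, or_iff_right hφ, sub_eq_zero] at hx hy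
  rw [← sub_eq_zero]
  have key : ∀ n, (PowerSeries.X : PowerSeries K) ^ (n+1) ∣ x - y := by
    intro n
    induction n with
    | zero =>
      rw [zero_add, pow_one, PowerSeries.X_dvd_iff, map_sub, hxy, sub_self]
    | succ n ih =>
      rw [hx, hy]; exact ctr_dvd he hq k φ (by omega) ih
  exact X_pow_all fun n => (pow_dvd_pow _ (Nat.le_succ n)).trans (key n)

theorem hensel_exists (he : 0 < e) (hq : q = p ^ e) (k : ℕ) (φ : ℕ → PowerSeries K)
    (h0 : PowerSeries.constantCoeff (φ 0) ≠ 0) (c : K)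
    (hc : ev q k (fun i => PowerSeries.constantCoeff (φ i)) c = 0) :
    ∃ z, ev q k φ z = 0 ∧ PowerSeries.constantCoeff z = c := by
  have hφ : φ 0 ≠ 0 := fun h => h0 (by simp [h])
  let z : ℕ → PowerSeries K := fun n => (ctr q k φ)^[n] (PowerSeries.C c)
  have hz : ∀ n, z (n + 1) = ctr q k φ (z n) := fun n => Function.iterate_succ_apply' _ _ _
  have hstep : ∀ n, PowerSeries.X ^ (n + 1) ∣ z (n + 1) - z n := by
    intro n
    induction n with
    | zero =>
      have h1 := map_ev q k φ PowerSeries.constantCoeff (PowerSeries.C c)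
      rw [PowerSeries.constantCoeff_C, hc, ev_ctr q k φ h0, map_mul, mul_eq_zero, or_iff_right h0]
        at h1
      rw [zero_add, pow_one, PowerSeries.X_dvd_iff, hz, ← neg_eq_zero, ← map_neg, neg_sub]
      exact h1
    | succ n ih =>
      rw [hz (n+1), hz n]; rw [hz n] at ih
      exact ctr_dvd he hq k φ (by omega) ih
  have hstep' : ∀ n m, n ≤ m → PowerSeries.X ^ (n + 1) ∣ z m - z n := by
    intro n m hnm
    induction m, hnm using Nat.le_induction with
    | base => simp
    | succ m hm ih =>
      have : z (m+1) - z n = (z (m+1) - z m) + (z m - z n) := by ring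
      rw [this]
      exact dvd_add ((pow_dvd_pow _ (by omega)).trans (hstep m)) ih
  let Z : PowerSeries K := PowerSeries.mk fun n => PowerSeries.coeff n (z n)
  have hZ : ∀ n, PowerSeries.X ^ (n + 1) ∣ Z - z n := by
    intro n
    rw [PowerSeries.X_pow_dvd_iff]
    intro i hi
    have := PowerSeries.X_pow_dvd_iff.mp (hstep' i n (by omega)) i (by omega)
    rw [map_sub, sub_eq_zero] at this
    simp [Z, this]
  refine ⟨Z, ?_, ?_⟩
  · rw [ev_ctr q k φ h0, mul_eq_zero, or_iff_right hφ]
    apply X_pow_all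
    intro n
    have h1 : Z - ctr q k φ Z = (Z - z (n+1)) - (ctr q k φ Z - ctr q k φ (z n)) := by
      rw [hz]; ring
    rw [h1]
    exact dvd_sub ((pow_dvd_pow _ (by omega)).trans (hZ (n+1)))
      ((pow_dvd_pow _ (by omega)).trans (ctr_dvd he hq k φ (by omega) (hZ n)))
  · have := hZ 0
    rw [zero_add, pow_one, PowerSeries.X_dvd_iff, map_sub, sub_eq_zero] at this
    rw [this]; simp [z]

/-- all roots in an overfield come from `K[[t]]` -/
theorem hensel_all [IsAlgClosed K] (he : 0 < e) (hq : q = p ^ e) (k : ℕ) (φ : ℕ → PowerSeries K)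
    (h0 : PowerSeries.constantCoeff (φ 0) ≠ 0) (hk : PowerSeries.constantCoeff (φ k) ≠ 0)
    {A : Type*} [Field A] (f : PowerSeries K →+* A) (hf : Function.Injective f) (x : A)
    (hx : ev q k (fun i => f (φ i)) x = 0) : ∃ z, f z = x ∧ ev q k φ z = 0 := by
  have hq1 := one_lt_q (p := p) he hq
  have hφ : φ 0 ≠ 0 := fun h => h0 (by simp [h])
  have hφ' : f (φ 0) ≠ 0 := by rwa [Ne, map_eq_zero_iff f hf]
  choose! g hg hg' using hensel_exists he hq k φ h0
  let Rk := rts q k (fun i => PowerSeries.constantCoeff (φ i))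
  have hcard : Rk.ncard = q ^ k := rts_card_of_splits he hq k _ h0 hk (IsAlgClosed.splits _)
  have hinj : Set.InjOn (fun c => f (g c)) Rk := by
    intro c hc c' hc' h
    rw [← hg' c hc, ← hg' c' hc', hf h]
  have himg : (fun c => f (g c)) '' Rk ⊆ rts q k (fun i => f (φ i)) := by
    rintro _ ⟨c, hc, rfl⟩
    have := hg c hc
    show ev _ _ _ _ = 0
    rw [← map_ev, this, map_zero]
  have heq := Set.eq_of_subset_of_ncard_le himg (by
    rw [hinj.ncard_image, hcard]
    exact rts_card_le hq1 k _ (Nat.zero_le _) hφ')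
    (rts_finite hq1 k _ (Nat.zero_le _) hφ')
  have : x ∈ (fun c => f (g c)) '' Rk := heq ▸ hx
  obtain ⟨c, hc, rfl⟩ := this
  exact ⟨g c, rfl, hg c hc⟩

end
end Scat

set_option linter.all false
namespace Scat
open Polynomial

theorem joint_surj {K S : Type*} [Field K] [CommRing S] [Algebra K S] (Z : Finset (S →ₐ[K] K))
    (f : (S →ₐ[K] K) → K) : ∃ w : S, ∀ χ ∈ Z, χ w = f χ := by
  classical
  let π : S →ₗ[K] (Z → K) := LinearMap.pi fun χ => χ.1.toLinearMap
  have hπ : Function.Surjective π := by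
    rw [← LinearMap.range_eq_top]
    by_contra hne
    obtain ⟨f, hf0, hf⟩ := Submodule.exists_le_ker_of_lt_top _ (lt_top_iff_ne_top.mpr hne)
    have hind : LinearIndependent K (fun χ : Z => ((χ.1 : S →* K) : S → K)) := by
      refine (linearIndependent_monoidHom S K).comp (fun χ : Z => (χ.1 : S →* K)) ?_
      intro χ χ' hh
      apply Subtype.ext
      ext x
      exact DFunLike.congr_fun hh x
    rw [Fintype.linearIndependent_iff] at hind
    apply hf0
    have key := hind (fun χ => f (fun j => if χ = j then 1 else 0)) (by
      ext x
      have : f (π x) = 0 := hf ⟨x, rfl⟩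
      rw [LinearMap.pi_apply_eq_sum_univ] at this
      simpa [π, mul_comm] using this)
    apply LinearMap.ext
    intro x
    rw [LinearMap.pi_apply_eq_sum_univ]
    simp only [key]
    simp
  obtain ⟨w, hw⟩ := hπ fun χ => f χ.1
  exact ⟨w, fun χ hχ => congrFun hw ⟨χ, hχ⟩⟩

theorem exists_extend {E Ω A : Type*} [Field E] [Field Ω] [Field A] [Algebra E Ω]
    [Algebra.IsAlgebraic E Ω] [IsAlgClosed A] (f : E →+* A) :
    ∃ F : Ω →+* A, ∀ x, F (algebraMap E Ω x) = f x := by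
  let _ := f.toAlgebra
  let F : Ω →ₐ[E] A := IsAlgClosed.lift
  exact ⟨F, fun x => F.commutes x⟩

theorem card_fixed (K : Type*) [Field K] [IsAlgClosed K] (p : ℕ) [Fact p.Prime] [CharP K p]
    (n : ℕ) (hn : 0 < n) : {x : K | x ^ p ^ n = x}.ncard = p ^ n := by
  have h := rts_card_of_splits (A := K) (p := p) (e := 1) (q := p) one_pos (by simp) n
    (fun i => if i = 0 then -1 else if i = n then 1 else 0) (by simp) (by simp [hn.ne'])
    (IsAlgClosed.splits _)
  refine Eq.trans ?_ h
  clear h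
  congr 1
  ext x
  change _ ↔ ev _ _ _ _ = 0
  simp only [ev, Set.mem_ofPred_eq]
  rw [Finset.sum_range_succ', Finset.sum_eq_single (n - 1)]
  · have : n - 1 + 1 = n := by omega
    simp [this, hn.ne', add_neg_eq_zero]
  · intro b _ hb
    have : ¬ (b + 1 = n) := by omega
    simp [this]
  · intro h; simp at h; omega

section
variable {K E Ω : Type*} [Field K] [Field E] [Field Ω] [Algebra K[X] E] [IsFractionRing K[X] E]
  [Algebra E Ω] [Algebra K[X] Ω] [IsScalarTower K[X] E Ω] [Algebra K Ω] [IsScalarTower K K[X] Ω]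

variable (Ω) in
abbrev VV (q k : ℕ) (c : ℕ → K[X]) : Set Ω := rts q k (fun i => algebraMap K[X] Ω (c i))

variable (Ω) in
noncomputable abbrev SS (q k : ℕ) (c : ℕ → K[X]) : Subalgebra K[X] Ω := Algebra.adjoin K[X] (VV Ω q k c)

theorem VV_sub {q k : ℕ} {c : ℕ → K[X]} {x : Ω} (hx : x ∈ VV Ω q k c) : x ∈ SS Ω q k c :=
  Algebra.subset_adjoin hx

include E in
variable (E Ω) in
theorem algMap_inj : Function.Injective (algebraMap K[X] Ω) := by
  rw [IsScalarTower.algebraMap_eq K[X] E Ω]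
  exact (algebraMap E Ω).injective.comp (IsFractionRing.injective K[X] E)

variable {q k : ℕ} {c : ℕ → K[X]}

theorem VV_integral (hq1 : 1 < q) (hk : c k = 1) {x : Ω} (hx : x ∈ VV Ω q k c) :
    IsIntegral K[X] x := by
  refine ⟨evp q k c, ?_, ?_⟩
  · have h1 : (evp q k c).natDegree ≤ q ^ k := by
      refine natDegree_sum_le_of_forall_le _ _ fun i hi => ?_
      refine (natDegree_C_mul_X_pow_le _ _).trans ?_
      exact Nat.pow_le_pow_right (by omega) (by simpa [Nat.lt_succ_iff] using hi)
    refine monic_of_natDegree_le_of_coeff_eq_one _ h1 ?_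
    simp only [evp, finsetSum_coeff, coeff_C_mul, coeff_X_pow]
    rw [Finset.sum_eq_single k]
    · simp [hk]
    · intro b _ hb
      rw [if_neg, mul_zero]
      intro h
      exact hb (Nat.pow_right_injective hq1 h).symm
    · intro h; simp at h
  · rw [← eval_map, map_evp, eval_evp]; exact hx

include E in
variable (E) in
theorem VV_finite (hq1 : 1 < q) (hc0 : c 0 ≠ 0) : (VV Ω q k c).Finite := by
  refine rts_finite hq1 k _ (Nat.zero_le _) ?_
  rwa [Ne, map_eq_zero_iff _ (algMap_inj (K := K) E Ω)]

include E in
variable (E) in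
theorem SS_finite (hq1 : 1 < q) (hc0 : c 0 ≠ 0) (hk : c k = 1) :
    Module.Finite K[X] (SS Ω q k c) := by
  have := fg_adjoin_of_finite (R := K[X]) (VV_finite (Ω := Ω) E hq1 hc0)
    (fun x hx => VV_integral hq1 hk hx)
  exact Module.Finite.iff_fg.mpr this

include E in
variable (E) in
theorem SS_free (hq1 : 1 < q) (hc0 : c 0 ≠ 0) (hk : c k = 1) :
    Module.Free K[X] (SS Ω q k c) := by
  have := SS_finite (Ω := Ω) E hq1 hc0 hk
  have : Module.IsTorsionFree K[X] Ω := by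
    rw [Module.isTorsionFree_iff_algebraMap_injective]
    exact algMap_inj E Ω
  infer_instance

variable {p e : ℕ} [Fact p.Prime] [CharP K p] [IsAlgClosed K]

/-- power series expansion of `S` at a good place -/
theorem exists_psr [Algebra.IsAlgebraic E Ω] (he : 0 < e) (hq : q = p ^ e)
    (hk : c k = 1) (l : K) (hl : (c 0).eval l ≠ 0) :
    ∃ j : SS Ω q k c →ₐ[K] PowerSeries K, Function.Injective j ∧
      ∀ P : K[X], j (algebraMap K[X] _ P) =
        Polynomial.aeval (PowerSeries.C l + PowerSeries.X : PowerSeries K) P := by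
  let f0 : K[X] →ₐ[K] PowerSeries K :=
    Polynomial.aeval (PowerSeries.C l + PowerSeries.X : PowerSeries K)
  have hf0c : ∀ P, PowerSeries.constantCoeff (f0 P) = P.eval l := by
    intro P
    simp only [f0]
    rw [aeval_def, hom_eval₂]
    simp only [map_add, PowerSeries.constantCoeff_C, PowerSeries.constantCoeff_X, add_zero]
    have : (PowerSeries.constantCoeff (R := K)).comp (algebraMap K (PowerSeries K))
        = RingHom.id K := by
      ext x; simp [PowerSeries.algebraMap_apply]
    rw [this]; rfl
  have hf0 : Function.Injective f0 := by
    have h1 : ∀ P : K[X], f0 (P.comp (X - Polynomial.C l)) = (P : PowerSeries K) := by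
      intro P
      simp only [f0, aeval_comp]
      have : (aeval (PowerSeries.C l + PowerSeries.X : PowerSeries K)) (X - Polynomial.C l)
          = (PowerSeries.X : PowerSeries K) := by
        simp [PowerSeries.algebraMap_apply]
      rw [this]
      induction P using Polynomial.induction_on' with
      | add p q hp hq => simp [hp, hq]
      | monomial n a =>
        simp [aeval_monomial, PowerSeries.algebraMap_apply, ← C_mul_X_pow_eq_monomial]
    rw [injective_iff_map_eq_zero]
    intro P hP
    have h2 := h1 (P.comp (X + Polynomial.C l))
    rw [comp_assoc] at h2
    simp only [sub_comp, add_comp, X_comp, C_comp, sub_add_cancel, comp_X] at h2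
    rw [hP] at h2
    have h3 : P.comp (X + Polynomial.C l) = 0 := by
      rw [← Polynomial.coe_eq_zero_iff]; exact h2.symm
    have h4 : (P.comp (X + Polynomial.C l)).comp (X - Polynomial.C l) = P := by
      rw [comp_assoc]; simp
    rw [← h4, h3, zero_comp]
  let Fr := FractionRing (PowerSeries K)
  let A := AlgebraicClosure Fr
  let ι : PowerSeries K →+* A := algebraMap (PowerSeries K) A
  have hι : Function.Injective ι := by
    have : ι = (algebraMap Fr A).comp (algebraMap (PowerSeries K) Fr) :=
      IsScalarTower.algebraMap_eq (PowerSeries K) Fr A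
    rw [this]
    exact (algebraMap Fr A).injective.comp (IsFractionRing.injective _ Fr)
  have hinj : Function.Injective (ι.comp (f0 : K[X] →+* PowerSeries K)) := hι.comp hf0
  let f1 : E →+* A := IsFractionRing.lift hinj
  obtain ⟨F, hF⟩ := exists_extend (Ω := Ω) f1
  have hFP : ∀ P : K[X], F (algebraMap K[X] Ω P) = ι (f0 P) := by
    intro P
    rw [IsScalarTower.algebraMap_apply K[X] E Ω, hF]
    exact IsFractionRing.lift_algebraMap hinj P
  have hmem : ∀ x ∈ SS Ω q k c, F x ∈ ι.range := by
    intro x hx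
    induction hx using Algebra.adjoin_induction with
    | mem v hv =>
      have hv' : ev q k (fun i => ι (f0 (c i))) (F v) = 0 := by
        have h2 := map_ev q k (fun i => algebraMap K[X] Ω (c i)) F v
        have h3 : ev q k (fun i => algebraMap K[X] Ω (c i)) v = 0 := hv
        rw [h3, map_zero] at h2
        simpa only [hFP] using h2.symm
      obtain ⟨z, hz, _⟩ := hensel_all he hq k (fun i => f0 (c i)) (by rwa [hf0c])
        (by rw [hf0c, hk]; simp) ι hι (F v) hv'
      exact ⟨z, hz⟩
    | algebraMap P => exact ⟨_, (hFP P).symm⟩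
    | add x y _ _ hx hy => rw [map_add]; exact Subring.add_mem _ hx hy
    | mul x y _ _ hx hy => rw [map_mul]; exact Subring.mul_mem _ hx hy
  have hex : ∀ x : SS Ω q k c, ∃ z, ι z = F x := fun x => hmem x x.2
  choose j hj using hex
  have hjP : ∀ P : K[X], j (algebraMap K[X] _ P) = f0 P := by
    intro P
    apply hι
    rw [hj]; exact hFP P
  let j' : SS Ω q k c →ₐ[K] PowerSeries K :=
    { toFun := j
      map_one' := hι (by rw [hj]; simp)
      map_zero' := hι (by rw [hj]; simp)
      map_add' := fun x y => hι (by rw [map_add]; simp only [hj]; simp)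
      map_mul' := fun x y => hι (by rw [map_mul]; simp only [hj]; simp)
      commutes' := fun a => by
        rw [IsScalarTower.algebraMap_apply K K[X] (SS Ω q k c), hjP]
        exact f0.commutes a }
  refine ⟨j', ?_, hjP⟩
  intro x y hxy
  have h1 : j x = j y := hxy
  have h2 := congrArg ι h1
  rw [hj, hj] at h2
  exact Subtype.ext (F.injective h2)

/-- restriction of a semilinear map to `S` -/
theorem exists_restrict (n : ℕ) (hcF : ∀ i, (c i).map (iterateFrobenius K p n) = c i)
    (s : Ω →+* Ω) (hs : ∀ P, s (algebraMap K[X] Ω P) =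
      algebraMap K[X] Ω (P.map (iterateFrobenius K p n))) :
    (∀ v ∈ VV Ω q k c, s v ∈ VV Ω q k c) ∧
    ∃ s' : SS Ω q k c →+* SS Ω q k c, ∀ w, ((s' w : SS Ω q k c) : Ω) = s w := by
  have hV : ∀ v ∈ VV Ω q k c, s v ∈ VV Ω q k c := by
    intro v hv
    have h2 := map_ev q k (fun i => algebraMap K[X] Ω (c i)) s v
    have h3 : ev q k (fun i => algebraMap K[X] Ω (c i)) v = 0 := hv
    rw [h3, map_zero] at h2
    simp only [hs, hcF] at h2
    exact h2.symm
  refine ⟨hV, ?_⟩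
  have hmem : ∀ x ∈ SS Ω q k c, s x ∈ SS Ω q k c := by
    intro x hx
    induction hx using Algebra.adjoin_induction with
    | mem v hv => exact VV_sub (hV v hv)
    | algebraMap P => rw [hs]; exact Subalgebra.algebraMap_mem _ _
    | add x y _ _ hx hy => rw [map_add]; exact Subalgebra.add_mem _ hx hy
    | mul x y _ _ hx hy => rw [map_mul]; exact Subalgebra.mul_mem _ hx hy
  exact ⟨(s.comp (SS Ω q k c).toSubring.subtype).codRestrict (SS Ω q k c).toSubring
    (fun x => hmem x x.2), fun w => rfl⟩

theorem gal_VV (g : Ω ≃ₐ[E] Ω) {v : Ω} (hv : v ∈ VV Ω q k c) : g v ∈ VV Ω q k c := by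
  have h2 := map_ev q k (fun i => algebraMap K[X] Ω (c i)) (g : Ω →+* Ω) v
  have h3 : ev q k (fun i => algebraMap K[X] Ω (c i)) v = 0 := hv
  rw [h3, map_zero] at h2
  have h4 : ∀ P : K[X], (g : Ω →+* Ω) (algebraMap K[X] Ω P) = algebraMap K[X] Ω P := by
    intro P
    rw [IsScalarTower.algebraMap_apply K[X] E Ω]
    exact g.commutes _
  simp only [h4] at h2
  exact h2.symm

/-- restriction of Galois automorphisms to `S` -/
theorem gal_mem (g : Ω ≃ₐ[E] Ω) {x : Ω} (hx : x ∈ SS Ω q k c) : g x ∈ SS Ω q k c := by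
  induction hx using Algebra.adjoin_induction with
  | mem v hv => exact VV_sub (gal_VV g hv)
  | algebraMap P =>
    rw [IsScalarTower.algebraMap_apply K[X] E Ω, g.commutes,
      ← IsScalarTower.algebraMap_apply K[X] E Ω]
    exact Subalgebra.algebraMap_mem _ _
  | add x y _ _ hx hy => rw [map_add]; exact Subalgebra.add_mem _ hx hy
  | mul x y _ _ hx hy => rw [map_mul]; exact Subalgebra.mul_mem _ hx hy

variable (c q k) in
noncomputable def gres (g : Ω ≃ₐ[E] Ω) : SS Ω q k c →ₐ[K[X]] SS Ω q k c :=
  ((g.toAlgHom.restrictScalars K[X]).comp (SS Ω q k c).val).codRestrict (SS Ω q k c)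
    (fun x => gal_mem g x.2)

theorem gres_coe (g : Ω ≃ₐ[E] Ω) (x : SS Ω q k c) : ((gres q k c g x : SS Ω q k c) : Ω) = g x :=
  rfl

theorem fibre_transitive [FiniteDimensional E Ω] [IsGalois E Ω] (hq1 : 1 < q) (hk : c k = 1)
    (χ ψ : SS Ω q k c →ₐ[K] K)
    (h : χ (algebraMap K[X] _ X) = ψ (algebraMap K[X] _ X))  :
    ∃ g : Ω ≃ₐ[E] Ω, ∀ w, χ (gres q k c g w) = ψ w := by
  classical
  by_contra hcon
  push Not at hcon
  let χg : (Ω ≃ₐ[E] Ω) → (SS Ω q k c →ₐ[K] K) :=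
    fun g : Ω ≃ₐ[E] Ω => χ.comp ((gres (E := E) q k c g).restrictScalars K)
  have hne : ∀ g, χg g ≠ ψ := by
    intro g hg
    obtain ⟨w, hw⟩ := hcon g
    exact hw (DFunLike.congr_fun hg w)
  obtain ⟨w, hw⟩ := joint_surj (insert ψ (Finset.univ.image χg)) (fun χ' => if χ' = ψ then 0 else 1)
  have hwψ : ψ w = 0 := by simpa using hw ψ (Finset.mem_insert_self _ _)
  have hwχ : ∀ g : Ω ≃ₐ[E] Ω, χ (gres q k c g w) = 1 := by
    intro g
    have := hw (χg g) (Finset.mem_insert_of_mem (Finset.mem_image_of_mem _ (Finset.mem_univ g)))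
    rw [if_neg (hne g)] at this
    exact this
  let n : SS Ω q k c := ∏ g : Ω ≃ₐ[E] Ω, gres q k c g w
  have hnΩ : (n : Ω) = ∏ g : Ω ≃ₐ[E] Ω, g w := by
    simp only [n, SubmonoidClass.coe_finset_prod, gres_coe]
  have hnE : ∃ y : E, algebraMap E Ω y = n := by
    have := (IsGalois.mem_bot_iff_fixed (F := E) (E := Ω) (n : Ω)).mpr (by
      intro f
      rw [hnΩ, map_prod]
      exact Fintype.prod_equiv (Equiv.mulLeft f) _ _ (fun g => rfl))
    exact IntermediateField.mem_bot.mp this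
  obtain ⟨y, hy⟩ := hnE
  have hIntg : ∀ x ∈ SS Ω q k c, IsIntegral K[X] x := by
    intro x hx
    have : SS Ω q k c ≤ integralClosure K[X] Ω :=
      Algebra.adjoin_le (fun v hv => VV_integral hq1 hk hv)
    exact this hx
  have hyint : IsIntegral K[X] y := by
    have h1 := hIntg n n.2
    rw [← hy] at h1
    exact (isIntegral_algebraMap_iff (algebraMap E Ω).injective).mp h1
  obtain ⟨P, hP⟩ := IsIntegrallyClosed.isIntegral_iff.mp hyint
  have hnP : n = algebraMap K[X] (SS Ω q k c) P := by
    apply Subtype.ext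
    rw [← hy, ← hP]
    exact (IsScalarTower.algebraMap_apply K[X] E Ω P).symm
  have hχP : ∀ χ' : SS Ω q k c →ₐ[K] K, χ' (algebraMap K[X] _ P) =
      P.eval (χ' (algebraMap K[X] _ X)) := by
    intro χ'
    have h1 : (χ'.comp (IsScalarTower.toAlgHom K K[X] (SS Ω q k c))) =
        aeval (χ' (algebraMap K[X] _ X)) := by
      apply Polynomial.algHom_ext
      simp
    have h2 := DFunLike.congr_fun h1 P
    rw [coe_aeval_eq_eval] at h2
    exact h2
  have h1 : χ n = 1 := by simp [n, hwχ]
  have h2 : ψ n = 0 := by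
    simp only [n, map_prod]
    refine Finset.prod_eq_zero (Finset.mem_univ (1 : Ω ≃ₐ[E] Ω)) ?_
    have : gres q k c (1 : Ω ≃ₐ[E] Ω) w = w := Subtype.ext rfl
    rw [this, hwψ]
  rw [hnP, hχP, h, ← hχP, ← hnP, h2] at h1
  exact zero_ne_one h1

theorem chi_inj (hq : q = p ^ e) (he : 0 < e) [CharP Ω p] (χ : SS Ω q k c →ₐ[K] K)
    (hχ : (c 0).eval (χ (algebraMap K[X] _ X)) ≠ 0)
    (x y : SS Ω q k c) (hx : (x : Ω) ∈ VV Ω q k c) (hy : (y : Ω) ∈ VV Ω q k c)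
    (hxy : χ x = χ y) : x = y := by
  have hq1 := one_lt_q (p := p) he hq
  by_contra hne
  let w := x - y
  have hw0 : w ≠ 0 := sub_ne_zero.mpr hne
  have hwχ : χ w = 0 := by simp [w, hxy]
  have hwV : ev q k (fun i => algebraMap K[X] (SS Ω q k c) (c i)) w = 0 := by
    apply Subtype.ext
    have h1 := map_ev q k (fun i => algebraMap K[X] (SS Ω q k c) (c i)) (SS Ω q k c).val.toRingHom w
    have h2 : (SS Ω q k c).val.toRingHom w = (x : Ω) - y := rfl
    rw [h2, ev_sub (A := Ω) (p := p) hq] at h1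
    have h3 : ev q k (fun i => algebraMap K[X] Ω (c i)) (x:Ω) = 0 := hx
    have h4 : ev q k (fun i => algebraMap K[X] Ω (c i)) (y:Ω) = 0 := hy
    have h5 : ∀ i, (SS Ω q k c).val.toRingHom (algebraMap K[X] (SS Ω q k c) (c i)) =
      algebraMap K[X] Ω (c i) := fun i => rfl
    simp only [h5] at h1
    rw [h3, h4, sub_zero] at h1
    exact h1
  have hfac : ev q k (fun i => algebraMap K[X] (SS Ω q k c) (c i)) w =
      w * (algebraMap K[X] _ (c 0) + ∑ i ∈ Finset.range k,
        algebraMap K[X] (SS Ω q k c) (c (i + 1)) * w ^ (q ^ (i + 1) - 1)) := by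
    rw [ev, Finset.sum_range_succ', mul_add, Finset.mul_sum, add_comm, pow_zero, pow_one, mul_comm]
    congr 1
    refine Finset.sum_congr rfl fun i _ => ?_
    have : 1 ≤ q ^ (i + 1) := Nat.one_le_pow _ _ (by omega)
    conv_lhs => rw [← Nat.sub_add_cancel this, pow_succ]
    ring
  rw [hfac, mul_eq_zero, or_iff_right hw0] at hwV
  have h1 := congrArg χ hwV
  rw [map_add, map_sum, map_zero, Finset.sum_eq_zero, add_zero] at h1
  · apply hχ
    have h2 : (χ.comp (IsScalarTower.toAlgHom K K[X] (SS Ω q k c))) =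
        aeval (χ (algebraMap K[X] _ X)) := by
      apply Polynomial.algHom_ext
      simp
    have h3 := DFunLike.congr_fun h2 (c 0)
    rw [coe_aeval_eq_eval] at h3
    rw [← h3]; exact h1
  · intro i _
    rw [map_mul, map_pow, hwχ, zero_pow, mul_zero]
    have : 1 < q ^ (i + 1) := Nat.one_lt_pow (by omega) hq1
    omega

end
end Scat

set_option linter.all false
namespace Scat
open Polynomial

section
variable {K E Ω : Type*} [Field K] [Field E] [Field Ω] [Algebra K[X] E] [IsFractionRing K[X] E]
  [Algebra E Ω] [Algebra K[X] Ω] [IsScalarTower K[X] E Ω] [Algebra K Ω] [IsScalarTower K K[X] Ω]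
variable {q k : ℕ} {c : ℕ → K[X]} {p e : ℕ} [Fact p.Prime] [CharP K p] [IsAlgClosed K]

theorem chi_poly (χ' : SS Ω q k c →ₐ[K] K) (P : K[X]) : χ' (algebraMap K[X] _ P) =
      P.eval (χ' (algebraMap K[X] _ X)) := by
  have h1 : (χ'.comp (IsScalarTower.toAlgHom K K[X] (SS Ω q k c))) =
      aeval (χ' (algebraMap K[X] _ X)) := by
    apply Polynomial.algHom_ext
    simp
  have h2 := DFunLike.congr_fun h1 P
  rw [coe_aeval_eq_eval] at h2
  exact h2

theorem gres_ext (hq1 : 1 < q) (hc0 : c 0 ≠ 0)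
    (hspl : (evp q k (fun i => algebraMap K[X] E (c i))).IsSplittingField E Ω)
    (g h : Ω ≃ₐ[E] Ω) (hgh : ∀ v ∈ VV Ω q k c, g v = h v) : g = h := by
  have hadj := hspl.adjoin_rootSet
  have hc0E : algebraMap K[X] E (c 0) ≠ 0 := by
    rwa [Ne, map_eq_zero_iff _ (IsFractionRing.injective K[X] E)]
  have hV : (evp q k (fun i => algebraMap K[X] E (c i))).rootSet Ω = VV Ω q k c := by
    ext x
    rw [mem_rootSet_of_ne (evp_ne_zero hq1 k _ (Nat.zero_le _) hc0E), aeval_def, ← eval_map,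
      map_evp, eval_evp]
    simp only [← IsScalarTower.algebraMap_apply K[X] E Ω]
    rfl
  rw [hV] at hadj
  have := AlgHom.ext_of_adjoin_eq_top (φ₁ := g.toAlgHom) (φ₂ := h.toAlgHom) hadj
    (fun v hv => hgh v hv)
  ext x
  exact DFunLike.congr_fun this x

theorem cheb (he : 0 < e) (hq : q = p ^ e) [CharP Ω p] [FiniteDimensional E Ω] [IsGalois E Ω]
    (hc0 : c 0 ≠ 0) (hk : c k = 1)
    (hspl : (evp q k (fun i => algebraMap K[X] E (c i))).IsSplittingField E Ω) :
    ∃ Q0, ∀ n, Q0 ≤ p ^ n → (∀ i, (c i).map (iterateFrobenius K p n) = c i) →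
    ∀ s : Ω →+* Ω, (∀ P, s (algebraMap K[X] Ω P) =
      algebraMap K[X] Ω (P.map (iterateFrobenius K p n))) →
    ∃ χ : SS Ω q k c →ₐ[K] K, (c 0).eval (χ (algebraMap K[X] _ X)) ≠ 0 ∧
      ∀ x y : SS Ω q k c, s x = y → χ y = χ x ^ p ^ n := by
  classical
  have hq1 := one_lt_q (p := p) he hq
  have hp1 := (Fact.out : p.Prime).one_lt
  have hfin := SS_finite (Ω := Ω) E hq1 hc0 hk
  have hfree := SS_free (Ω := Ω) E hq1 hc0 hk
  -- a good place
  obtain ⟨l0, hl0⟩ : ∃ l : K, (c 0).eval l ≠ 0 := by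
    by_contra hcon
    push Not at hcon
    exact hc0 (Polynomial.funext (by simpa using hcon))
  obtain ⟨j, hj, hjP⟩ := exists_psr (E := E) (Ω := Ω) he hq hk l0 hl0
  set R := Fintype.card (Ω ≃ₐ[E] Ω) with hR
  have hRpos : 0 < R := Fintype.card_pos
  let V' : Set (SS Ω q k c) := {x | (x : Ω) ∈ VV Ω q k c}
  have hV'f : V'.Finite := (VV_finite (Ω := Ω) E hq1 hc0).preimage Subtype.val_injective.injOn
  have hV'adj : Algebra.adjoin K[X] V' = ⊤ := Algebra.adjoin_adjoin_coe_preimage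
  obtain ⟨Q1, hQ1⟩ := stepanov_alg p j hj
    (τ := algebraMap K[X] _ (X - Polynomial.C l0)) (by rw [hjP]; simp) V' hV'f hV'adj R
  set D := (c 0).natDegree with hD
  refine ⟨max Q1 (R * R * D + 2), fun n hn hcF s hs => ?_⟩
  have hn1 : Q1 ≤ p ^ n := le_trans (le_max_left _ _) hn
  have hn2 : R * R * D + 2 ≤ p ^ n := le_trans (le_max_right _ _) hn
  have hn0 : 0 < n := by
    rcases Nat.eq_zero_or_pos n with rfl | h
    · rw [pow_zero] at hn2; omega
    · exact h
  obtain ⟨hsV, s', hs'⟩ := exists_restrict (q := q) (k := k) n hcF s hs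
  by_contra hcon
  push Not at hcon
  -- good rational places
  have hfixfin : {x : K | x ^ p ^ n = x}.Finite := by
    apply Set.finite_of_ncard_pos
    rw [card_fixed K p n hn0]; positivity
  let Λ : Finset K := hfixfin.toFinset.filter (fun l => (c 0).eval l ≠ 0)
  have hΛ : p ^ n ≤ Λ.card + D := by
    have h1 : hfixfin.toFinset.card = p ^ n := by
      rw [← Set.ncard_eq_toFinset_card _ hfixfin, card_fixed K p n hn0]
    have h2 := Finset.card_filter_add_card_filter_not (s := hfixfin.toFinset)
      (fun l => (c 0).eval l ≠ 0)
    have h3 : (hfixfin.toFinset.filter (fun l => ¬ (c 0).eval l ≠ 0)).card ≤ D := by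
      refine le_trans (Finset.card_le_card ?_) ((Multiset.toFinset_card_le _).trans (card_roots' _))
      intro x hx
      rw [Finset.mem_filter, not_not] at hx
      rw [Multiset.mem_toFinset, mem_roots hc0]
      exact hx.2
    rw [h1] at h2
    have h4 : Λ.card = (hfixfin.toFinset.filter (fun l => (c 0).eval l ≠ 0)).card := rfl
    omega
  have hχ : ∀ l, (c 0).eval l ≠ 0 → ∃ χ : SS Ω q k c →ₐ[K] K, χ (algebraMap K[X] _ X) = l := by
    intro l hl
    obtain ⟨j, _, hjP⟩ := exists_psr (E := E) (Ω := Ω) he hq hk l hl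
    let cc : PowerSeries K →ₐ[K] K :=
      { PowerSeries.constantCoeff (R := K) with
        commutes' := fun a => by simp [PowerSeries.algebraMap_apply] }
    refine ⟨cc.comp j, ?_⟩
    rw [AlgHom.comp_apply, hjP]
    show PowerSeries.constantCoeff _ = _
    simp
  have hnon : Nonempty (SS Ω q k c →ₐ[K] K) := ⟨(hχ l0 hl0).choose⟩
  choose! χ hχ' using hχ
  have hχ : ∀ l ∈ Λ, χ l (algebraMap K[X] _ X) = l :=
    fun l hl => hχ' l (Finset.mem_filter.mp hl).2
  let χg : K × (Ω ≃ₐ[E] Ω) → (SS Ω q k c →ₐ[K] K) :=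
    fun lg => (χ lg.1).comp ((gres (E := E) q k c lg.2).restrictScalars K)
  have hχgX : ∀ l ∈ Λ, ∀ g, χg (l, g) (algebraMap K[X] _ X) = l := by
    intro l hl g
    show χ l (gres (E := E) q k c g _) = l
    rw [AlgHom.commutes, hχ l hl]
  have hinj : Set.InjOn χg (Λ ×ˢ (Finset.univ : Finset (Ω ≃ₐ[E] Ω)) : Finset _) := by
    rintro ⟨l, g⟩ hl ⟨l', g'⟩ hl' heq
    simp only [Finset.coe_product, Set.mem_prod, Finset.mem_coe] at hl hl'
    have h1 : l = l' := by
      rw [← hχgX l hl.1 g, ← hχgX l' hl'.1 g', heq]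
    subst h1
    have : g = g' := by
      refine gres_ext hq1 hc0 hspl g g' fun v hv => ?_
      have h2 := DFunLike.congr_fun heq ⟨v, VV_sub hv⟩
      have h3 := chi_inj (p := p) hq he (χ l) (by
        rw [hχ l hl.1]; exact (Finset.mem_filter.mp hl.1).2)
        (gres (E := E) q k c g ⟨v, VV_sub hv⟩) (gres (E := E) q k c g' ⟨v, VV_sub hv⟩)
        (gal_VV g hv) (gal_VV g' hv) h2
      exact congrArg Subtype.val h3
    rw [this]
  let 𝒵 : Finset (SS Ω q k c →ₐ[K] K) := (Λ ×ˢ Finset.univ).image χg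
  have h𝒵card : 𝒵.card = Λ.card * R := by
    rw [Finset.card_image_of_injOn hinj, Finset.card_product, Finset.card_univ]
  -- each element of 𝒵 belongs to some Frobenius class
  have hcl : ∀ ψ ∈ 𝒵, ∃ g : Ω ≃ₐ[E] Ω, ∀ w, ψ (s' (gres q k c g w)) = ψ w ^ p ^ n := by
    intro ψ hψ
    obtain ⟨⟨l, g0⟩, hlg, rfl⟩ := Finset.mem_image.mp hψ
    have hl := (Finset.mem_product.mp hlg).1
    set ψ := χg (l, g0) with hψdef
    have hψX : ψ (algebraMap K[X] _ X) = l := hχgX l hl g0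
    have hlfix : l ^ p ^ n = l := by simpa using (Finset.mem_filter.mp hl).1
    have hroot : ∀ x : K, ∃ y, y ^ p ^ n = x := fun x => IsAlgClosed.exists_pow_nat_eq x (by positivity)
    have hFinj : Function.Injective (iterateFrobenius K p n) := (iterateFrobenius K p n).injective
    choose ρ hρ using fun w : SS Ω q k c => hroot (ψ (s' w))
    have hρ' : ∀ w, iterateFrobenius K p n (ρ w) = ψ (s' w) := fun w => hρ w
    have hs'P : ∀ P, s' (algebraMap K[X] _ P) = algebraMap K[X] _ (P.map (iterateFrobenius K p n)) := by
      intro P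
      apply Subtype.ext
      rw [hs']
      exact hs P
    have hρP : ∀ P, ρ (algebraMap K[X] _ P) = P.eval l := by
      intro P
      apply hFinj
      rw [hρ', hs'P, chi_poly, hψX]
      conv_lhs => rw [← hlfix]
      exact eval_map_apply (iterateFrobenius K p n) l
    let ρ' : SS Ω q k c →ₐ[K] K :=
      { toFun := ρ
        map_one' := hFinj (by rw [hρ']; simp)
        map_zero' := hFinj (by rw [hρ']; simp)
        map_add' := fun x y => hFinj (by rw [map_add]; simp only [hρ']; simp)
        map_mul' := fun x y => hFinj (by rw [map_mul]; simp only [hρ']; simp)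
        commutes' := fun a => by
          rw [IsScalarTower.algebraMap_apply K K[X] (SS Ω q k c), hρP]
          simp }
    obtain ⟨g, hg⟩ := fibre_transitive (E := E) hq1 hk ρ' ψ (by
      rw [hψX]
      show ρ _ = _
      rw [hρP]; simp)
    refine ⟨g, fun w => ?_⟩
    rw [← hg w]
    exact (hρ _).symm
  choose! G hG using hcl
  have hG1 : ∀ ψ ∈ 𝒵, G ψ ≠ 1 := by
    intro ψ hψ h1
    obtain ⟨⟨l, g0⟩, hlg, hψe⟩ := Finset.mem_image.mp hψ
    have hl := (Finset.mem_product.mp hlg).1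
    have hψX : ψ (algebraMap K[X] _ X) = l := hψe ▸ hχgX l hl g0
    obtain ⟨x, y, hxy, hne⟩ := hcon ψ (by rw [hψX]; exact (Finset.mem_filter.mp hl).2)
    apply hne
    have h2 := hG ψ hψ x
    rw [h1] at h2
    have h3 : gres q k c (1 : Ω ≃ₐ[E] Ω) x = x := Subtype.ext rfl
    have h4 : s' x = y := Subtype.ext (by rw [hs', hxy])
    rw [h3, h4] at h2
    exact h2
  -- count
  have hfib : 𝒵.card = ∑ g ∈ Finset.univ.erase (1 : Ω ≃ₐ[E] Ω), (𝒵.filter (fun ψ => G ψ = g)).card :=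
    Finset.card_eq_sum_card_fiberwise (fun ψ hψ => by
      simpa using hG1 ψ hψ)
  have hbound : ∀ g : Ω ≃ₐ[E] Ω, R * (𝒵.filter (fun ψ => G ψ = g)).card ≤ p ^ n * (R + 1) := by
    intro g
    refine hQ1 n hn1 (s'.comp (gres q k c g).toRingHom) ?_ ?_ _ ?_
    · intro P
      apply Subtype.ext
      show ((s' (gres q k c g (algebraMap K[X] _ P)) : SS Ω q k c) : Ω) = _
      rw [AlgHom.commutes, hs']
      exact hs P
    · intro v hv
      show ((s' (gres q k c g v) : SS Ω q k c) : Ω) ∈ VV Ω q k c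
      rw [hs']
      exact hsV _ (gal_VV g hv)
    · intro ψ hψ w
      rw [Finset.mem_filter] at hψ
      rw [← hψ.2]
      exact hG ψ hψ.1 w
  have hfinal : R * (Λ.card * R) ≤ (R - 1) * (p ^ n * (R + 1)) := by
    rw [← h𝒵card, hfib, Finset.mul_sum]
    refine (Finset.sum_le_card_nsmul _ _ _ (fun g _ => hbound g)).trans ?_
    rw [Finset.card_erase_of_mem (Finset.mem_univ _), Finset.card_univ, smul_eq_mul]
  obtain ⟨R', hR'⟩ : ∃ R', R = R' + 1 := ⟨R - 1, by omega⟩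
  rw [hR'] at hfinal hn2
  simp only [Nat.add_sub_cancel] at hfinal
  set Q := p ^ n
  have h5 : (R' + 1) * (R' + 1) * Q ≤ (R' + 1) * (R' + 1) * (Λ.card + D) := Nat.mul_le_mul_left _ hΛ
  nlinarith

theorem cheb2 (he : 0 < e) (hq : q = p ^ e) [CharP Ω p] [FiniteDimensional E Ω] [IsGalois E Ω]
    (hc0 : c 0 ≠ 0) (hk : c k = 1)
    (hspl : (evp q k (fun i => algebraMap K[X] E (c i))).IsSplittingField E Ω) :
    ∃ Q0, ∀ n, Q0 ≤ p ^ n → (∀ i, (c i).map (iterateFrobenius K p n) = c i) →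
    ∀ s : Ω →+* Ω, (∀ P, s (algebraMap K[X] Ω P) =
      algebraMap K[X] Ω (P.map (iterateFrobenius K p n))) →
    ∀ x ∈ VV Ω q k c, ∀ y ∈ VV Ω q k c, s x = x → s y = y → x ≠ 0 →
    (∀ b : K, b ^ q = b → y ≠ algebraMap K Ω b * x) →
    ∃ l x0 y0 : K, (c 0).eval l ≠ 0 ∧ x0 ≠ 0 ∧ y0 ≠ 0 ∧ x0 ^ p ^ n = x0 ∧ y0 ^ p ^ n = y0 ∧
      ev q k (fun i => (c i).eval l) x0 = 0 ∧ ev q k (fun i => (c i).eval l) y0 = 0 ∧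
      (y0 / x0) ^ q ≠ y0 / x0 := by
  obtain ⟨Q0, hQ0⟩ := cheb (E := E) (Ω := Ω) he hq hc0 hk hspl
  have hq1 := one_lt_q (p := p) he hq
  refine ⟨Q0, fun n hn hcF s hs x hx y hy hsx hsy hx0 hxy => ?_⟩
  obtain ⟨χ, hχ0, hχ⟩ := hQ0 n hn hcF s hs
  let x' : SS Ω q k c := ⟨x, VV_sub hx⟩
  let y' : SS Ω q k c := ⟨y, VV_sub hy⟩
  have hzV : (0 : Ω) ∈ VV Ω q k c := ev_zero (by omega) k _
  have hroot : ∀ v : SS Ω q k c, (v : Ω) ∈ VV Ω q k c →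
      ev q k (fun i => (c i).eval (χ (algebraMap K[X] _ X))) (χ v) = 0 := by
    intro v hv
    have h1 : ev q k (fun i => algebraMap K[X] (SS Ω q k c) (c i)) v = 0 := by
      apply Subtype.ext
      have h1 := map_ev q k (fun i => algebraMap K[X] (SS Ω q k c) (c i))
        (SS Ω q k c).val.toRingHom v
      exact h1.trans hv
    have h2 := map_ev q k (fun i => algebraMap K[X] (SS Ω q k c) (c i)) (χ : SS Ω q k c →+* K) v
    rw [h1, map_zero] at h2
    have h3 : ∀ i, (χ : SS Ω q k c →+* K) (algebraMap K[X] (SS Ω q k c) (c i)) =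
      (c i).eval (χ (algebraMap K[X] _ X)) := fun i => chi_poly χ (c i)
    simp only [h3] at h2
    exact h2.symm
  have hχx : χ x' ≠ 0 := by
    intro h
    have := chi_inj (p := p) hq he χ hχ0 x' 0 hx hzV (by rw [h, map_zero])
    exact hx0 (congrArg Subtype.val this)
  have key : ∀ b : K, b ^ q = b → χ y' ≠ b * χ x' := by
    intro b hb h
    have hb' : (algebraMap K Ω b) ^ q = algebraMap K Ω b := by rw [← map_pow, hb]
    have hbx : ((b • x' : SS Ω q k c) : Ω) = algebraMap K Ω b * x := by
      rw [← Algebra.smul_def]; rfl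
    have := chi_inj (p := p) hq he χ hχ0 y' (b • x') hy (by
      rw [hbx]
      show ev _ _ _ _ = 0
      have hx' : ev q k (fun i => algebraMap K[X] Ω (c i)) x = 0 := hx
      rw [ev_smul hb', hx', mul_zero]) (by rw [h, map_smul, smul_eq_mul])
    apply hxy b hb
    rw [← hbx, ← this]
  refine ⟨χ (algebraMap K[X] _ X), χ x', χ y', hχ0, hχx, ?_, (hχ x' x' hsx).symm,
    (hχ y' y' hsy).symm, hroot x' hx, hroot y' hy, ?_⟩
  · have := key 0 (zero_pow (by omega))
    simpa using this
  · intro h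
    exact key _ h (by field_simp)

end
end Scat

set_option linter.all false
namespace Scat
open Polynomial

/-- conditions on the local additive polynomial -/
structure LCond {K : Type*} [Field K] (q m D a : ℕ) (φ : ℕ → PowerSeries K) : Prop where
  ua : PowerSeries.constantCoeff (φ a) ≠ 0
  top : ∃ ε : K, ε ≠ 0 ∧ φ (a + D) = PowerSeries.C ε * PowerSeries.X ^ (m * (q ^ D - 1))
  mid : ∀ j, 0 < j → j < D → PowerSeries.X ^ (m * (q ^ j - 1) + 1) ∣ φ (a + j)

section
variable {K : Type*} [Field K] {p e q : ℕ} [Fact p.Prime] [CharP K p]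

/-- coefficients of the quotient of an additive polynomial by `z^q - w^(q-1) z` -/
noncomputable def quo {A : Type*} [CommRing A] (q k : ℕ) (φ : ℕ → A) (w : A) : ℕ → A
  | j => if h : j < k then φ (j + 1) + quo q k φ w (j + 1) * w ^ ((q - 1) * q ^ (j + 1)) else 0
  termination_by j => k - j

theorem quo_lt {A : Type*} [CommRing A] (q k : ℕ) (φ : ℕ → A) (w : A) {j : ℕ} (h : j < k) :
    quo q k φ w j = φ (j + 1) + quo q k φ w (j + 1) * w ^ ((q - 1) * q ^ (j + 1)) := by
  rw [quo]; simp [h]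

theorem quo_ge {A : Type*} [CommRing A] (q k : ℕ) (φ : ℕ → A) (w : A) {j : ℕ} (h : k ≤ j) :
    quo q k φ w j = 0 := by
  rw [quo]; simp [h]

theorem ev_quo_aux {A : Type*} [CommRing A] [CharP A p] (hq : q = p ^ e) (he : 0 < e) (k : ℕ)
    (φ : ℕ → A) (w z : A) :
    ev q (k + 1) φ z = ev q k (quo q (k + 1) φ w) (z ^ q - w ^ (q - 1) * z) +
      (φ 0 + quo q (k + 1) φ w 0 * w ^ (q - 1)) * z := by
  set α := quo q (k + 1) φ w with hα
  have h1 : ∀ n ≤ k + 1, ∑ i ∈ Finset.range n, φ (i + 1) * z ^ q ^ (i + 1) =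
      ∑ i ∈ Finset.range n, α i * (z ^ q - w ^ (q - 1) * z) ^ q ^ i
      + α 0 * w ^ (q - 1) * z - α n * w ^ ((q - 1) * q ^ n) * z ^ q ^ n := by
    intro n hn
    induction n with
    | zero => simp
    | succ n ih =>
      rw [Finset.sum_range_succ, ih (by omega), Finset.sum_range_succ, sub_pow_q (p := p) hq,
        mul_pow]
      have h2 : φ (n + 1) = α n - α (n + 1) * w ^ ((q - 1) * q ^ (n + 1)) := by
        rw [hα, quo_lt q (k + 1) φ w (by omega : n < k + 1)]; ring
      rw [h2, ← pow_mul, ← pow_mul, ← pow_succ']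
      ring
  rw [ev, Finset.sum_range_succ', h1 (k + 1) le_rfl, hα, quo_ge q (k+1) φ w le_rfl, ev]
  ring

theorem ev_quo {A : Type*} [CommRing A] [IsDomain A] [CharP A p] (hq : q = p ^ e) (he : 0 < e)
    (k : ℕ) (φ : ℕ → A) (w : A) (hw0 : w ≠ 0) (hw : ev q (k + 1) φ w = 0) :
    φ 0 + quo q (k + 1) φ w 0 * w ^ (q - 1) = 0 := by
  have hq1 := one_lt_q (p := p) he hq
  have h := ev_quo_aux (p := p) hq he k φ w w
  have h2 : w ^ q - w ^ (q - 1) * w = 0 := by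
    rw [← pow_succ, Nat.sub_add_cancel (by omega), sub_self]
  rw [hw, h2, ev_zero (by omega), zero_add] at h
  exact (mul_eq_zero.mp h.symm).resolve_right hw0

theorem quo_cond (hq1 : 1 < q) {m D a : ℕ} (hm : 0 < m) (hD : 0 < D) {φ : ℕ → PowerSeries K}
    (h : LCond q m D (a + 1) φ) (w : PowerSeries K) :
    LCond q m D a (quo q (a + 1 + D) φ w) := by
  set α := quo q (a + 1 + D) φ w with hα
  have hlt : ∀ j, j < a + 1 + D → α j = φ (j + 1) + α (j + 1) * w ^ ((q - 1) * q ^ (j + 1)) :=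
    fun j hj => quo_lt _ _ _ _ hj
  have htop : α (a + D) = φ (a + 1 + D) := by
    rw [hlt _ (by omega), hα, quo_ge _ _ _ _ (by omega)]
    rw [zero_mul, add_zero]; congr 1; omega
  have hpow : ∀ i j, i < j → m * (q ^ i - 1) + 1 ≤ m * (q ^ j - 1) := by
    intro i j hij
    have h1 : q ^ i < q ^ j := Nat.pow_lt_pow_right hq1 hij
    have h2 : 1 ≤ q ^ i := Nat.one_le_pow _ _ (by omega)
    have h3 : q ^ i - 1 + 1 ≤ q ^ j - 1 := by omega
    calc m * (q ^ i - 1) + 1 ≤ m * (q ^ i - 1) + m := by omega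
      _ = m * (q ^ i - 1 + 1) := by ring
      _ ≤ _ := Nat.mul_le_mul_left _ h3
  obtain ⟨ε, hε, hεt⟩ := h.top
  -- divisibility in top or mid
  have hdiv : ∀ t, t < D → ∀ j, j + t + 1 = D → PowerSeries.X ^ (m * (q ^ j - 1) + 1) ∣ α (a + j + 1) := by
    intro t
    induction t with
    | zero =>
      intro _ j hj
      have : a + j + 1 = a + D := by omega
      rw [this, htop, hεt]
      exact Dvd.dvd.mul_left (pow_dvd_pow _ (hpow _ _ (by omega))) _
    | succ t ih =>
      intro ht j hj
      have h1 := ih (by omega) (j + 1) (by omega)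
      rw [hlt _ (by omega)]
      refine dvd_add ?_ (Dvd.dvd.mul_right ?_ _)
      · have := h.mid (j + 1) (by omega) (by omega)
        have h2 : a + j + 1 + 1 = a + 1 + (j + 1) := by omega
        rw [h2]
        exact (pow_dvd_pow _ (by have := hpow j (j+1) (by omega); omega)).trans this
      · have h2 : a + j + 1 + 1 = a + (j + 1) + 1 := by omega
        rw [h2]
        exact (pow_dvd_pow _ (by have := hpow j (j+1) (by omega); omega)).trans h1
  refine ⟨?_, ⟨ε, hε, by rw [htop, hεt]⟩, ?_⟩
  · rw [hlt _ (by omega), map_add, map_mul]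
    have h1 := hdiv (D - 1) (by omega) 0 (by omega)
    simp only [pow_zero, Nat.sub_self, mul_zero, zero_add, pow_one, add_zero] at h1
    rw [PowerSeries.X_dvd_iff] at h1
    rw [h1, zero_mul, add_zero]
    exact h.ua
  · intro j hj0 hj
    have h1 := hdiv (D - 1 - j) (by omega) j (by omega)
    rw [hlt _ (by omega)]
    refine dvd_add ?_ (h1.mul_right _)
    have h2 : a + j + 1 = a + 1 + j := by omega
    rw [h2]
    exact h.mid j hj0 hj

theorem lcond_zero_unique (hq : q = p ^ e) (he : 0 < e) {m D : ℕ} {φ : ℕ → PowerSeries K}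
    (h : LCond q m D 0 φ) (hm : 0 < m) (hD : 0 < D) (z : PowerSeries K) (hz : ev q (0 + D) φ z = 0) :
    z = 0 := by
  have hq1 := one_lt_q (p := p) he hq
  refine hensel_unique he hq (0 + D) φ h.ua hz (ev_zero (by omega) _ _) ?_
  have h1 := congrArg PowerSeries.constantCoeff hz
  rw [ev, Finset.sum_range_succ', map_add, map_sum, Finset.sum_eq_zero, zero_add, map_mul,
    map_zero, mul_eq_zero, or_iff_right h.ua, pow_zero, pow_one] at h1
  · rw [h1, map_zero]
  · intro j hj
    rw [Finset.mem_range] at hj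
    rw [map_mul]
    have : PowerSeries.constantCoeff (φ (j + 1)) = 0 := by
      rw [← PowerSeries.X_dvd_iff]
      rcases Nat.lt_or_ge (j + 1) D with h2 | h2
      · have := h.mid (j + 1) (by omega) h2
        rw [zero_add] at this
        exact (dvd_pow_self _ (by omega)).trans this
      · obtain ⟨ε, _, hε⟩ := h.top
        have h3 : j + 1 = 0 + D := by omega
        rw [h3, hε]
        refine Dvd.dvd.mul_left (dvd_pow_self _ ?_) _
        have : 1 < q ^ D := Nat.one_lt_pow (by omega) hq1
        have : 0 < m * (q ^ D - 1) := Nat.mul_pos hm (by omega)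
        omega
    rw [this, zero_mul]

/-- factorization `Φ = A ∘ P` -/
theorem local_factor (hq : q = p ^ e) (he : 0 < e) {m D : ℕ} (hm : 0 < m) (hD : 0 < D)
    {A : Type*} [Field A] [CharP A p] (f : PowerSeries K →+* A) (a : ℕ) :
    ∀ (φ : ℕ → PowerSeries K), LCond q m D a φ → ∀ W : AddSubgroup (PowerSeries K),
    (∀ w ∈ W, ev q (a + D) φ w = 0) → q ^ a ≤ Nat.card W →
    ∃ (P : (PowerSeries K)[X]) (α : ℕ → PowerSeries K), P.Monic ∧ P.natDegree = q ^ a ∧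
      LCond q m D 0 α ∧ (∀ w ∈ W, P.eval w = 0) ∧
      ∀ z : A, ev q (a + D) (fun i => f (φ i)) z =
        ev q (0 + D) (fun i => f (α i)) ((P.map f).eval z) := by
  classical
  have hq1 := one_lt_q (p := p) he hq
  induction a with
  | zero =>
    intro φ hφ W hW _
    refine ⟨X, φ, monic_X, by simp, hφ, ?_, by simp⟩
    intro w hw
    simpa using lcond_zero_unique hq he hφ hm hD w (hW w hw)
  | succ a ih =>
    intro φ hφ W hW hcard
    have hqa : 1 < q ^ (a + 1) := Nat.one_lt_pow (by omega) hq1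
    have hfin : Finite W := Nat.finite_of_card_ne_zero (by omega)
    obtain ⟨w, hwW, hw0⟩ : ∃ w ∈ W, w ≠ 0 := by
      have : Nontrivial W := Finite.one_lt_card_iff_nontrivial.mp (by omega)
      obtain ⟨w, hw⟩ := exists_ne (0 : W)
      exact ⟨w, w.2, fun h => hw (Subtype.ext h)⟩
    have hadd : a + 1 + D = a + D + 1 := by omega
    have hα0 := ev_quo (p := p) hq he (a + D) φ w hw0 (by rw [← hadd]; exact hW w hwW)
    set α := quo q (a + D + 1) φ w with hα
    have hαc : LCond q m D a α := by
      have := quo_cond hq1 hm hD hφ w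
      rwa [hadd] at this
    let ℓ : PowerSeries K →+ PowerSeries K :=
      { toFun := fun z => z ^ q - w ^ (q - 1) * z
        map_zero' := by simp [zero_pow (by omega : q ≠ 0)]
        map_add' := by
          intro x y
          have := add_pow_q (p := p) hq 1 x y
          simp only [pow_one] at this
          rw [this]; ring }
    have hevα : ∀ z, ev q (a + D + 1) φ z = ev q (a + D) α (ℓ z) := by
      intro z
      have := ev_quo_aux (p := p) hq he (a + D) φ w z
      rw [← hα, hα0, zero_mul, add_zero] at this
      exact this
    have hcard' : q ^ a ≤ Nat.card (W.map ℓ) := by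
      have h1 : Nat.card W ≤ Nat.card (W.map ℓ) * q := by
        let g : W →+ PowerSeries K := ℓ.comp W.subtype
        have h2 : Nat.card g.ker * Nat.card g.range = Nat.card W := by
          rw [← AddSubgroup.index_ker, mul_comm]
          exact AddSubgroup.index_mul_card _
        have h3 : g.range = W.map ℓ := by
          ext y
          constructor
          · rintro ⟨x, rfl⟩; exact ⟨x, x.2, rfl⟩
          · rintro ⟨x, hx, rfl⟩; exact ⟨⟨x, hx⟩, rfl⟩
        have h4 : Nat.card g.ker ≤ q := by
          let S : (PowerSeries K)[X] := X ^ q - Polynomial.C (w ^ (q - 1)) * X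
          have hS : S.natDegree ≤ q := by
            refine (natDegree_sub_le _ _).trans (max_le (natDegree_X_pow_le _) ?_)
            exact (natDegree_C_mul_le _ _).trans (by rw [natDegree_X]; omega)
          have hS0 : S ≠ 0 := by
            intro h
            have := congrArg (fun P => P.coeff q) h
            simp only [S, coeff_sub, coeff_X_pow, coeff_C_mul, coeff_X, coeff_zero] at this
            rw [if_pos trivial, if_neg (by omega), mul_zero, sub_zero] at this
            exact one_ne_zero this
          let i : g.ker → S.roots.toFinset := fun x => ⟨((x : W) : PowerSeries K), by
            rw [Multiset.mem_toFinset, mem_roots hS0, IsRoot.def]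
            have : g x = 0 := x.2
            have h6 : ((x : W) : PowerSeries K) ^ q - w ^ (q - 1) * ((x : W) : PowerSeries K) = 0 := this
            simpa [S] using h6⟩
          have hi : Function.Injective i := by
            intro x y hxy
            apply Subtype.ext; apply Subtype.ext
            exact Subtype.mk.inj hxy
          have h5 := Nat.card_le_card_of_injective i hi
          refine h5.trans ?_
          rw [Nat.card_eq_fintype_card, Fintype.card_coe]
          exact (Multiset.toFinset_card_le _).trans ((card_roots' _).trans hS)
        rw [← h2, ← h3, mul_comm]
        exact Nat.mul_le_mul_left _ h4
      have h2 : q ^ a * q ≤ Nat.card (W.map ℓ) * q := by rw [← pow_succ]; exact hcard.trans h1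
      exact Nat.le_of_mul_le_mul_right h2 (by omega)
    obtain ⟨P, β, hPm, hPd, hβ, hPW, hP⟩ := ih α hαc (W.map ℓ) (by
      rintro _ ⟨x, hx, rfl⟩
      rw [← hevα, ← hadd]
      exact hW x hx) hcard'
    let S : (PowerSeries K)[X] := X ^ q - Polynomial.C (w ^ (q - 1)) * X
    have hdlt : (Polynomial.C (w ^ (q - 1)) * X : (PowerSeries K)[X]).degree < q := by
      refine lt_of_le_of_lt (degree_C_mul_X_le _) ?_
      exact_mod_cast hq1
    have hSm : S.Monic := monic_X_pow_sub hdlt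
    have hSd : S.natDegree = q := by
      have h1 : S.degree = q := by
        rw [degree_sub_eq_left_of_degree_lt (by rwa [degree_X_pow]), degree_X_pow]
      exact natDegree_eq_of_degree_eq_some h1
    refine ⟨P.comp S, β, hPm.comp hSm (by omega), ?_, hβ, ?_, ?_⟩
    · rw [natDegree_comp, hPd, hSd, pow_succ]
    · intro x hx
      rw [eval_comp]
      have := hPW (ℓ x) ⟨x, hx, rfl⟩
      have h2 : S.eval x = ℓ x := by simp [S, ℓ]
      rw [h2, this]
    · intro z
      rw [Polynomial.map_comp, eval_comp, ← hP, hadd]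
      have h1 := ev_quo_aux (A := A) (p := p) hq he (a + D) (fun i => f (φ i)) (f w) z
      have h2 : ∀ j, quo q (a + D + 1) (fun i => f (φ i)) (f w) j = f (α j) := by
        have : ∀ t j, a + D + 1 - j = t → quo q (a + D + 1) (fun i => f (φ i)) (f w) j = f (α j) := by
          intro t
          induction t with
          | zero => intro j hj; rw [hα, quo_ge _ _ _ _ (by omega), quo_ge _ _ _ _ (by omega), map_zero]
          | succ t iht =>
            intro j hj
            have e1 := quo_lt q (a+D+1) (fun i => f (φ i)) (f w) (by omega : j < a+D+1)
            have e2 := quo_lt q (a+D+1) φ w (by omega : j<a+D+1)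
            rw [e1, iht (j+1) (by omega), hα, e2]; simp
        exact fun j => this _ j rfl
      have h3 : quo q (a + D + 1) (fun i => f (φ i)) (f w) = fun j => f (α j) := funext h2
      rw [h3] at h1
      rw [h1, ← map_pow, ← map_mul, ← map_add, hα0, map_zero, zero_mul, add_zero]
      congr 1
      simp [S]

/-- tame part -/
theorem local_tame [IsAlgClosed K] (hq : q = p ^ e) (he : 0 < e) {m D : ℕ} (hm : 0 < m)
    {A : Type*} [Field A] (f : PowerSeries K →+* A) (hf : Function.Injective f)
    (α : ℕ → PowerSeries K) (hα : LCond q m D 0 α) (hD : 0 < D) (u : A) (hu0 : u ≠ 0)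
    (hu : ev q (0 + D) (fun i => f (α i)) u = 0) :
    ∃ z, PowerSeries.constantCoeff z ≠ 0 ∧ f PowerSeries.X ^ m * u = f z := by
  have hq1 := one_lt_q (p := p) he hq
  have hX : f PowerSeries.X ≠ 0 := by
    rw [Ne, map_eq_zero_iff f hf]; exact PowerSeries.X_ne_zero
  obtain ⟨ε, hε, htop⟩ := hα.top
  have hβ : ∀ j, ∃ β : PowerSeries K, (j ≤ D → α j = β * PowerSeries.X ^ (m * (q ^ j - 1))) ∧
      (j = 0 → PowerSeries.constantCoeff β ≠ 0) ∧ (j = D → β = PowerSeries.C ε) ∧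
      (0 < j → j < D → PowerSeries.constantCoeff β = 0) := by
    intro j
    rcases Nat.eq_zero_or_pos j with rfl | hj
    · exact ⟨α 0, by simp, fun _ => hα.ua, by omega, by omega⟩
    · rcases lt_trichotomy j D with h | h | h
      · obtain ⟨t, ht⟩ := hα.mid j hj h
        refine ⟨PowerSeries.X * t, fun _ => ?_, by omega, by omega, by simp⟩
        rw [zero_add] at ht
        rw [ht, pow_succ]; ring
      · rw [zero_add] at htop
        exact ⟨PowerSeries.C ε, fun _ => by rw [h, htop], by omega, fun _ => rfl, by omega⟩
      · exact ⟨0, by omega, by omega, by omega, by omega⟩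
  choose β hβ1 hβ2 hβ3 hβ4 using hβ
  have hβtop : β D = PowerSeries.C ε := hβ3 D rfl
  have hev : ev q D (fun i => f (β i)) (f PowerSeries.X ^ m * u) = 0 := by
    have h1 : ev q D (fun i => f (β i)) (f PowerSeries.X ^ m * u) =
        f PowerSeries.X ^ m * ev q D (fun i => f (α i)) u := by
      rw [ev, ev, Finset.mul_sum]
      refine Finset.sum_congr rfl fun j hj => ?_
      rw [Finset.mem_range] at hj
      rw [hβ1 j (by omega), map_mul, map_pow, mul_pow, ← pow_mul]
      have : m * q ^ j = m * (q ^ j - 1) + m := by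
        have : 1 ≤ q ^ j := Nat.one_le_pow _ _ (by omega)
        conv_lhs => rw [← Nat.sub_add_cancel this]
        ring
      rw [this, pow_add]
      ring
    rw [h1]
    rw [zero_add] at hu
    rw [hu, mul_zero]
  obtain ⟨z, hz, hz'⟩ := hensel_all he hq D β (hβ2 0 rfl) (by rw [hβtop]; simpa using hε) f hf _ hev
  refine ⟨z, fun h0 => ?_, hz.symm⟩
  have : z = 0 := hensel_unique he hq D β (hβ2 0 rfl) hz' (ev_zero (by omega) _ _) (by simp [h0])
  rw [this, map_zero] at hz
  exact (mul_ne_zero (pow_ne_zero _ hX) hu0) hz.symm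

end
end Scat

set_option linter.all false
namespace Scat
open Polynomial

section nm
variable {A : Type*} [Field A]

noncomputable def nmp (S : Finset A) : A[X] := ∏ h ∈ S, (X - C h)
def nm (S : Finset A) (x : A) : A := ∏ h ∈ S, (x - h)

theorem eval_nmp (S : Finset A) (x : A) : (nmp S).eval x = nm S x := by
  simp [nmp, nm, eval_prod]

theorem nmp_monic (S : Finset A) : (nmp S).Monic := monic_prod_of_monic _ _ fun i _ => monic_X_sub_C i

theorem nmp_natDegree (S : Finset A) : (nmp S).natDegree = S.card := by
  rw [nmp, natDegree_prod_of_monic _ _ (fun i _ => monic_X_sub_C i)]; simp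

theorem nm_eq_zero (S : Finset A) (x : A) : nm S x = 0 ↔ x ∈ S := by
  rw [nm, Finset.prod_eq_zero_iff]
  constructor
  · rintro ⟨a, ha, h⟩; rw [sub_eq_zero] at h; rwa [h]
  · intro h; exact ⟨x, h, sub_self _⟩

theorem nm_shift (S : Finset A) (hadd : ∀ x ∈ S, ∀ y ∈ S, x + y ∈ S) (hneg : ∀ x ∈ S, -x ∈ S)
    (x : A) {h : A} (hh : h ∈ S) : nm S (x + h) = nm S x := by
  refine Finset.prod_bij' (fun t _ => t - h) (fun t _ => t + h) ?_ ?_ ?_ ?_ ?_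
  · intro t ht; rw [sub_eq_add_neg]; exact hadd _ ht _ (hneg _ hh)
  · intro t ht; exact hadd _ ht _ hh
  · intro t _; simp
  · intro t _; simp
  · intro t _; ring

theorem nm_add (S : Finset A) (h0 : (0 : A) ∈ S) (hadd : ∀ x ∈ S, ∀ y ∈ S, x + y ∈ S)
    (hneg : ∀ x ∈ S, -x ∈ S) (x y : A) : nm S (x + y) = nm S x + nm S y := by
  classical
  have hc : 0 < S.card := Finset.card_pos.mpr ⟨0, h0⟩
  have key : (nmp S).comp (C x + X) - nmp S - C (nm S x) = 0 := by
    refine eq_zero_of_degree_lt_of_eval_finset_eq_zero S ?_ ?_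
    · have hm : ((nmp S).comp (C x + X)).Monic := by
        rw [add_comm]; exact (nmp_monic S).comp_X_add_C x
      have hdeg : ((nmp S).comp (C x + X)).natDegree = S.card := by
        rw [natDegree_comp, nmp_natDegree, add_comm, natDegree_X_add_C, mul_one]
      have h1 : ((nmp S).comp (C x + X)).degree = S.card := by
        rw [degree_eq_natDegree hm.ne_zero, hdeg]
      have h2 : (nmp S).degree = S.card := by
        rw [degree_eq_natDegree (nmp_monic S).ne_zero, nmp_natDegree]
      have h3 : ((nmp S).comp (C x + X) - nmp S).degree < S.card := by
        rw [← h1]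
        exact degree_sub_lt (h1.trans h2.symm) hm.ne_zero (by rw [hm.leadingCoeff, (nmp_monic S).leadingCoeff])
      refine lt_of_le_of_lt (degree_sub_le _ _) (max_lt h3 ?_)
      exact lt_of_le_of_lt degree_C_le (by exact_mod_cast hc)
    · intro t ht
      simp only [eval_sub, eval_comp, eval_add, eval_C, eval_X, eval_nmp]
      rw [nm_shift S hadd hneg x ht, (nm_eq_zero S t).mpr ht]; ring
  have := congrArg (eval y) key
  simp only [eval_sub, eval_comp, eval_add, eval_C, eval_X, eval_nmp, eval_zero] at this
  linear_combination this

theorem nm_sub (S : Finset A) (h0 : (0 : A) ∈ S) (hadd : ∀ x ∈ S, ∀ y ∈ S, x + y ∈ S)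
    (hneg : ∀ x ∈ S, -x ∈ S) (x y : A) : nm S (x - y) = nm S x - nm S y := by
  have := nm_add S h0 hadd hneg (x - y) y
  rw [sub_add_cancel] at this; rw [this]; ring

end nm

section wild
variable {K : Type*} [Field K] {p e q : ℕ} [Fact p.Prime] [CharP K p]
variable {F : Type*} [Field F] [Algebra (PowerSeries K) F] [IsFractionRing (PowerSeries K) F]

theorem ps_factor (a : PowerSeries K) (ha : a ≠ 0) :
    ∃ n b, PowerSeries.constantCoeff b ≠ 0 ∧ a = PowerSeries.X ^ n * b := by
  obtain ⟨n, hn⟩ : ∃ n, a.order = (n : ℕ) :=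
    ⟨a.order.toNat, (ENat.coe_toNat (by rwa [Ne, PowerSeries.order_eq_top])).symm⟩
  obtain ⟨b, hb⟩ := PowerSeries.X_pow_dvd_iff.mpr (fun m hm => PowerSeries.coeff_of_lt_order (φ := a) m (by rw [hn]; exact_mod_cast hm))
  refine ⟨n, b, fun h0 => ?_, hb⟩
  have h1 := PowerSeries.coeff_order ha
  have h2 : a.order.toNat = n := by rw [hn]; rfl
  rw [h2, hb, PowerSeries.coeff_X_pow_mul', if_pos le_rfl, Nat.sub_self,
    PowerSeries.coeff_zero_eq_constantCoeff_apply] at h1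
  exact h1 h0

theorem frac_form (y : F) : ∃ n z, algebraMap (PowerSeries K) F PowerSeries.X ^ n * y =
    algebraMap (PowerSeries K) F z ∧ (n = 0 ∨ PowerSeries.constantCoeff z ≠ 0) := by
  have hinj := IsFractionRing.injective (PowerSeries K) F
  obtain ⟨a, b, hb, rfl⟩ := IsFractionRing.div_surjective (A := PowerSeries K) y
  have hb0 : b ≠ 0 := nonZeroDivisors.ne_zero hb
  obtain ⟨n, b', hb', hbe⟩ := ps_factor b hb0
  have hfb : algebraMap (PowerSeries K) F b ≠ 0 := by rwa [Ne, map_eq_zero_iff _ hinj]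
  have hbinv : b' * b'⁻¹ = 1 := PowerSeries.mul_inv_cancel _ hb'
  by_cases ha : a = 0
  · exact ⟨0, 0, by simp [ha], Or.inl rfl⟩
  obtain ⟨k, a', ha', hae⟩ := ps_factor a ha
  have hai : PowerSeries.constantCoeff (a' * b'⁻¹) ≠ 0 := by
    rw [map_mul, PowerSeries.constantCoeff_inv]
    exact mul_ne_zero ha' (inv_ne_zero hb')
  rcases le_total n k with h | h
  · refine ⟨0, PowerSeries.X ^ (k - n) * (a' * b'⁻¹), ?_, Or.inl rfl⟩
    rw [pow_zero, one_mul, div_eq_iff hfb, ← map_mul]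
    congr 1
    rw [hae, hbe]
    calc PowerSeries.X ^ k * a' = PowerSeries.X ^ (k - n + n) * a' * (b' * b'⁻¹) := by
          rw [hbinv, mul_one, Nat.sub_add_cancel h]
      _ = _ := by rw [pow_add]; ring
  · refine ⟨n - k, a' * b'⁻¹, ?_, Or.inr hai⟩
    rw [mul_div_assoc', div_eq_iff hfb, ← map_mul, ← map_pow, ← map_mul]
    congr 1
    rw [hae, hbe]
    calc PowerSeries.X ^ (n - k) * (PowerSeries.X ^ k * a') = PowerSeries.X ^ (n - k + k) * a' * (b' * b'⁻¹) := by
          rw [hbinv, pow_add]; ring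
      _ = _ := by rw [Nat.sub_add_cancel h]; ring

variable {Ah : Type*} [Field Ah] [Algebra F Ah] [IsAlgClosed Ah] [Algebra.IsAlgebraic F Ah]
  [Algebra (PowerSeries K) Ah] [IsScalarTower (PowerSeries K) F Ah] [CharP Ah p]

theorem wild_core {m n0 : ℕ} (hm : 0 < m) (hpm : ¬ p ∣ m) (S : Finset Ah)
    (hScard : S.card = p ^ n0)
    (h0 : (0 : Ah) ∈ S) (hadd : ∀ x ∈ S, ∀ y ∈ S, x + y ∈ S) (hneg : ∀ x ∈ S, -x ∈ S)
    (hSR : ∀ s ∈ S, ∃ w, algebraMap (PowerSeries K) Ah w = s)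
    (PF : F[X]) (hPF : PF.map (algebraMap F Ah) = nmp S)
    (v : Ah) (z : PowerSeries K) (hz : PowerSeries.constantCoeff z ≠ 0)
    (hv : algebraMap (PowerSeries K) Ah PowerSeries.X ^ m * nm S v = algebraMap (PowerSeries K) Ah z) :
    ∀ s ∈ S, ∃ γ : Ah ≃ₐ[F] Ah, γ v = v + s := by
  classical
  have hcomp : ∀ x, algebraMap (PowerSeries K) Ah x = algebraMap F Ah (algebraMap _ F x) :=
    fun x => IsScalarTower.algebraMap_apply _ _ _ x
  have hinj : Function.Injective (algebraMap (PowerSeries K) Ah) := by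
    rw [IsScalarTower.algebraMap_eq (PowerSeries K) F Ah]
    exact (algebraMap F Ah).injective.comp (IsFractionRing.injective _ _)
  have hX : algebraMap (PowerSeries K) Ah PowerSeries.X ≠ 0 := by
    rw [Ne, map_eq_zero_iff _ hinj]; exact PowerSeries.X_ne_zero
  have hγS : ∀ (γ : Ah ≃ₐ[F] Ah), ∀ s ∈ S, γ s = s := by
    intro γ s hs
    obtain ⟨w, rfl⟩ := hSR s hs
    rw [hcomp]; exact γ.commutes _
  have : IsAlgClosure F Ah := ⟨inferInstance, inferInstance⟩
  have hn : Normal F Ah := IsAlgClosure.normal F Ah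
  have hIntg : IsIntegral F v := (Algebra.IsAlgebraic.isAlgebraic v).isIntegral
  obtain ⟨uF, huF⟩ : ∃ uF : F, algebraMap F Ah uF = nm S v := by
    refine ⟨algebraMap (PowerSeries K) F z / algebraMap (PowerSeries K) F PowerSeries.X ^ m, ?_⟩
    rw [map_div₀, map_pow, ← hcomp, ← hcomp, div_eq_iff (pow_ne_zero _ hX), ← hv]; ring
  set M := minpoly F v with hM
  have hMdvd : M ∣ PF - C uF := by
    apply minpoly.dvd
    rw [map_sub, aeval_C, aeval_def, ← eval_map, hPF, eval_nmp, huF, sub_self]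
  have hPFe : (PF - C uF).map (algebraMap F Ah) = nmp (S.image (fun s => v + s)) := by
    apply Polynomial.funext
    intro x
    rw [Polynomial.map_sub, map_C, hPF, huF, eval_sub, eval_C, eval_nmp, eval_nmp,
      ← nm_sub S h0 hadd hneg]
    rw [nm, nm, Finset.prod_image (by intro a _ b _ h; simpa using h)]
    exact Finset.prod_congr rfl fun i _ => by ring
  let H := S.filter (fun s => aeval (v + s) M = 0)
  have hHγ : ∀ s, s ∈ H ↔ s ∈ S ∧ ∃ γ : Ah ≃ₐ[F] Ah, γ v = v + s := by
    intro s
    rw [Finset.mem_filter]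
    refine and_congr_right fun hs => ?_
    constructor
    · intro h
      exact minpoly.exists_algEquiv_of_root' (Algebra.IsAlgebraic.isAlgebraic v) h
    · rintro ⟨γ, hγ⟩
      rw [← hγ, aeval_algHom_apply, hM, minpoly.aeval, map_zero]
  have hHS : H ⊆ S := Finset.filter_subset _ _
  have hH0 : (0 : Ah) ∈ H := (hHγ 0).mpr ⟨h0, AlgEquiv.refl, by simp⟩
  have hHadd : ∀ x ∈ H, ∀ y ∈ H, x + y ∈ H := by
    intro x hx y hy
    obtain ⟨hxS, γ, hγ⟩ := (hHγ x).mp hx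
    obtain ⟨hyS, δ, hδ⟩ := (hHγ y).mp hy
    refine (hHγ _).mpr ⟨hadd _ hxS _ hyS, δ.trans γ, ?_⟩
    rw [AlgEquiv.trans_apply, hδ, map_add, hγ, hγS _ _ hyS]; ring
  have hHneg : ∀ x ∈ H, -x ∈ H := by
    intro x hx
    obtain ⟨hxS, γ, hγ⟩ := (hHγ x).mp hx
    refine (hHγ _).mpr ⟨hneg _ hxS, γ.symm, ?_⟩
    rw [AlgEquiv.symm_apply_eq, map_add, hγ, hγS _ _ (hneg _ hxS)]; ring
  -- the minimal polynomial
  have hMm : (M.map (algebraMap F Ah)).Monic := (minpoly.monic hIntg).map _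
  have hMd : M.map (algebraMap F Ah) ∣ nmp (S.image (fun s => v + s)) := by
    rw [← hPFe]; exact Polynomial.map_dvd _ hMdvd
  have hroots : (M.map (algebraMap F Ah)).roots ≤ (S.image (fun s => v + s)).val := by
    have h1 := roots.le_of_dvd (nmp_monic _).ne_zero hMd
    rwa [nmp, roots_prod_X_sub_C] at h1
  have hset : (M.map (algebraMap F Ah)).roots = (H.image (fun s => v + s)).val := by
    refine (Multiset.Nodup.ext (Multiset.nodup_of_le hroots (Finset.nodup _)) (Finset.nodup _)).mpr ?_
    intro x
    rw [Finset.mem_val, Finset.mem_image]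
    constructor
    · intro hx
      have h1 := Multiset.mem_of_le hroots hx
      rw [Finset.mem_val, Finset.mem_image] at h1
      obtain ⟨s, hs, rfl⟩ := h1
      refine ⟨s, Finset.mem_filter.mpr ⟨hs, ?_⟩, rfl⟩
      rw [mem_roots hMm.ne_zero, IsRoot.def, eval_map] at hx
      exact hx
    · rintro ⟨s, hs, rfl⟩
      rw [mem_roots hMm.ne_zero, IsRoot.def, eval_map]
      exact (Finset.mem_filter.mp hs).2
  have hMe : M.map (algebraMap F Ah) = nmp (H.image (fun s => v + s)) := by
    have h1 := (IsAlgClosed.splits (M.map (algebraMap F Ah))).eq_prod_roots_of_monic hMm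
    rw [h1, hset]; rfl
  have hyF : nm H v = algebraMap F Ah (-M.coeff 0) := by
    have h1 := congrArg (eval 0) hMe
    rw [eval_nmp, ← coeff_zero_eq_eval_zero, coeff_map] at h1
    rw [map_neg, h1, nm, nm, Finset.prod_image (by intro a _ b _ h; simpa using h)]
    have h2 : ∏ x ∈ H, (0 - (v + x)) = nm H (0 - v) := Finset.prod_congr rfl fun i _ => by ring
    rw [h2, nm_sub H hH0 hHadd hHneg, (nm_eq_zero H 0).mpr hH0]; simp [nm]
  obtain ⟨n, z', hz', hn0⟩ := frac_form (K := K) (-M.coeff 0)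
  have hprod : ∏ s ∈ S, nm H (v - s) = nm S v ^ H.card := by
    simp only [nm]
    rw [Finset.prod_comm]
    rw [Finset.prod_congr rfl (g := fun _ => nm S v), Finset.prod_const]
    · rfl
    · intro h hh
      rw [← nm_shift S hadd hneg v (hneg h (hHS hh))]
      exact Finset.prod_congr rfl fun i _ => by ring
  have hnmR : ∀ s ∈ S, ∃ r, algebraMap (PowerSeries K) Ah r = nm H s := by
    intro s hs
    have : ∀ t ∈ S, t ∈ (algebraMap (PowerSeries K) Ah).range := fun t ht => hSR t ht
    have h2 : nm H s ∈ (algebraMap (PowerSeries K) Ah).range :=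
      Subring.prod_mem _ fun h hh => Subring.sub_mem _ (this s hs) (this h (hHS hh))
    exact h2
  have hterm : ∀ s ∈ S, ∃ r, algebraMap (PowerSeries K) Ah PowerSeries.X ^ n * nm H (v - s) =
      algebraMap (PowerSeries K) Ah r ∧ (n ≠ 0 → PowerSeries.constantCoeff r ≠ 0) := by
    intro s hs
    obtain ⟨r, hr⟩ := hnmR s hs
    refine ⟨z' - PowerSeries.X ^ n * r, ?_, ?_⟩
    · rw [nm_sub H hH0 hHadd hHneg, mul_sub, hyF, map_sub, hcomp z', ← hz', map_mul, map_pow,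
        map_mul, map_pow, ← hcomp, hr]
    · intro hn1
      rw [map_sub, map_mul, map_pow, PowerSeries.constantCoeff_X, zero_pow hn1, zero_mul, sub_zero]
      exact hn0.resolve_left hn1
  choose! ρ hρ1 hρ2 using hterm
  have hfin : PowerSeries.X ^ (n * S.card) * z ^ H.card =
      PowerSeries.X ^ (m * H.card) * ∏ s ∈ S, ρ s := by
    apply hinj
    rw [map_mul, map_mul, map_prod, ← Finset.prod_congr rfl hρ1, Finset.prod_mul_distrib, hprod,
      Finset.prod_const, map_pow, map_pow, map_pow, ← hv]
    ring
  have hHc : 0 < H.card := Finset.card_pos.mpr ⟨0, hH0⟩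
  have hn1 : n ≠ 0 := by
    rintro rfl
    have := congrArg PowerSeries.constantCoeff hfin
    rw [zero_mul, pow_zero, one_mul, map_mul, map_pow, map_pow, PowerSeries.constantCoeff_X,
      zero_pow (Nat.mul_pos hm hHc).ne', zero_mul] at this
    exact pow_ne_zero _ hz this
  have hu1 : PowerSeries.constantCoeff (z ^ H.card) ≠ 0 := by rw [map_pow]; exact pow_ne_zero _ hz
  have hu2 : PowerSeries.constantCoeff (∏ s ∈ S, ρ s) ≠ 0 := by
    rw [map_prod]; exact Finset.prod_ne_zero_iff.mpr fun s hs => hρ2 s hs hn1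
  have hXle : ∀ (i j : ℕ) (x y : PowerSeries K), PowerSeries.constantCoeff x ≠ 0 →
      PowerSeries.X ^ i * x = PowerSeries.X ^ j * y → j ≤ i := by
    intro i j x y hx h
    by_contra hlt
    push Not at hlt
    have h1 : PowerSeries.coeff i (PowerSeries.X ^ i * x) = PowerSeries.constantCoeff x := by
      rw [PowerSeries.coeff_X_pow_mul', if_pos le_rfl, Nat.sub_self,
        PowerSeries.coeff_zero_eq_constantCoeff_apply]
    rw [h, PowerSeries.coeff_X_pow_mul', if_neg (by omega)] at h1
    exact hx h1.symm
  have hcard : n * S.card = m * H.card :=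
    le_antisymm (hXle _ _ _ _ hu2 hfin.symm) (hXle _ _ _ _ hu1 hfin)
  have hdvd : S.card ∣ H.card := by
    have hcop : Nat.Coprime S.card m := by
      rw [hScard]
      exact Nat.Coprime.pow_left _ (((Fact.out : p.Prime).coprime_iff_not_dvd).mpr hpm)
    exact hcop.dvd_of_dvd_mul_left (by rw [← hcard]; exact Dvd.intro_left _ rfl)
  have hHeq : H = S := Finset.eq_of_subset_of_card_le hHS (Nat.le_of_dvd hHc hdvd)
  intro s hs
  rw [← hHeq] at hs
  exact ((hHγ s).mp hs).2

theorem wild [IsAlgClosed K] (hq : q = p ^ e) (he : 0 < e) {m D a : ℕ} (hm : 0 < m) (hD : 0 < D)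
    (hpm : ¬ p ∣ m) (φ : ℕ → PowerSeries K) (hφ : LCond q m D a φ)
    (W : AddSubgroup (PowerSeries K)) (hW : ∀ w ∈ W, ev q (a + D) φ w = 0)
    (hcard : q ^ a ≤ Nat.card W) :
    (∀ v : Ah, ev q (a + D) (fun i => algebraMap (PowerSeries K) Ah (φ i)) v = 0 →
      (∀ w ∈ W, v ≠ algebraMap (PowerSeries K) Ah w) → ∀ w ∈ W, ∃ γ : Ah ≃ₐ[F] Ah,
        γ v = v + algebraMap (PowerSeries K) Ah w) ∧
    (∀ (γ : Ah ≃ₐ[F] Ah) (v : Ah), ev q (a + D) (fun i => algebraMap (PowerSeries K) Ah (φ i)) v = 0 →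
      ∃ w ∈ W, γ v = v + algebraMap (PowerSeries K) Ah w) := by
  classical
  have hq1 := one_lt_q (p := p) he hq
  have hcomp : ∀ x, algebraMap (PowerSeries K) Ah x = algebraMap F Ah (algebraMap _ F x) :=
    fun x => IsScalarTower.algebraMap_apply _ _ _ x
  have hinj : Function.Injective (algebraMap (PowerSeries K) Ah) := by
    rw [IsScalarTower.algebraMap_eq (PowerSeries K) F Ah]
    exact (algebraMap F Ah).injective.comp (IsFractionRing.injective _ _)
  have hX : algebraMap (PowerSeries K) Ah PowerSeries.X ≠ 0 := by
    rw [Ne, map_eq_zero_iff _ hinj]; exact PowerSeries.X_ne_zero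
  have hfin : Finite W := Nat.finite_of_card_ne_zero (by
    have : 0 < q ^ a := Nat.pow_pos (by omega)
    omega)
  have : Fintype W := Fintype.ofFinite W
  obtain ⟨P, α, hPm, hPd, hα, hPW, hPev⟩ := local_factor hq he hm hD (algebraMap (PowerSeries K) Ah) a
    φ hφ W hW hcard
  let S : Finset Ah := Finset.univ.image (fun w : W => algebraMap (PowerSeries K) Ah w)
  have hS : ∀ s, s ∈ S ↔ ∃ w ∈ W, algebraMap (PowerSeries K) Ah w = s := by
    intro s; simp [S]
  have hSc : S.card = Nat.card W := by
    rw [Finset.card_image_of_injective _ (fun x y h => Subtype.ext (hinj h)), Finset.card_univ,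
      Nat.card_eq_fintype_card]
  have h0 : (0 : Ah) ∈ S := (hS 0).mpr ⟨0, W.zero_mem, map_zero _⟩
  have hadd : ∀ x ∈ S, ∀ y ∈ S, x + y ∈ S := by
    intro x hx y hy
    obtain ⟨w, hw, rfl⟩ := (hS x).mp hx
    obtain ⟨w', hw', rfl⟩ := (hS y).mp hy
    exact (hS _).mpr ⟨w + w', W.add_mem hw hw', map_add _ _ _⟩
  have hneg : ∀ x ∈ S, -x ∈ S := by
    intro x hx
    obtain ⟨w, hw, rfl⟩ := (hS x).mp hx
    exact (hS _).mpr ⟨-w, W.neg_mem hw, map_neg _ _⟩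
  have hPA : P.map (algebraMap (PowerSeries K) Ah) = nmp S := by
    have hm' := hPm.map (algebraMap (PowerSeries K) Ah)
    have hdvd : nmp S ∣ P.map (algebraMap (PowerSeries K) Ah) := by
      rw [nmp]
      refine Finset.prod_dvd_of_coprime ?_ ?_
      · intro x _ y _ hxy
        exact pairwise_coprime_X_sub_C (Function.injective_id) hxy
      · intro x hx
        obtain ⟨w, hw, rfl⟩ := (hS x).mp hx
        rw [dvd_iff_isRoot, IsRoot.def, eval_map, eval₂_at_apply, hPW w hw, map_zero]
    refine (eq_of_monic_of_dvd_of_natDegree_le (nmp_monic S) hm' hdvd ?_)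
    rw [hPm.natDegree_map, hPd, nmp_natDegree, hSc]; exact hcard
  have hSc' : S.card = p ^ (e * a) := by
    rw [← nmp_natDegree, ← hPA, hPm.natDegree_map, hPd, hq, ← pow_mul]
  have hPF : (P.map (algebraMap (PowerSeries K) F)).map (algebraMap F Ah) = nmp S := by
    rw [Polynomial.map_map, ← IsScalarTower.algebraMap_eq, hPA]
  have hu : ∀ v : Ah, ev q (a + D) (fun i => algebraMap (PowerSeries K) Ah (φ i)) v = 0 →
      nm S v ≠ 0 → ∃ z, PowerSeries.constantCoeff z ≠ 0 ∧
        algebraMap (PowerSeries K) Ah PowerSeries.X ^ m * nm S v = algebraMap (PowerSeries K) Ah z := by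
    intro v hv hnz
    rw [hPev, hPA, eval_nmp] at hv
    exact local_tame hq he hm _ hinj α hα hD _ hnz hv
  constructor
  · intro v hv hnv w hw
    obtain ⟨z, hz, hzv⟩ := hu v hv (by
      rw [Ne, nm_eq_zero, hS]
      rintro ⟨w, hw, h⟩
      exact hnv w hw h.symm)
    exact wild_core (p := p) hm hpm S hSc' h0 hadd hneg (fun s hs => by
      obtain ⟨w, _, h⟩ := (hS s).mp hs
      exact ⟨w, h⟩) _ hPF v z hz hzv _ ((hS _).mpr ⟨w, hw, rfl⟩)
  · intro γ v hv
    by_cases hnz : nm S v = 0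
    · obtain ⟨w, hw, rfl⟩ := (hS v).mp ((nm_eq_zero S v).mp hnz)
      refine ⟨0, W.zero_mem, ?_⟩
      rw [map_zero, add_zero, hcomp]; exact γ.commutes _
    · obtain ⟨z, hz, hzv⟩ := hu v hv hnz
      have h1 : γ (nm S v) = nm S (γ v) := by
        rw [nm, map_prod]
        refine Finset.prod_congr rfl fun s hs => ?_
        obtain ⟨w, hw, rfl⟩ := (hS s).mp hs
        rw [map_sub, hcomp]; congr 1; exact γ.commutes _
      have h2 : γ (nm S v) = nm S v := by
        have h3 := congrArg γ hzv
        rw [map_mul, map_pow, hcomp z, hcomp PowerSeries.X, γ.commutes, γ.commutes, ← hcomp, ← hcomp,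
          ← hzv] at h3
        exact mul_left_cancel₀ (pow_ne_zero _ hX) h3
      have h4 : γ v - v ∈ S := by
        rw [← nm_eq_zero, nm_sub S h0 hadd hneg, ← h1, h2, sub_self]
      obtain ⟨w, hw, h⟩ := (hS _).mp h4
      exact ⟨w, hw, by rw [h]; ring⟩

end wild
end Scat

set_option linter.all false
namespace Scat
open Polynomial

abbrev FF (K : Type*) [Field K] := FractionRing (PowerSeries K)
abbrev AA (K : Type*) [Field K] := AlgebraicClosure (FF K)

section
variable {K E Ω : Type*} [Field K] [Field E] [Field Ω] [Algebra K[X] E] [IsFractionRing K[X] E]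
  [Algebra E Ω] [Algebra K[X] Ω] [IsScalarTower K[X] E Ω] [Algebra K Ω] [IsScalarTower K K[X] Ω]

/-- evaluation of polynomials at `t` in the Laurent series field -/
noncomputable def evt (t : FF K) : K[X] →+* FF K :=
  Polynomial.eval₂RingHom ((algebraMap (PowerSeries K) (FF K)).comp PowerSeries.C) t

theorem evt_C (t : FF K) (b : K) : evt t (C b) = algebraMap (PowerSeries K) (FF K) (PowerSeries.C b) := by
  simp [evt]

theorem evt_X (t : FF K) : evt t X = t := by simp [evt]

theorem evt_inj [IsAlgClosed K] (t : FF K)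
    (ht : ∀ b : K, t ≠ algebraMap (PowerSeries K) (FF K) (PowerSeries.C b)) :
    Function.Injective (evt t) := by
  rw [injective_iff_map_eq_zero]
  intro P hP
  by_contra hP0
  have h1 := (IsAlgClosed.splits P).eq_prod_roots
  rw [h1, map_mul, map_multiset_prod, mul_eq_zero] at hP
  rcases hP with h | h
  · rw [evt_C, map_eq_zero_iff _ (IsFractionRing.injective _ _),
      map_eq_zero_iff _ PowerSeries.C_injective, leadingCoeff_eq_zero] at h
    exact hP0 h
  · rw [Multiset.map_map, Multiset.prod_eq_zero_iff, Multiset.mem_map] at h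
    obtain ⟨b, _, hb⟩ := h
    rw [Function.comp_apply, map_sub, evt_X, evt_C, sub_eq_zero] at hb
    exact ht b hb

variable (Ω) in
structure Place (q k : ℕ) (c : ℕ → K[X]) (η : PowerSeries K) (φ : ℕ → PowerSeries K) (t : FF K) where
  ι : Ω →+* AA K
  hι : ∀ P : K[X], ι (algebraMap K[X] Ω P) = algebraMap (FF K) (AA K) (evt t P)
  κ : FF K
  κ0 : κ ≠ 0
  η0 : η ≠ 0
  hκ : ∀ i ≤ k, evt t (c i) * algebraMap _ (FF K) η ^ q ^ i = κ * algebraMap _ (FF K) (φ i)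

variable {q k : ℕ} {c : ℕ → K[X]} {η : PowerSeries K} {φ : ℕ → PowerSeries K} {t : FF K}

theorem fcomp (x : PowerSeries K) : algebraMap (PowerSeries K) (AA K) x =
    algebraMap (FF K) (AA K) (algebraMap (PowerSeries K) (FF K) x) :=
  IsScalarTower.algebraMap_apply _ _ _ x

theorem finj : Function.Injective (algebraMap (PowerSeries K) (AA K)) := by
  rw [IsScalarTower.algebraMap_eq (PowerSeries K) (FF K) (AA K)]
  exact (algebraMap (FF K) (AA K)).injective.comp (IsFractionRing.injective _ _)

include E in
variable (E) in
theorem place_exists [IsAlgClosed K] [Algebra.IsAlgebraic E Ω]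
    (ht : ∀ b : K, t ≠ algebraMap (PowerSeries K) (FF K) (PowerSeries.C b))
    (κ : FF K) (κ0 : κ ≠ 0) (η0 : η ≠ 0)
    (hκ : ∀ i ≤ k, evt t (c i) * algebraMap _ (FF K) η ^ q ^ i = κ * algebraMap _ (FF K) (φ i)) :
    Nonempty (Place Ω q k c η φ t) := by
  obtain ⟨ι, hι⟩ := exists_extend (Ω := Ω) ((algebraMap (FF K) (AA K)).comp
    (IsFractionRing.lift (A := K[X]) (K := E) (evt_inj t ht)))
  refine ⟨⟨ι, fun P => ?_, κ, κ0, η0, hκ⟩⟩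
  rw [IsScalarTower.algebraMap_apply K[X] E Ω, hι, RingHom.comp_apply, IsFractionRing.lift_algebraMap]

namespace Place
variable (pl : Place Ω q k c η φ t)

theorem root_iff {x : Ω} {y : AA K} (hxy : pl.ι x = algebraMap (PowerSeries K) (AA K) η * y) :
    x ∈ VV Ω q k c ↔ ev q k (fun i => algebraMap (PowerSeries K) (AA K) (φ i)) y = 0 := by
  have h1 := map_ev q k (fun i => algebraMap K[X] Ω (c i)) pl.ι x
  have h2 : ev q k (fun i => pl.ι (algebraMap K[X] Ω (c i))) (pl.ι x) =
      algebraMap (FF K) (AA K) pl.κ * ev q k (fun i => algebraMap (PowerSeries K) (AA K) (φ i)) y := by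
    rw [ev, ev, Finset.mul_sum]
    refine Finset.sum_congr rfl fun i hi => ?_
    rw [Finset.mem_range] at hi
    rw [pl.hι, hxy, mul_pow, ← mul_assoc, ← mul_assoc, fcomp, ← map_pow, ← map_mul,
      pl.hκ i (by omega), map_mul, ← fcomp]
  have h3 : algebraMap (FF K) (AA K) pl.κ ≠ 0 := by
    rw [Ne, map_eq_zero_iff _ (algebraMap (FF K) (AA K)).injective]; exact pl.κ0
  show ev q k (fun i => algebraMap K[X] Ω (c i)) x = 0 ↔ _
  rw [← map_eq_zero_iff pl.ι pl.ι.injective, h1, h2, mul_eq_zero, or_iff_right h3]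

include pl in
theorem fη0 : algebraMap (PowerSeries K) (AA K) η ≠ 0 := by
  rw [Ne, map_eq_zero_iff _ finj]; exact pl.η0

theorem surj (hq1 : 1 < q) (hk : c k = 1)
    (hspl : (evp q k (fun i => algebraMap K[X] E (c i))).IsSplittingField E Ω) (y : AA K)
    (hy : ev q k (fun i => algebraMap (PowerSeries K) (AA K) (φ i)) y = 0) :
    ∃ x ∈ VV Ω q k c, pl.ι x = algebraMap (PowerSeries K) (AA K) η * y := by
  have hs := hspl.splits'
  rw [map_evp] at hs
  set L := evp q k (fun i => algebraMap E Ω (algebraMap K[X] E (c i))) with hL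
  have hLe : L = evp q k (fun i => algebraMap K[X] Ω (c i)) := by
    rw [hL]; congr 1; funext i; rw [← IsScalarTower.algebraMap_apply]
  have hL0 : L ≠ 0 := by
    rw [hLe]
    exact evp_ne_zero hq1 k _ le_rfl (by rw [hk, map_one]; exact one_ne_zero)
  -- value at the point
  have h1 : (L.map pl.ι).eval (algebraMap (PowerSeries K) (AA K) η * y) = 0 := by
    rw [hLe, map_evp, eval_evp]
    have h2 : ev q k (fun i => pl.ι (algebraMap K[X] Ω (c i))) (algebraMap (PowerSeries K) (AA K) η * y) =
      algebraMap (FF K) (AA K) pl.κ * ev q k (fun i => algebraMap (PowerSeries K) (AA K) (φ i)) y := by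
      rw [ev, ev, Finset.mul_sum]
      refine Finset.sum_congr rfl fun i hi => ?_
      rw [Finset.mem_range] at hi
      rw [pl.hι, mul_pow, ← mul_assoc, ← mul_assoc, fcomp, ← map_pow, ← map_mul,
        pl.hκ i (by omega), map_mul, ← fcomp]
    rw [h2, hy, mul_zero]
  rw [hs.eq_prod_roots, Polynomial.map_mul, eval_mul, map_C, eval_C, mul_eq_zero,
    Polynomial.map_multiset_prod, eval_multiset_prod, Multiset.prod_eq_zero_iff] at h1
  rcases h1 with h1 | h1
  · rw [map_eq_zero_iff _ pl.ι.injective, leadingCoeff_eq_zero] at h1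
    exact absurd h1 hL0
  · simp only [Multiset.map_map, Multiset.mem_map] at h1
    obtain ⟨x, hx, h⟩ := h1
    simp only [Function.comp_apply, Polynomial.map_sub, map_X, map_C, eval_sub, eval_X, eval_C] at h
    rw [mem_roots hL0, IsRoot.def, hLe, eval_evp] at hx
    exact ⟨x, hx, (sub_eq_zero.mp h).symm⟩

/-- `v` is a root which is `η` times a power series with constant coefficient `b` -/
def Rep (v : Ω) (b : K) : Prop := v ∈ VV Ω q k c ∧ ∃ z : PowerSeries K,
  pl.ι v = algebraMap (PowerSeries K) (AA K) (η * z) ∧ PowerSeries.constantCoeff z = b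

variable {p e : ℕ} [Fact p.Prime] [CharP K p]

theorem rep_root {v : Ω} (hv : v ∈ VV Ω q k c) {z : PowerSeries K}
    (hz : pl.ι v = algebraMap (PowerSeries K) (AA K) (η * z)) : ev q k φ z = 0 := by
  rw [map_mul] at hz
  have := (pl.root_iff hz).mp hv
  rw [← map_ev, map_eq_zero_iff _ finj] at this
  exact this

variable {pl} in
theorem Rep.eqn {v : Ω} {b : K} (h : pl.Rep v b) :
    ev q k (fun i => PowerSeries.constantCoeff (φ i)) b = 0 := by
  obtain ⟨hv, z, hz, rfl⟩ := h
  rw [← map_ev, pl.rep_root hv hz, map_zero]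

variable {pl} in
theorem Rep.unique (he : 0 < e) (hq : q = p ^ e) (h0 : PowerSeries.constantCoeff (φ 0) ≠ 0)
    {v v' : Ω} {b : K} (h : pl.Rep v b) (h' : pl.Rep v' b) : v = v' := by
  obtain ⟨hv, z, hz, hb⟩ := h
  obtain ⟨hv', z', hz', hb'⟩ := h'
  have : z = z' := hensel_unique he hq k φ h0 (pl.rep_root hv hz) (pl.rep_root hv' hz') (hb.trans hb'.symm)
  apply pl.ι.injective
  rw [hz, hz', this]

theorem rep_exists (he : 0 < e) (hq : q = p ^ e) (h0 : PowerSeries.constantCoeff (φ 0) ≠ 0)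
    (hk : c k = 1)
    (hspl : (evp q k (fun i => algebraMap K[X] E (c i))).IsSplittingField E Ω) {b : K}
    (hb : ev q k (fun i => PowerSeries.constantCoeff (φ i)) b = 0) : ∃ v, pl.Rep v b := by
  obtain ⟨z, hz, hzb⟩ := hensel_exists he hq k φ h0 b hb
  obtain ⟨x, hx, h⟩ := pl.surj (one_lt_q (p := p) he hq) hk hspl (algebraMap _ _ z) (by
    rw [← map_ev, hz, map_zero])
  exact ⟨x, hx, z, by rw [h, map_mul], hzb⟩

variable {pl} in
theorem Rep.add [CharP Ω p] (hq : q = p ^ e) {v v' : Ω} {b b' : K} (h : pl.Rep v b) (h' : pl.Rep v' b') :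
    pl.Rep (v + v') (b + b') := by
  obtain ⟨hv, z, hz, hb⟩ := h
  obtain ⟨hv', z', hz', hb'⟩ := h'
  refine ⟨?_, z + z', ?_, by rw [map_add, hb, hb']⟩
  · show ev _ _ _ _ = 0
    have h1 : ev q k (fun i => algebraMap K[X] Ω (c i)) v = 0 := hv
    have h2 : ev q k (fun i => algebraMap K[X] Ω (c i)) v' = 0 := hv'
    rw [ev_add (p := p) hq, h1, h2, add_zero]
  · rw [map_add, hz, hz', ← map_add, mul_add]

include pl in
theorem ι_K (b : K) : pl.ι (algebraMap K Ω b) = algebraMap (PowerSeries K) (AA K) (PowerSeries.C b) := by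
  rw [IsScalarTower.algebraMap_apply K K[X] Ω, pl.hι]
  rw [show algebraMap K K[X] b = C b from rfl, evt_C, ← fcomp]

variable {pl} in
theorem Rep.smul [CharP Ω p] (hq : q = p ^ e) {v : Ω} {b s : K} (h : pl.Rep v b) (hs : s ^ q = s) :
    pl.Rep (algebraMap K Ω s * v) (s * b) := by
  obtain ⟨hv, z, hz, hb⟩ := h
  refine ⟨?_, PowerSeries.C s * z, ?_, by rw [map_mul, hb]; simp⟩
  · show ev _ _ _ _ = 0
    have h1 : ev q k (fun i => algebraMap K[X] Ω (c i)) v = 0 := hv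
    rw [ev_smul (by rw [← map_pow, hs]), h1, mul_zero]
  · rw [map_mul, hz, pl.ι_K, ← map_mul]; congr 1; ring

variable {pl} in
theorem Rep.zero (he : 0 < e) (hq : q = p ^ e) (h0 : PowerSeries.constantCoeff (φ 0) ≠ 0)
    {v : Ω} (h : pl.Rep v 0) : v = 0 := by
  refine h.unique he hq h0 ⟨?_, 0, by simp, by simp⟩
  exact ev_zero (by have := one_lt_q (p := p) he hq; omega) _ _

variable {pl} in
theorem Rep.ne_zero {v : Ω} {b : K} (h : pl.Rep v b) (hb : b ≠ 0) : v ≠ 0 := by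
  rintro rfl
  obtain ⟨_, z, hz, rfl⟩ := h
  rw [map_zero, eq_comm, map_eq_zero_iff _ finj, mul_eq_zero, or_iff_right pl.η0] at hz
  rw [hz, map_zero] at hb
  exact hb rfl

/-- restriction of endomorphisms to `Ω` -/
theorem restrict_hom (hq1 : 1 < q) (hk : c k = 1)
    (hspl : (evp q k (fun i => algebraMap K[X] E (c i))).IsSplittingField E Ω)
    (s : AA K →+* AA K) (ρ : K →+* K) (hρ : ∀ i, (c i).map ρ = c i)
    (h1 : ∀ P : K[X], s (pl.ι (algebraMap K[X] Ω P)) = pl.ι (algebraMap K[X] Ω (P.map ρ))) :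
    ∃ s0 : Ω →+* Ω, (∀ x, pl.ι (s0 x) = s (pl.ι x)) ∧
      (∀ P, s0 (algebraMap K[X] Ω P) = algebraMap K[X] Ω (P.map ρ)) ∧
      ∀ v ∈ VV Ω q k c, s0 v ∈ VV Ω q k c := by
  let B : Subfield Ω := (pl.ι.fieldRange.comap (s.comp pl.ι))
  have hB : ∀ x, x ∈ B ↔ ∃ y, pl.ι y = s (pl.ι x) := fun x => Iff.rfl
  have hBE : ∀ x : E, algebraMap E Ω x ∈ B := by
    intro x
    obtain ⟨a, b, _, rfl⟩ := IsFractionRing.div_surjective (A := K[X]) x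
    rw [map_div₀]
    refine B.div_mem ?_ ?_ <;>
    · rw [← IsScalarTower.algebraMap_apply, hB, h1]; exact ⟨_, rfl⟩
  let B' : Subalgebra E Ω := { B.toSubring.toSubsemiring with algebraMap_mem' := hBE }
  have hV : ∀ v ∈ VV Ω q k c, ∃ y ∈ VV Ω q k c, pl.ι y = s (pl.ι v) := by
    intro v hv
    have hη := pl.fη0
    obtain ⟨y, hy, h⟩ := pl.surj hq1 hk hspl (s (pl.ι v) / algebraMap (PowerSeries K) (AA K) η) (by
      have h3 : ev q k (fun i => algebraMap K[X] Ω (c i)) v = 0 := hv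
      have h4 : s (pl.ι (ev q k (fun i => algebraMap K[X] Ω (c i)) v)) = 0 := by
        rw [h3, map_zero, map_zero]
      rw [map_ev, map_ev] at h4
      simp only [h1, hρ] at h4
      -- convert
      have h2 : ev q k (fun i => pl.ι (algebraMap K[X] Ω (c i))) (s (pl.ι v)) =
        algebraMap (FF K) (AA K) pl.κ * ev q k (fun i => algebraMap (PowerSeries K) (AA K) (φ i))
          (s (pl.ι v) / algebraMap (PowerSeries K) (AA K) η) := by
        rw [ev, ev, Finset.mul_sum]
        refine Finset.sum_congr rfl fun i hi => ?_
        rw [Finset.mem_range] at hi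
        rw [pl.hι, ← mul_assoc, fcomp (φ i), ← map_mul, ← pl.hκ i (by omega), map_mul, map_pow,
          ← fcomp, mul_assoc, ← mul_pow, mul_div_cancel₀ _ hη]
      rw [h2, mul_eq_zero] at h4
      refine h4.resolve_left ?_
      rw [map_eq_zero_iff _ (algebraMap (FF K) (AA K)).injective]; exact pl.κ0)
    exact ⟨y, hy, by rw [h, mul_div_cancel₀ _ hη]⟩
  have hL0 : evp q k (fun i => algebraMap K[X] E (c i)) ≠ 0 :=
    evp_ne_zero hq1 k _ le_rfl (by rw [hk, map_one]; exact one_ne_zero)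
  have htop : B' = ⊤ := by
    rw [← top_le_iff, ← hspl.adjoin_rootSet']
    refine Algebra.adjoin_le ?_
    intro v hv
    rw [mem_rootSet_of_ne hL0, aeval_def, ← eval_map, map_evp, eval_evp] at hv
    simp only [← IsScalarTower.algebraMap_apply] at hv
    obtain ⟨y, _, h⟩ := hV v hv
    exact (hB v).mpr ⟨y, h⟩
  have hall : ∀ x, ∃ y, pl.ι y = s (pl.ι x) := by
    intro x
    have : x ∈ B' := by rw [htop]; trivial
    exact (hB x).mp this
  choose g hg using hall
  let s0 : Ω →+* Ω :=
    { toFun := g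
      map_one' := pl.ι.injective (by rw [hg]; simp)
      map_mul' := fun x y => pl.ι.injective (by rw [hg]; simp [hg])
      map_zero' := pl.ι.injective (by rw [hg]; simp)
      map_add' := fun x y => pl.ι.injective (by rw [hg]; simp [hg]) }
  refine ⟨s0, hg, ?_, ?_⟩
  · intro P; apply pl.ι.injective; rw [← h1]; exact hg _
  · intro v hv
    obtain ⟨y, hy, h⟩ := hV v hv
    have : s0 v = y := pl.ι.injective (by rw [h]; exact hg v)
    rwa [this]

theorem push (hq1 : 1 < q) (hk : c k = 1)
    (hspl : (evp q k (fun i => algebraMap K[X] E (c i))).IsSplittingField E Ω)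
    (τ : PowerSeries K →+* PowerSeries K) (hτ : Function.Injective τ) (ρ : K →+* K)
    (hρ : ∀ i, (c i).map ρ = c i) (hτC : ∀ b, τ (PowerSeries.C b) = PowerSeries.C (ρ b))
    (hτ0 : ∀ z, PowerSeries.constantCoeff (τ z) = ρ (PowerSeries.constantCoeff z))
    (ζ : K) (hη : τ η = PowerSeries.C ζ * η)
    (ht : ∀ s : FF K →+* FF K, (∀ x, s (algebraMap _ _ x) = algebraMap _ _ (τ x)) → s t = t) :
    ∃ s0 : Ω →+* Ω, (∀ P, s0 (algebraMap K[X] Ω P) = algebraMap K[X] Ω (P.map ρ)) ∧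
      ∀ v b, pl.Rep v b → pl.Rep (s0 v) (ζ * ρ b) := by
  let τF : FF K →+* FF K := IsFractionRing.map hτ
  have hτF : ∀ x, τF (algebraMap _ _ x) = algebraMap _ _ (τ x) := fun x => by
    simp [τF, IsFractionRing.map, -FractionRing.mk_eq_div]
  obtain ⟨s, hs⟩ := exists_extend (Ω := AA K) ((algebraMap (FF K) (AA K)).comp τF)
  have hsR : ∀ x, s (algebraMap (PowerSeries K) (AA K) x) = algebraMap (PowerSeries K) (AA K) (τ x) := by
    intro x; rw [fcomp, hs, RingHom.comp_apply, hτF, ← fcomp]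
  have hst := ht τF hτF
  have hevt : ∀ P, τF (evt t P) = evt t (P.map ρ) := by
    intro P
    have : τF.comp (evt t) = (evt t).comp (mapRingHom ρ) := by
      ext b
      · simp [evt_C, hτF, hτC]
      · simp [evt_X, hst]
    exact congrArg (fun f => f P) this
  obtain ⟨s0, h1, h2, h3⟩ := pl.restrict_hom hq1 hk hspl s ρ hρ (fun P => by
    rw [pl.hι, hs, RingHom.comp_apply, hevt, pl.hι])
  refine ⟨s0, h2, ?_⟩
  rintro v b ⟨hv, z, hz, rfl⟩
  refine ⟨h3 v hv, PowerSeries.C ζ * τ z, ?_, by rw [map_mul, hτ0]; simp⟩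
  rw [h1, hz, hsR, map_mul, hη]; congr 1; ring

end Place
end
end Scat

set_option linter.all false
namespace Scat
open Polynomial
section
variable {K E Ω : Type*} [Field K] [Field E] [Field Ω] [Algebra K[X] E] [IsFractionRing K[X] E]
  [Algebra E Ω] [Algebra K[X] Ω] [IsScalarTower K[X] E Ω] [Algebra K Ω] [IsScalarTower K K[X] Ω]

theorem to_gal [FiniteDimensional E Ω] (s0 : Ω →+* Ω)
    (h : ∀ P, s0 (algebraMap K[X] Ω P) = algebraMap K[X] Ω P) :
    ∃ g : Ω ≃ₐ[E] Ω, ∀ x, g x = s0 x := by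
  have hE : ∀ x : E, s0 (algebraMap E Ω x) = algebraMap E Ω x := by
    intro x
    obtain ⟨a, b, _, rfl⟩ := IsFractionRing.div_surjective (A := K[X]) x
    rw [map_div₀, map_div₀, ← IsScalarTower.algebraMap_apply, ← IsScalarTower.algebraMap_apply, h, h]
  let f : Ω →ₐ[E] Ω := { s0 with commutes' := hE }
  refine ⟨AlgEquiv.ofBijective f (f.bijective), fun x => rfl⟩

variable {q k : ℕ} {c : ℕ → K[X]} {η : PowerSeries K} {φ : ℕ → PowerSeries K} {t : FF K}
variable {p e : ℕ} [Fact p.Prime] [CharP K p]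

theorem lcond_res (hq1 : 1 < q) {m D a : ℕ} (hm : 0 < m) (hD : 0 < D) (hφ : LCond q m D a φ) (b : K) :
    ev q (a + D) (fun i => PowerSeries.constantCoeff (φ i)) b =
      ev q a (fun i => PowerSeries.constantCoeff (φ i)) b := by
  rw [ev, ev, show a + D + 1 = (a + 1) + D by omega, Finset.sum_range_add, add_eq_left]
  refine Finset.sum_eq_zero fun j hj => ?_
  rw [Finset.mem_range] at hj
  have : PowerSeries.constantCoeff (φ (a + 1 + j)) = 0 := by
    rw [← PowerSeries.X_dvd_iff]
    rcases Nat.lt_or_ge (j + 1) D with h2 | h2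
    · have := hφ.mid (j + 1) (by omega) h2
      rw [show a + 1 + j = a + (j + 1) by omega]
      exact (dvd_pow_self _ (by omega)).trans this
    · obtain ⟨ε, _, hε⟩ := hφ.top
      have h3 : a + 1 + j = a + D := by omega
      rw [h3, hε]
      refine Dvd.dvd.mul_left (dvd_pow_self _ ?_) _
      have : 1 < q ^ D := Nat.one_lt_pow (by omega) hq1
      have : 0 < m * (q ^ D - 1) := Nat.mul_pos hm (by omega)
      omega
  rw [this, zero_mul]

/-- the group of power series roots -/
def Wgrp (q k : ℕ) (φ : ℕ → PowerSeries K) (hq : q = p ^ e) (he : 0 < e) : AddSubgroup (PowerSeries K) where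
  carrier := {z | ev q k φ z = 0}
  zero_mem' := ev_zero (by have := one_lt_q (p := p) he hq; omega) _ _
  add_mem' := by
    intro x y hx hy
    simp only [Set.mem_setOf_eq] at *
    rw [ev_add (p := p) hq, hx, hy, add_zero]
  neg_mem' := by
    intro x hx
    simp only [Set.mem_setOf_eq] at *
    have h0 : ev q k φ 0 = 0 := ev_zero (by have := one_lt_q (p := p) he hq; omega) _ _
    rw [← zero_sub, ev_sub (p := p) hq, h0, hx, sub_zero]

theorem Wgrp_card [IsAlgClosed K] (hq : q = p ^ e) (he : 0 < e) {m D a : ℕ} (hm : 0 < m) (hD : 0 < D)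
    (hφ : LCond q m D a φ) (h0 : PowerSeries.constantCoeff (φ 0) ≠ 0) :
    q ^ a ≤ Nat.card (Wgrp q (a + D) φ hq he) := by
  have hq1 := one_lt_q (p := p) he hq
  have h1 := rts_card_of_splits (p := p) he hq a (fun i => PowerSeries.constantCoeff (φ i)) h0 hφ.ua
    (IsAlgClosed.splits _)
  have hφ0 : φ 0 ≠ 0 := fun h => h0 (by simp [h])
  have hfin : Finite (Wgrp q (a + D) φ hq he) := by
    have hinj : Function.Injective (algebraMap (PowerSeries K) (FF K)) := IsFractionRing.injective _ _
    have h2 := rts_finite hq1 (a + D) (fun i => algebraMap (PowerSeries K) (FF K) (φ i)) (i := 0)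
      (Nat.zero_le _) (by rwa [Ne, map_eq_zero_iff _ hinj])
    have h3 : Finite (rts q (a + D) (fun i => algebraMap (PowerSeries K) (FF K) (φ i))) := h2
    refine Finite.of_injective (β := rts q (a + D) (fun i => algebraMap (PowerSeries K) (FF K) (φ i)))
      (fun z => ⟨algebraMap _ _ (z : PowerSeries K), ?_⟩) ?_
    · show ev _ _ _ _ = 0
      have : ev q (a + D) φ z = 0 := z.2
      rw [← map_ev, this, map_zero]
    · intro x y h
      exact Subtype.ext (hinj (Subtype.mk.inj h))
  rw [← h1]
  have h4 : ∀ b ∈ rts q a (fun i => PowerSeries.constantCoeff (φ i)), ∃ z, ev q (a + D) φ z = 0 ∧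
      PowerSeries.constantCoeff z = b := fun b hb =>
    hensel_exists he hq (a + D) φ h0 b (by rw [lcond_res hq1 hm hD hφ]; exact hb)
  choose! g hg hg' using h4
  rw [← Nat.card_coe_set_eq]
  refine Nat.card_le_card_of_injective (fun b : rts q a (fun i => PowerSeries.constantCoeff (φ i)) =>
    (⟨g b, hg b b.2⟩ : Wgrp q (a + D) φ hq he)) ?_
  intro x y h
  apply Subtype.ext
  rw [← hg' x x.2, ← hg' y y.2]
  exact congrArg _ (Subtype.mk.inj h)

namespace Place
variable (pl : Place Ω q k c η φ t)

theorem wildG [IsAlgClosed K] [FiniteDimensional E Ω] (hq : q = p ^ e) (he : 0 < e) (hk : c k = 1)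
    (hspl : (evp q k (fun i => algebraMap K[X] E (c i))).IsSplittingField E Ω)
    {m D a : ℕ} (hm : 0 < m) (hD : 0 < D) (hpm : ¬ p ∣ m)
    (hφ : LCond q m D a φ) (h0 : PowerSeries.constantCoeff (φ 0) ≠ 0) (hkD : k = a + D) :
    ∀ v ∈ VV Ω q k c, (∀ b, ¬ pl.Rep v b) → ∀ w b, pl.Rep w b →
    ∃ g : Ω ≃ₐ[E] Ω, g v = v + w ∧ (∀ v' b', pl.Rep v' b' → g v' = v') ∧
      ∀ v' ∈ VV Ω q k c, ∃ w' b', pl.Rep w' b' ∧ g v' = v' + w' := by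
  have hq1 := one_lt_q (p := p) he hq
  intro v hv hnv w b hw
  subst hkD
  have : CharP (FF K) p := charP_of_injective_algebraMap (IsFractionRing.injective (PowerSeries K) (FF K)) p
  have : CharP (AA K) p := charP_of_injective_algebraMap (algebraMap (FF K) (AA K)).injective p
  obtain ⟨hA, hB⟩ := wild (F := FF K) (Ah := AA K) hq he hm hD hpm φ hφ (Wgrp q (a + D) φ hq he)
    (fun w hw => hw) (Wgrp_card hq he hm hD hφ h0)
  have hη := pl.fη0
  have hdiv : ∀ x, pl.ι x = algebraMap (PowerSeries K) (AA K) η *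
      (pl.ι x / algebraMap (PowerSeries K) (AA K) η) := fun x => (mul_div_cancel₀ _ hη).symm
  obtain ⟨hwV, z, hz, hzb⟩ := hw
  have hγK : ∀ (γ : AA K ≃ₐ[FF K] AA K) (x : PowerSeries K), γ (algebraMap _ _ x) = algebraMap _ _ x := by
    intro γ x; rw [fcomp]; exact γ.commutes _
  obtain ⟨γ, hγ⟩ := hA (pl.ι v / algebraMap _ _ η) ((pl.root_iff (hdiv v)).mp hv) (by
    intro z hz h
    refine hnv (PowerSeries.constantCoeff z) ⟨hv, z, ?_, rfl⟩
    rw [hdiv v, h, map_mul]) z (pl.rep_root hwV hz)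
  obtain ⟨s0, h1, h2, h3⟩ := pl.restrict_hom hq1 hk hspl (γ : AA K →+* AA K) (RingHom.id K)
    (fun i => Polynomial.map_id) (fun P => by
      rw [Polynomial.map_id, pl.hι]; exact γ.commutes _)
  simp only [Polynomial.map_id] at h2
  obtain ⟨g, hg⟩ := to_gal (E := E) s0 h2
  refine ⟨g, ?_, ?_, ?_⟩
  · apply pl.ι.injective
    rw [hg, h1, map_add, hz, RingHom.coe_coe]
    rw [map_div₀, hγK, div_eq_iff hη, add_mul, div_mul_cancel₀ _ hη] at hγ
    rw [hγ, map_mul]; ring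
  · rintro v' b' ⟨hv', z', hz', _⟩
    apply pl.ι.injective
    rw [hg, h1, hz']; exact hγK γ _
  · intro v' hv'
    obtain ⟨z', hz', h⟩ := hB γ _ ((pl.root_iff (hdiv v')).mp hv')
    obtain ⟨w', hw', h'⟩ := pl.surj hq1 hk hspl (algebraMap _ _ z') (by
      have : ev q (a + D) φ z' = 0 := hz'
      rw [← map_ev, this, map_zero])
    refine ⟨w', PowerSeries.constantCoeff z', ⟨hw', z', by rw [h', map_mul], rfl⟩, ?_⟩
    apply pl.ι.injective
    rw [hg, h1, map_add, h', RingHom.coe_coe]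
    rw [map_div₀, hγK, div_eq_iff hη, add_mul, div_mul_cancel₀ _ hη] at h
    rw [h]; ring

end Place
end
end Scat

set_option linter.all false
namespace Scat
open Polynomial
section
variable {K E Ω : Type*} [Field K] [Field E] [Field Ω] [Algebra K[X] E] [IsFractionRing K[X] E]
  [Algebra E Ω] [Algebra K[X] Ω] [IsScalarTower K[X] E Ω] [Algebra K Ω] [IsScalarTower K K[X] Ω]
variable {q k : ℕ} {c : ℕ → K[X]} {η : PowerSeries K} {φ : ℕ → PowerSeries K} {t : FF K}
variable {p e : ℕ} [Fact p.Prime] [CharP K p]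

variable (E) in
/-- the outputs of the analysis at infinity -/
structure InfData (p q k : ℕ) [Fact p.Prime] [CharP K p] (c : ℕ → K[X]) (a0 : K)
    (Rp : Ω → K → Prop) : Prop where
  mem : ∀ {v b}, Rp v b → v ∈ VV Ω q k c
  eqn : ∀ {v b}, Rp v b → b ^ q ^ 2 = a0 * b
  ex : ∀ b, b ^ q ^ 2 = a0 * b → ∃ v, Rp v b
  uniq : ∀ {v v' b}, Rp v b → Rp v' b → v = v'
  add : ∀ {v v' b b'}, Rp v b → Rp v' b' → Rp (v + v') (b + b')
  smul : ∀ {v b s}, s ^ q = s → Rp v b → Rp (algebraMap K Ω s * v) (s * b)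
  zero : ∀ {v}, Rp v 0 → v = 0
  ne0 : ∀ {v b}, Rp v b → b ≠ 0 → v ≠ 0
  singer : ∀ ζ : K, ζ ^ (q ^ 2 - 1) = 1 → ∃ g : Ω ≃ₐ[E] Ω, ∀ v b, Rp v b → Rp (g v) (ζ * b)
  frob : ∀ n, (∀ i, (c i).map (iterateFrobenius K p n) = c i) → ∃ s : Ω →+* Ω,
    (∀ P, s (algebraMap K[X] Ω P) = algebraMap K[X] Ω (P.map (iterateFrobenius K p n))) ∧
    ∀ v b, Rp v b → Rp (s v) (b ^ p ^ n)

theorem t_ne {M : ℕ} (hM : 0 < M)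
    (ht : t = algebraMap (PowerSeries K) (FF K) (PowerSeries.X ^ M) ∨
      t = (algebraMap (PowerSeries K) (FF K) (PowerSeries.X ^ M))⁻¹) :
    ∀ b : K, t ≠ algebraMap (PowerSeries K) (FF K) (PowerSeries.C b) := by
  have hinj : Function.Injective (algebraMap (PowerSeries K) (FF K)) := IsFractionRing.injective _ _
  have key : ∀ b : K, (PowerSeries.X ^ M : PowerSeries K) ≠ PowerSeries.C b := by
    intro b h
    have h1 := congrArg (PowerSeries.coeff M) h
    rw [PowerSeries.coeff_X_pow_self, PowerSeries.coeff_C, if_neg hM.ne'] at h1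
    exact one_ne_zero h1
  intro b
  rcases ht with rfl | rfl
  · exact fun h => key b (hinj h)
  · intro h
    rw [inv_eq_iff_eq_inv] at h
    by_cases hb : b = 0
    · rw [hb, map_zero, map_zero, inv_zero, map_eq_zero_iff _ hinj] at h
      exact pow_ne_zero _ PowerSeries.X_ne_zero h
    · refine key b⁻¹ (hinj ?_)
      rw [h]
      refine inv_eq_of_mul_eq_one_right ?_
      rw [← map_mul, ← map_mul, mul_inv_cancel₀ hb, map_one, map_one]

theorem inf_of_place [IsAlgClosed K] [FiniteDimensional E Ω] [CharP Ω p] (hq : q = p ^ e) (he : 0 < e)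
    (hk : c k = 1)
    (hspl : (evp q k (fun i => algebraMap K[X] E (c i))).IsSplittingField E Ω)
    {N : ℕ} (hN : 0 < N) (pl : Place Ω q k c (PowerSeries.X ^ N) φ t)
    (ht : t = algebraMap (PowerSeries K) (FF K) (PowerSeries.X ^ (N * (q ^ 2 - 1))) ∨
      t = (algebraMap (PowerSeries K) (FF K) (PowerSeries.X ^ (N * (q ^ 2 - 1))))⁻¹)
    (h0 : PowerSeries.constantCoeff (φ 0) ≠ 0) {a0 : K}
    (hres : ∀ b, ev q k (fun i => PowerSeries.constantCoeff (φ i)) b = 0 ↔ b ^ q ^ 2 = a0 * b) :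
    InfData E p q k c a0 pl.Rep := by
  have hq1 := one_lt_q (p := p) he hq
  have htτ : ∀ (τ : PowerSeries K →+* PowerSeries K), τ (PowerSeries.X ^ (N * (q ^ 2 - 1))) =
      PowerSeries.X ^ (N * (q ^ 2 - 1)) →
      ∀ s : FF K →+* FF K, (∀ x, s (algebraMap _ _ x) = algebraMap _ _ (τ x)) → s t = t := by
    intro τ hτ s hs
    rcases ht with h | h <;> rw [h]
    · rw [hs, hτ]
    · rw [map_inv₀, hs, hτ]
  refine ⟨fun h => h.1, fun h => (hres _).mp h.eqn, fun b hb => ?_, fun h h' => h.unique he hq h0 h',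
    fun h h' => h.add hq h', fun hs h => h.smul hq hs, fun h => h.zero he hq h0,
    fun h hb => h.ne_zero hb, ?_, ?_⟩
  · exact pl.rep_exists he hq h0 hk hspl ((hres b).mpr hb)
  · intro ζ hζ
    obtain ⟨θ, hθ⟩ := IsAlgClosed.exists_pow_nat_eq ζ hN
    have hζ0 : ζ ≠ 0 := by
      rintro rfl
      rw [zero_pow (by have : 1 < q ^ 2 := Nat.one_lt_pow (by omega) hq1
                       omega)] at hζ
      exact zero_ne_one hζ
    have hθ0 : θ ≠ 0 := by rintro rfl; rw [zero_pow hN.ne'] at hθ; exact hζ0 hθ.symm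
    have hX : ∀ M, PowerSeries.rescale θ (PowerSeries.X ^ M : PowerSeries K) =
        PowerSeries.C (θ ^ M) * PowerSeries.X ^ M := by
      intro M
      rw [map_pow, PowerSeries.rescale_X, mul_pow, map_pow]
    obtain ⟨s0, h1, h2⟩ := pl.push hq1 hk hspl (PowerSeries.rescale θ) (by
        intro x y hxy
        ext n
        have := congrArg (PowerSeries.coeff n) hxy
        rw [PowerSeries.coeff_rescale, PowerSeries.coeff_rescale] at this
        exact mul_left_cancel₀ (pow_ne_zero _ hθ0) this) (RingHom.id K) (fun i => Polynomial.map_id)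
      (fun b => by
        ext n
        rw [PowerSeries.coeff_rescale, RingHom.id_apply, PowerSeries.coeff_C]
        split_ifs with h
        · simp [h]
        · simp)
      (fun z => by
        rw [← PowerSeries.coeff_zero_eq_constantCoeff_apply, PowerSeries.coeff_rescale]; simp)
      ζ (by rw [hX, hθ]) (htτ _ (by rw [hX, pow_mul, hθ, hζ, map_one, one_mul]))
    simp only [Polynomial.map_id] at h1
    obtain ⟨g, hg⟩ := to_gal (E := E) s0 h1
    exact ⟨g, fun v b hv => by rw [hg]; exact h2 v b hv⟩
  · intro n hn
    obtain ⟨s0, h1, h2⟩ := pl.push hq1 hk hspl (PowerSeries.map (iterateFrobenius K p n)) (by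
        intro x y hxy
        ext m
        have := congrArg (PowerSeries.coeff m) hxy
        rw [PowerSeries.coeff_map, PowerSeries.coeff_map] at this
        exact (iterateFrobenius K p n).injective this) (iterateFrobenius K p n) hn
      (fun b => by simp)
      (fun z => by rw [← PowerSeries.coeff_zero_eq_constantCoeff_apply, PowerSeries.coeff_map, PowerSeries.coeff_zero_eq_constantCoeff_apply])
      1 (by simp) (htτ _ (by simp))
    refine ⟨s0, h1, fun v b hv => ?_⟩
    have := h2 v b hv
    rwa [one_mul, iterateFrobenius_def] at this

/-- coefficients for `d ≥ 3` -/
noncomputable def cA (a : ℕ → K) (i : ℕ) : K[X] := if i = 2 then -X else C (a i)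

noncomputable def phA (q d : ℕ) (a : ℕ → K) (i : ℕ) : PowerSeries K :=
  if i = 2 then -1 else PowerSeries.C (a i) * (PowerSeries.X ^ (q ^ (d - 2) - 1)) ^ (q ^ i - 1)

theorem lcondA (hq1 : 1 < q) {d : ℕ} (hd : 3 ≤ d) (a : ℕ → K) (had : a d = 1) :
    LCond q (q ^ d - 1) (d - 2) 2 (phA q d a) := by
  obtain ⟨D, rfl⟩ : ∃ D, d = D + 2 := ⟨d - 2, by omega⟩
  refine ⟨by simp [phA], ⟨1, one_ne_zero, ?_⟩, ?_⟩
  · rw [phA, if_neg (by omega), show 2 + (D + 2 - 2) = D + 2 by omega, had, ← pow_mul,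
      mul_comm (q ^ (D + 2 - 2) - 1)]
  · intro j hj hjD
    rw [phA, if_neg (by omega), ← pow_mul]
    refine Dvd.dvd.mul_left (pow_dvd_pow _ ?_) _
    simp only [Nat.add_sub_cancel] at *
    have h1 : q ^ j < q ^ D := Nat.pow_lt_pow_right hq1 hjD
    have h2 : 1 ≤ q ^ j := Nat.one_le_pow _ _ (by omega)
    have h3 : 1 < q ^ 2 := Nat.one_lt_pow (by omega) hq1
    rw [pow_add q D 2, pow_add q 2 j]
    obtain ⟨x, hx⟩ : ∃ x, q ^ j = x + 1 := ⟨q ^ j - 1, by omega⟩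
    obtain ⟨y, hy⟩ : ∃ y, q ^ D = x + 1 + (y + 1) := ⟨q ^ D - q ^ j - 1, by omega⟩
    obtain ⟨w, hw⟩ : ∃ w, q ^ 2 = w + 2 := ⟨q ^ 2 - 2, by omega⟩
    rw [hx, hy, hw]
    have e1 : (x + 1 + (y + 1)) * (w + 2) - 1 = x * w + y * w + 2 * w + 2 * x + 2 * y + 3 := by
      have : (x + 1 + (y + 1)) * (w + 2) = x * w + y * w + 2 * w + 2 * x + 2 * y + 3 + 1 := by ring
      omega
    have e2 : (w + 2) * (x + 1) - 1 = w * x + w + 2 * x + 1 := by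
      have : (w + 2) * (x + 1) = w * x + w + 2 * x + 1 + 1 := by ring
      omega
    rw [e1, e2, show x + 1 + (y + 1) - 1 = x + y + 1 by omega, Nat.add_sub_cancel]
    nlinarith [Nat.zero_le (x*w), Nat.zero_le (y*w)]

include E in
variable (E) in
theorem placeA [IsAlgClosed K] [FiniteDimensional E Ω] (hq1 : 1 < q) {d : ℕ} (hd : 3 ≤ d) (a : ℕ → K) :
    ∃ t : FF K, t = (algebraMap (PowerSeries K) (FF K)
        (PowerSeries.X ^ ((q ^ (d - 2) - 1) * (q ^ 2 - 1))))⁻¹ ∧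
      Nonempty (Place Ω q d (cA a) (PowerSeries.X ^ (q ^ (d - 2) - 1)) (phA q d a) t) := by
  have hN : 0 < q ^ (d - 2) - 1 := by
    have : 1 < q ^ (d - 2) := Nat.one_lt_pow (by omega) hq1
    omega
  have h2 : 1 < q ^ 2 := Nat.one_lt_pow (by omega) hq1
  have hinj : Function.Injective (algebraMap (PowerSeries K) (FF K)) := IsFractionRing.injective _ _
  have hη : algebraMap (PowerSeries K) (FF K) (PowerSeries.X ^ (q ^ (d - 2) - 1)) ≠ 0 := by
    rw [Ne, map_eq_zero_iff _ hinj]; exact pow_ne_zero _ PowerSeries.X_ne_zero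
  refine ⟨_, rfl, place_exists E (t_ne (Nat.mul_pos hN (by omega : 0 < q ^ 2 - 1)) (Or.inr rfl))
    (algebraMap (PowerSeries K) (FF K) (PowerSeries.X ^ (q ^ (d - 2) - 1))) hη
    (pow_ne_zero _ PowerSeries.X_ne_zero) ?_⟩
  intro i _
  have hqi : q ^ i = q ^ i - 1 + 1 := (Nat.sub_add_cancel (Nat.one_le_pow _ _ (by omega))).symm
  rw [cA, phA]
  split_ifs with hi
  · subst hi
    rw [map_neg, evt_X, map_neg, map_one, pow_mul, map_pow]
    have : algebraMap (PowerSeries K) (FF K) (PowerSeries.X ^ (q ^ (d - 2) - 1)) ^ q ^ 2 =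
       algebraMap (PowerSeries K) (FF K) (PowerSeries.X ^ (q ^ (d - 2) - 1)) ^ (q ^ 2 - 1) *
        algebraMap (PowerSeries K) (FF K) (PowerSeries.X ^ (q ^ (d - 2) - 1)) := by
      rw [← pow_succ, Nat.sub_add_cancel (by omega)]
    rw [this, neg_mul, ← mul_assoc, inv_mul_cancel₀ (pow_ne_zero _ hη)]; ring
  · rw [evt_C, hqi, pow_succ, map_mul, Nat.add_sub_cancel, map_pow _ (PowerSeries.X ^ (q ^ (d - 2) - 1))]; ring

theorem resA (hq1 : 1 < q) {d : ℕ} (hd : 3 ≤ d) (a : ℕ → K) (b : K) :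
    ev q d (fun i => PowerSeries.constantCoeff (phA q d a i)) b = 0 ↔ b ^ q ^ 2 = a 0 * b := by
  have hN : 0 < q ^ (d - 2) - 1 := by
    have : 1 < q ^ (d - 2) := Nat.one_lt_pow (by omega) hq1
    omega
  have h : ev q d (fun i => PowerSeries.constantCoeff (phA q d a i)) b = a 0 * b - b ^ q ^ 2 := by
    obtain ⟨D, rfl⟩ : ∃ D, d = D + 2 := ⟨d - 2, by omega⟩
    rw [ev, show D + 2 + 1 = 3 + D by omega, Finset.sum_range_add, Finset.sum_eq_zero (s := Finset.range D), add_zero,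
      Finset.sum_range_succ, Finset.sum_range_succ, Finset.sum_range_succ, Finset.sum_range_zero]
    · have : PowerSeries.constantCoeff (phA q (D + 2) a 1) = 0 := by
        rw [phA, if_neg (by omega), map_mul, map_pow, map_pow, PowerSeries.constantCoeff_X,
          zero_pow hN.ne', zero_pow (by rw [pow_one]; omega), mul_zero]
      rw [this]
      simp [phA]; ring
    · intro j _
      have : PowerSeries.constantCoeff (phA q (D + 2) a (3 + j)) = 0 := by
        rw [phA, if_neg (by omega), map_mul, map_pow, map_pow, PowerSeries.constantCoeff_X,
          zero_pow hN.ne', zero_pow, mul_zero]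
        have : 1 < q ^ (3 + j) := Nat.one_lt_pow (by omega) hq1
        omega
      rw [this, zero_mul]
  rw [h, sub_eq_zero, eq_comm]

/-- coefficients for `d = 1` -/
noncomputable def cB (a0 : K) (i : ℕ) : K[X] :=
  if i = 0 then -(C a0 * X) else if i = 1 then -X else if i = 2 then 1 else 0

noncomputable def phB (q : ℕ) (a0 : K) (i : ℕ) : PowerSeries K :=
  if i = 0 then PowerSeries.C a0 else if i = 1 then PowerSeries.X ^ (q - 1) else -1

noncomputable def phB0 (q : ℕ) (a0 : K) (i : ℕ) : PowerSeries K :=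
  if i = 0 then PowerSeries.C a0 else if i = 1 then 1 else - PowerSeries.X ^ (q - 1)

include E in
variable (E) in
theorem placeB [IsAlgClosed K] [FiniteDimensional E Ω] (hq1 : 1 < q) (a0 : K) :
    ∃ t : FF K, t = algebraMap (PowerSeries K) (FF K) (PowerSeries.X ^ (1 * (q ^ 2 - 1))) ∧
      Nonempty (Place Ω q 2 (cB a0) (PowerSeries.X ^ 1) (phB q a0) t) := by
  have h2 : 1 < q ^ 2 := Nat.one_lt_pow (by omega) hq1
  have hinj : Function.Injective (algebraMap (PowerSeries K) (FF K)) := IsFractionRing.injective _ _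
  have hη : algebraMap (PowerSeries K) (FF K) PowerSeries.X ≠ 0 := by
    rw [Ne, map_eq_zero_iff _ hinj]; exact PowerSeries.X_ne_zero
  refine ⟨_, rfl, place_exists E (t_ne (by omega : 0 < 1 * (q ^ 2 - 1)) (Or.inl rfl))
    (- algebraMap (PowerSeries K) (FF K) PowerSeries.X ^ (q ^ 2)) (neg_ne_zero.mpr (pow_ne_zero _ hη))
    (pow_ne_zero _ PowerSeries.X_ne_zero) ?_⟩
  intro i hi
  have hsucc : algebraMap (PowerSeries K) (FF K) PowerSeries.X ^ (q ^ 2) =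
    algebraMap (PowerSeries K) (FF K) PowerSeries.X ^ (q ^ 2 - 1) * algebraMap (PowerSeries K) (FF K) PowerSeries.X := by
    rw [← pow_succ, Nat.sub_add_cancel (by omega)]
  have hsucc' : algebraMap (PowerSeries K) (FF K) PowerSeries.X ^ q =
    algebraMap (PowerSeries K) (FF K) PowerSeries.X ^ (q - 1) * algebraMap (PowerSeries K) (FF K) PowerSeries.X := by
    rw [← pow_succ, Nat.sub_add_cancel (by omega)]
  interval_cases i
  · simp only [cB, phB, if_true, map_neg, map_mul, evt_C, evt_X, one_mul, map_pow, pow_one, pow_zero]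
    rw [hsucc]; ring
  · simp only [cB, phB, if_true, map_neg, map_mul, evt_C, evt_X, one_mul, map_pow, pow_one, pow_zero,
      one_ne_zero, if_false]
    rw [hsucc, hsucc']; ring
  · simp [cB, phB]

theorem resB (hq1 : 1 < q) (a0 : K) (b : K) :
    ev q 2 (fun i => PowerSeries.constantCoeff (phB q a0 i)) b = 0 ↔ b ^ q ^ 2 = a0 * b := by
  have h : ev q 2 (fun i => PowerSeries.constantCoeff (phB q a0 i)) b = a0 * b - b ^ q ^ 2 := by
    have hq' : q - 1 ≠ 0 := by omega
    rw [ev, Finset.sum_range_succ, Finset.sum_range_succ, Finset.sum_range_succ, Finset.sum_range_zero]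
    simp [phB, hq']; ring
  rw [h, sub_eq_zero, eq_comm]

theorem lcondB (hq1 : 1 < q) (a0 : K) : LCond q 1 1 1 (phB0 q a0) := by
  refine ⟨by simp [phB0], ⟨-1, by simp, ?_⟩, by omega⟩
  simp [phB0]

include E in
variable (E) in
theorem placeB0 [IsAlgClosed K] [FiniteDimensional E Ω] (hq1 : 1 < q) (a0 : K) :
    ∃ t : FF K, Nonempty (Place Ω q 2 (cB a0) 1 (phB0 q a0) t) := by
  have hinj : Function.Injective (algebraMap (PowerSeries K) (FF K)) := IsFractionRing.injective _ _
  have hη : algebraMap (PowerSeries K) (FF K) (PowerSeries.X ^ (q - 1)) ≠ 0 := by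
    rw [Ne, map_eq_zero_iff _ hinj]; exact pow_ne_zero _ PowerSeries.X_ne_zero
  refine ⟨(algebraMap (PowerSeries K) (FF K) (PowerSeries.X ^ (q - 1)))⁻¹, 
    place_exists E (t_ne (by omega : 0 < q - 1) (Or.inr rfl))
    (- (algebraMap (PowerSeries K) (FF K) (PowerSeries.X ^ (q - 1)))⁻¹) (neg_ne_zero.mpr (inv_ne_zero hη))
    one_ne_zero ?_⟩
  intro i hi
  rw [map_one, one_pow, mul_one]
  interval_cases i
  · simp only [cB, phB0, if_true, map_neg, map_mul, evt_C, evt_X]; ring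
  · simp [cB, phB0, evt_X]
  · simp only [cB, phB0, OfNat.ofNat_ne_zero, if_false, OfNat.ofNat_ne_one, if_true, map_one, map_neg]
    rw [neg_mul_neg, inv_mul_cancel₀ hη]

end
end Scat

set_option linter.all false
namespace Scat
open Polynomial
section
variable {K : Type*} [Field K] {p e q : ℕ} [Fact p.Prime] [CharP K p]

def om (q : ℕ) (x y : K) : K := x * y ^ q - y * x ^ q

theorem om_frob {a0 x y : K} (hq : q = p ^ e) (hx : x ^ q ^ 2 = a0 * x) (hy : y ^ q ^ 2 = a0 * y) :
    om q x y ^ q = - a0 * om q x y := by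
  have h := sub_pow_q (p := p) hq 1 (x * y ^ q) (y * x ^ q)
  rw [pow_one] at h
  rw [om, h, mul_pow, mul_pow, ← pow_mul, ← pow_mul, ← sq, hx, hy]; ring

theorem om_ratio {x y : K} (hx : x ≠ 0) (h : om q x y = 0) : (y / x) ^ q = y / x := by
  rw [div_pow, div_eq_div_iff (pow_ne_zero _ hx) hx]
  rw [om, sub_eq_zero] at h
  rw [mul_comm, h]

theorem om_self (x : K) : om q x x = 0 := by rw [om, sub_self]

theorem gl [IsAlgClosed K] (hq : q = p ^ e) (he : 0 < e) {a0 : K} (ha0 : a0 ≠ 0) (H : (K → K) → Prop)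
    (hcomp : ∀ f g, H f → H g → H (fun x => f (g x)))
    (hS : ∀ ζ : K, ζ ^ (q ^ 2 - 1) = 1 → H (fun x => ζ * x))
    {c0 : K} (hc0 : c0 ^ q ^ 2 = a0 * c0) (hc00 : c0 ≠ 0)
    (hT : ∀ μ : K, - a0 * μ ^ q = μ → H (fun c => c + μ * om q c0 c * c0))
    {c c' d d' : K} (hc : c ^ q ^ 2 = a0 * c) (hc' : c' ^ q ^ 2 = a0 * c')
    (hd : d ^ q ^ 2 = a0 * d) (hd' : d' ^ q ^ 2 = a0 * d') (hcc : om q c c' ≠ 0) (hdd : om q d d' ≠ 0) :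
    ∃ h, H h ∧ h c = d ∧ h c' = d' := by
  have hq1 := one_lt_q (p := p) he hq
  have hq2 : 1 < q ^ 2 := Nat.one_lt_pow (by omega) hq1
  have hadd : ∀ x y : K, (x + y) ^ q = x ^ q + y ^ q := fun x y => by
    have h := add_pow_q (p := p) hq 1 x y
    rwa [pow_one] at h
  have hsub : ∀ x y : K, (x - y) ^ q = x ^ q - y ^ q := fun x y => by
    have h := sub_pow_q (p := p) hq 1 x y
    rwa [pow_one] at h
  have hneg : ∀ x : K, (- x) ^ q = - x ^ q := fun x => by
    have h := neg_pow_q (p := p) hq 1 x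
    rwa [pow_one] at h
  have hq0 : (0 : K) ^ q = 0 := zero_pow (by omega)
  have hom0 : ∀ x y : K, om q x y ≠ 0 → x ≠ 0 ∧ y ≠ 0 := by
    intro x y h
    constructor
    · rintro rfl; apply h; rw [om, hq0]; ring
    · rintro rfl; apply h; rw [om, hq0]; ring
  -- ratios are Singer elements
  have hrat : ∀ x y : K, x ≠ 0 → y ≠ 0 → x ^ q ^ 2 = a0 * x → y ^ q ^ 2 = a0 * y →
      (y / x) ^ (q ^ 2 - 1) = 1 := by
    intro x y hx0 hy0 hx hy
    have h1 : (y / x) ^ (q ^ 2 - 1) * (y / x) = 1 * (y / x) := by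
      rw [← pow_succ, Nat.sub_add_cancel (by omega), div_pow, hx, hy, one_mul, mul_div_mul_left _ _ ha0]
    exact mul_right_cancel₀ (div_ne_zero hy0 hx0) h1
  have homS : ∀ z x y : K, om q (z * x) (z * y) = z ^ (q + 1) * om q x y := by
    intro z x y; rw [om, om, mul_pow, mul_pow]; ring
  have hSF : ∀ z x : K, z ^ (q ^ 2 - 1) = 1 → x ^ q ^ 2 = a0 * x → (z * x) ^ q ^ 2 = a0 * (z * x) := by
    intro z x hz hx
    have : z ^ q ^ 2 = z := by
      conv_lhs => rw [← Nat.sub_add_cancel (show 1 ≤ q ^ 2 by omega), pow_succ, hz, one_mul]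
    rw [mul_pow, hx, this]; ring
  -- all transvections
  have hTall : ∀ w : K, w ≠ 0 → w ^ q ^ 2 = a0 * w → ∀ μ : K, - a0 * μ ^ q = μ →
      H (fun c => c + μ * om q w c * w) := by
    intro w hw0 hw μ hμ
    set z := w / c0 with hz
    have hz1 := hrat c0 w hc00 hw0 hc0 hw
    have hz0 : z ≠ 0 := div_ne_zero hw0 hc00
    have hzw : w = z * c0 := (div_mul_cancel₀ w hc00).symm
    have hzq : (z ^ (q + 1)) ^ q = z ^ (q + 1) := by
      have : z ^ q ^ 2 = z := by
        conv_lhs => rw [← Nat.sub_add_cancel (show 1 ≤ q ^ 2 by omega), pow_succ, hz1, one_mul]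
      rw [← pow_mul, show (q + 1) * q = q ^ 2 + q by ring, pow_add, this]; ring
    have h1 := hT (μ * z ^ (q + 1)) (by rw [mul_pow, hzq, ← mul_assoc, hμ])
    have h2 := hcomp _ _ (hS z hz1) (hcomp _ _ h1 (hS z⁻¹ (by rw [inv_pow, hz1, inv_one])))
    have h3 : (fun c => c + μ * om q w c * w) =
        (fun x => z * (z⁻¹ * x + μ * z ^ (q + 1) * om q c0 (z⁻¹ * x) * c0)) := by
      funext x
      have h4 : om q w x = z ^ (q + 1) * om q c0 (z⁻¹ * x) := by
        rw [← homS, ← hzw, mul_inv_cancel_left₀ hz0]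
      rw [h4]
      conv_lhs => rw [hzw]
      field_simp
    rw [h3]; exact h2
  -- transvections preserve om
  have hμF : ∀ μ x y : K, - a0 * μ ^ q = μ → x ^ q ^ 2 = a0 * x → y ^ q ^ 2 = a0 * y →
      (μ * om q x y) ^ q = μ * om q x y := by
    intro μ x y hμ hx hy
    rw [mul_pow, om_frob hq hx hy]
    linear_combination (om q x y) * hμ
  have hTom : ∀ w μ x y : K, - a0 * μ ^ q = μ → w ^ q ^ 2 = a0 * w → x ^ q ^ 2 = a0 * x →
      y ^ q ^ 2 = a0 * y → om q (x + μ * om q w x * w) (y + μ * om q w y * w) = om q x y := by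
    intro w μ x y hμ hw hx hy
    have h1 := hμF μ w x hμ hw hx
    have h2 := hμF μ w y hμ hw hy
    have e1 : om q (x + μ * om q w x * w) (y + μ * om q w y * w) =
      (x + μ * om q w x * w) * (y ^ q + μ * om q w y * w ^ q) -
      (y + μ * om q w y * w) * (x ^ q + μ * om q w x * w ^ q) := by
      rw [om, hadd, hadd, mul_pow (μ * om q w x), mul_pow (μ * om q w y), h1, h2]
    rw [e1]
    simp only [om]; ring
  have hTF : ∀ w μ x : K, - a0 * μ ^ q = μ → w ^ q ^ 2 = a0 * w → x ^ q ^ 2 = a0 * x →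
      (x + μ * om q w x * w) ^ q ^ 2 = a0 * (x + μ * om q w x * w) := by
    intro w μ x hμ hw hx
    have h1 := pow_q_pow (hμF μ w x hμ hw hx) 2
    rw [add_pow_q (p := p) hq, mul_pow, h1, hw, hx]; ring
  -- direct move
  have hmove : ∀ u v : K, u ^ q ^ 2 = a0 * u → v ^ q ^ 2 = a0 * v → om q u v ≠ 0 →
      ∃ h, H h ∧ h u = v ∧ (∀ x, x ^ q ^ 2 = a0 * x → (h x) ^ q ^ 2 = a0 * h x ∧
        om q v (h x) = om q u x) := by
    intro u v hu hv huv
    have hw : (u - v) ^ q ^ 2 = a0 * (u - v) := by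
      rw [sub_pow_q (p := p) hq, hu, hv]; ring
    have hw0 : u - v ≠ 0 := by
      intro h
      rw [sub_eq_zero] at h
      rw [h, om_self] at huv; exact huv rfl
    have hμ : - a0 * (- (om q u v)⁻¹) ^ q = - (om q u v)⁻¹ := by
      rw [hneg, inv_pow, om_frob hq hu hv]; field_simp
    have huv' : u + - (om q u v)⁻¹ * om q (u - v) u * (u - v) = v := by
      have : om q (u - v) u = om q u v := by rw [om, om, hsub]; ring
      rw [this]; field_simp; ring
    refine ⟨_, hTall _ hw0 hw _ hμ, huv', fun x hx => ⟨hTF _ _ _ hμ hw hx, ?_⟩⟩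
    have := hTom (u - v) _ u x hμ hw hu hx
    rwa [huv'] at this
  have hcc0 := hom0 _ _ hcc
  have hdd0 := hom0 _ _ hdd
  -- step 1
  set z1 := d / c with hz1
  have hz1S := hrat c d hcc0.1 hdd0.1 hc hd
  set y := z1 * c' with hy
  have hyF := hSF z1 c' hz1S hc'
  have hzc : z1 * c = d := div_mul_cancel₀ d hcc0.1
  have hdy : om q d y ≠ 0 := by
    rw [← hzc, hy, homS]
    exact mul_ne_zero (pow_ne_zero _ (div_ne_zero hdd0.1 hcc0.1)) hcc
  -- step 2
  obtain ⟨ζ, hζ⟩ := IsAlgClosed.exists_pow_nat_eq (om q d d' / om q d y) (Nat.succ_pos q)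
  have hζ1 : (ζ ^ (q + 1)) ^ (q - 1) = 1 := by
    have h0 : ζ ^ (q + 1) ≠ 0 := by rw [hζ]; exact div_ne_zero hdd hdy
    have : (ζ ^ (q + 1)) ^ q = ζ ^ (q + 1) := by
      rw [hζ, div_pow, om_frob hq hd hd', om_frob hq hd hyF, mul_div_mul_left _ _ (neg_ne_zero.mpr ha0)]
    apply mul_right_cancel₀ h0
    rw [← pow_succ, Nat.sub_add_cancel (by omega), this, one_mul]
  have hζS : ζ ^ (q ^ 2 - 1) = 1 := by
    rw [← pow_mul] at hζ1
    rwa [show q ^ 2 - 1 = (q + 1) * (q - 1) by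
      rw [← Nat.sq_sub_sq]]
  have hζ0 : ζ ≠ 0 := by
    rintro rfl
    rw [zero_pow (by omega)] at hζS; exact zero_ne_one hζS
  have hζd := hSF ζ d hζS hd
  have hζy := hSF ζ y hζS hyF
  have hom2 : om q (ζ * d) (ζ * y) = om q d d' := by
    rw [homS, hζ, div_mul_cancel₀ _ hdy]
  have hstep3 : ∃ h, H h ∧ h (ζ * d) = d ∧ (∀ x, x ^ q ^ 2 = a0 * x → (h x) ^ q ^ 2 = a0 * h x ∧
        om q d (h x) = om q (ζ * d) x) := by
    by_cases h0 : om q (ζ * d) d = 0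
    · have hζF : ζ ^ q = ζ := by
        rw [om, mul_pow, sub_eq_zero] at h0
        have : d * d ^ q ≠ 0 := mul_ne_zero hdd0.1 (pow_ne_zero _ hdd0.1)
        apply mul_right_cancel₀ this
        linear_combination -h0
      have h1 : om q (ζ * d) d' ≠ 0 := by
        have : om q (ζ * d) d' = ζ * om q d d' := by rw [om, om, mul_pow, hζF]; ring
        rw [this]; exact mul_ne_zero hζ0 hdd
      have h2 : om q d' d ≠ 0 := by
        have : om q d' d = - om q d d' := by rw [om, om]; ring
        rw [this]; exact neg_ne_zero.mpr hdd
      obtain ⟨f, hf, hf1, hf2⟩ := hmove _ _ hζd hd' h1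
      obtain ⟨g, hg, hg1, hg2⟩ := hmove _ _ hd' hd h2
      refine ⟨_, hcomp _ _ hg hf, by rw [hf1, hg1], fun x hx => ⟨(hg2 _ (hf2 x hx).1).1, ?_⟩⟩
      rw [(hg2 _ (hf2 x hx).1).2, (hf2 x hx).2]
    · exact hmove _ _ hζd hd h0
  obtain ⟨h, hh, hh1, hh2⟩ := hstep3
  obtain ⟨hyF2, hom3⟩ := hh2 _ hζy
  rw [hom2] at hom3
  set y2 := h (ζ * y) with hy2
  have hom4 : om q d (d' - y2) = 0 := by
    have : om q d (d' - y2) = om q d d' - om q d y2 := by rw [om, om, om, hsub]; ring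
    rw [this, hom3, sub_self]
  have hs := om_ratio hdd0.1 hom4
  set s := (d' - y2) / d with hsdef
  have hμ : - a0 * (s / om q d d') ^ q = s / om q d d' := by
    rw [div_pow, hs, om_frob hq hd hd']; field_simp
  have hT4 := hTall d hdd0.1 hd _ hμ
  refine ⟨_, hcomp _ _ hT4 (hcomp _ _ hh (hcomp _ _ (hS ζ hζS) (hS z1 hz1S))), ?_, ?_⟩
  · simp only [hzc]
    rw [hh1, om_self]; ring
  · simp only [← hy, ← hy2]
    rw [hom3, div_mul_cancel₀ _ hdd, hsdef, div_mul_cancel₀ _ hdd0.1]; ring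
end
end Scat

set_option linter.all false
namespace Scat
open Polynomial
section
variable {K E Ω : Type*} [Field K] [Field E] [Field Ω] [Algebra K[X] E] [IsFractionRing K[X] E]
  [Algebra E Ω] [Algebra K[X] Ω] [IsScalarTower K[X] E Ω] [Algebra K Ω] [IsScalarTower K K[X] Ω]
variable {q k : ℕ} {c : ℕ → K[X]}
variable {p e : ℕ} [Fact p.Prime] [CharP K p]

theorem exists_zeta [IsAlgClosed K] (hq : q = p ^ e) (he : 0 < e) :
    ∃ ζ : K, ζ ^ q ^ 2 = ζ ∧ ζ ^ q ≠ ζ := by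
  by_contra hcon
  push Not at hcon
  have hq1 := one_lt_q (p := p) he hq
  have h1 := card_fixed K p e he
  have h2 := card_fixed K p (e * 2) (by omega)
  have h3 : {x : K | x ^ p ^ (e * 2) = x} ⊆ {x : K | x ^ p ^ e = x} := by
    intro x hx
    have := hcon x (by rw [hq, ← pow_mul]; exact hx)
    rw [hq] at this; exact this
  have h4 : {x : K | x ^ p ^ e = x}.Finite := Set.finite_of_ncard_pos (by rw [h1, ← hq]; omega)
  have h5 := Set.ncard_le_ncard h3 h4
  rw [h1, h2, pow_mul, ← hq] at h5
  nlinarith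

theorem exists_basis [IsAlgClosed K] (hq : q = p ^ e) (he : 0 < e) {a0 c0 : K} (hc0 : c0 ≠ 0)
    (h : c0 ^ q ^ 2 = a0 * c0) : ∃ c1, c1 ^ q ^ 2 = a0 * c1 ∧ om q c0 c1 ≠ 0 := by
  obtain ⟨ζ, h1, h2⟩ := exists_zeta (K := K) (p := p) hq he
  refine ⟨ζ * c0, by rw [mul_pow, h1, h]; ring, ?_⟩
  have : om q c0 (ζ * c0) = c0 * c0 ^ q * (ζ ^ q - ζ) := by rw [om, mul_pow]; ring
  rw [this]
  exact mul_ne_zero (mul_ne_zero hc0 (pow_ne_zero _ hc0)) (sub_ne_zero.mpr h2)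

theorem exists_c0 [IsAlgClosed K] (hq : q = p ^ e) (he : 0 < e) {a0 : K} (ha0 : a0 ≠ 0) :
    ∃ c0 : K, c0 ≠ 0 ∧ c0 ^ q ^ 2 = a0 * c0 := by
  have hq1 := one_lt_q (p := p) he hq
  have hq2 : 1 < q ^ 2 := Nat.one_lt_pow (by omega) hq1
  obtain ⟨z, hz⟩ := IsAlgClosed.exists_pow_nat_eq a0 (by omega : 0 < q ^ 2 - 1)
  refine ⟨z, ?_, ?_⟩
  · rintro rfl; rw [zero_pow (by omega)] at hz; exact ha0 hz.symm
  · rw [← hz, ← pow_succ, Nat.sub_add_cancel (by omega)]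

theorem InfData.indep {a0 : K} {Rp : Ω → K → Prop} (D : InfData E p q k c a0 Rp) (hq : q = p ^ e) (he : 0 < e)
    {x y : Ω} {b b' : K} (hx : Rp x b) (hy : Rp y b') (h : om q b b' ≠ 0) (s : K) (hs : s ^ q = s) :
    y ≠ algebraMap K Ω s * x := by
  intro h1
  have h2 := D.smul (s := -s) (by
    have h := neg_pow_q (p := p) hq 1 s
    rw [pow_one] at h
    rw [h, hs]) hx
  have h3 := D.add hy h2
  have h4 : b' + -s * b ≠ 0 := by
    intro h5
    apply h
    have : b' = s * b := by linear_combination h5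
    rw [this, om, mul_pow, hs]; ring
  apply D.ne0 h3 h4
  rw [map_neg, h1]; ring

theorem gal_poly (g : Ω ≃ₐ[E] Ω) (P : K[X]) : g (algebraMap K[X] Ω P) = algebraMap K[X] Ω P := by
  rw [IsScalarTower.algebraMap_apply K[X] E Ω]
  exact g.commutes _

theorem gal_K (g : Ω ≃ₐ[E] Ω) (b : K) : g (algebraMap K Ω b) = algebraMap K Ω b := by
  rw [IsScalarTower.algebraMap_apply K K[X] Ω]
  exact gal_poly g _

theorem fin_gl [IsAlgClosed K] (hq : q = p ^ e) (he : 0 < e) {a0 : K} (ha0 : a0 ≠ 0) {Rp : Ω → K → Prop}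
    (D : InfData E p q k c a0 Rp) {c0 : K} (hc0 : c0 ^ q ^ 2 = a0 * c0) (hc00 : c0 ≠ 0)
    (hT : ∀ μ : K, - a0 * μ ^ q = μ → ∃ g : Ω ≃ₐ[E] Ω, ∀ v b, Rp v b → Rp (g v) (b + μ * om q c0 b * c0))
    (n : ℕ) (hn : ∀ i, (c i).map (iterateFrobenius K p n) = c i) (han : a0 ^ p ^ n = a0) :
    ∃ s : Ω →+* Ω, (∀ P, s (algebraMap K[X] Ω P) =
      algebraMap K[X] Ω (P.map (iterateFrobenius K p n))) ∧
      ∃ x ∈ VV Ω q k c, ∃ y ∈ VV Ω q k c, s x = x ∧ s y = y ∧ x ≠ 0 ∧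
        (∀ b : K, b ^ q = b → y ≠ algebraMap K Ω b * x) := by
  obtain ⟨c1, hc1, hom⟩ := exists_basis hq he hc00 hc0
  obtain ⟨s0, hs0, hs0R⟩ := D.frob n hn
  have hF : ∀ b : K, b ^ q ^ 2 = a0 * b → (b ^ p ^ n) ^ q ^ 2 = a0 * b ^ p ^ n := by
    intro b hb
    rw [← pow_mul, mul_comm, pow_mul, hb, mul_pow, han]
  have hom' : om q (c0 ^ p ^ n) (c1 ^ p ^ n) ≠ 0 := by
    have : om q (c0 ^ p ^ n) (c1 ^ p ^ n) = (om q c0 c1) ^ p ^ n := by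
      rw [om, om, sub_pow_expChar_pow, mul_pow, mul_pow]
      ring
    rw [this]; exact pow_ne_zero _ hom
  obtain ⟨h, ⟨g, hg⟩, h0, h1⟩ := gl hq he ha0 (fun h => ∃ g : Ω ≃ₐ[E] Ω, ∀ v b, Rp v b → Rp (g v) (h b))
    (by
      rintro f f' ⟨g, hg⟩ ⟨g', hg'⟩
      exact ⟨g'.trans g, fun v b hv => hg _ _ (hg' _ _ hv)⟩) D.singer hc0 hc00 hT
    (hF c0 hc0) (hF c1 hc1) hc0 hc1 hom' hom
  obtain ⟨x, hx⟩ := D.ex c0 hc0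
  obtain ⟨y, hy⟩ := D.ex c1 hc1
  refine ⟨(g : Ω →+* Ω).comp s0, ?_, x, D.mem hx, y, D.mem hy, ?_, ?_, D.ne0 hx hc00, ?_⟩
  · intro P
    rw [RingHom.comp_apply, hs0]
    exact gal_poly g _
  · have := hg _ _ (hs0R _ _ hx)
    rw [h0] at this
    exact D.uniq this hx
  · have := hg _ _ (hs0R _ _ hy)
    rw [h1] at this
    exact D.uniq this hy
  · exact fun b hb => D.indep hq he hx hy hom b hb

/-- transvections on two vectors extend -/
theorem InfData.transv [CharP Ω p] {a0 : K} {Rp : Ω → K → Prop} (D : InfData E p q k c a0 Rp) (hq : q = p ^ e) (he : 0 < e)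
    {x y : Ω} {c0 c1 : K} (hx : Rp x c0) (hy : Rp y c1) (hom : om q c0 c1 ≠ 0)
    (h : ∀ s : K, s ^ q = s → ∃ g : Ω ≃ₐ[E] Ω, g x = x ∧ g y = y + algebraMap K Ω s * x) :
    ∀ μ : K, - a0 * μ ^ q = μ → ∃ g : Ω ≃ₐ[E] Ω, ∀ v b, Rp v b → Rp (g v) (b + μ * om q c0 b * c0) := by
  have hq1 := one_lt_q (p := p) he hq
  have hsub : ∀ x y : K, (x - y) ^ q = x ^ q - y ^ q := fun x y => by
    have h := sub_pow_q (p := p) hq 1 x y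
    rwa [pow_one] at h
  intro μ hμ
  have hc0 := D.eqn hx
  have hc1 := D.eqn hy
  obtain ⟨g, hgx, hgy⟩ := h (μ * om q c0 c1) (by
    rw [mul_pow, om_frob hq hc0 hc1]
    linear_combination (om q c0 c1) * hμ)
  have hc00 : c0 ≠ 0 := by
    rintro rfl; apply hom; rw [om, zero_pow (by omega)]; ring
  have ha0 : a0 ≠ 0 := by
    rintro rfl
    rw [zero_mul] at hc0
    exact hc00 (pow_eq_zero_iff (by positivity) |>.mp hc0)
  refine ⟨g, fun v b hv => ?_⟩
  have hb := D.eqn hv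
  set β := om q c0 b / om q c0 c1 with hβ
  have hβF : β ^ q = β := by
    rw [hβ, div_pow, om_frob hq hc0 hb, om_frob hq hc0 hc1, mul_div_mul_left _ _ (neg_ne_zero.mpr ha0)]
  have h0 : om q c0 (b - β * c1) = 0 := by
    have : om q c0 (b - β * c1) = om q c0 b - β * om q c0 c1 := by
      rw [om, om, om, hsub, mul_pow, hβF]; ring
    rw [this, hβ, div_mul_cancel₀ _ hom, sub_self]
  have hα := om_ratio hc00 h0
  set α := (b - β * c1) / c0 with hαd
  have hbe : b = α * c0 + β * c1 := by rw [hαd, div_mul_cancel₀ _ hc00]; ring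
  have hv' : v = algebraMap K Ω α * x + algebraMap K Ω β * y := by
    refine D.uniq hv ?_
    rw [hbe]
    exact D.add (D.smul hα hx) (D.smul hβF hy)
  have hgv : g v = v + algebraMap K Ω (μ * om q c0 b) * x := by
    have : μ * om q c0 b = β * (μ * om q c0 c1) := by
      rw [hβ]; field_simp
    rw [this, hv', map_add, map_mul, map_mul, gal_K, gal_K, hgx, hgy, map_mul (algebraMap K Ω) β]; ring
  rw [hgv]
  refine D.add hv (D.smul ?_ hx)
  rw [mul_pow, om_frob hq hc0 hb]
  linear_combination (om q c0 b) * hμ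
end
end Scat

set_option linter.all false
namespace Scat
open Polynomial
section
variable {K E Ω : Type*} [Field K] [Field E] [Field Ω] [Algebra K[X] E] [IsFractionRing K[X] E]
  [Algebra E Ω] [Algebra K[X] Ω] [IsScalarTower K[X] E Ω] [Algebra K Ω] [IsScalarTower K K[X] Ω]
variable {q k : ℕ} {c : ℕ → K[X]}
variable {p e : ℕ} [Fact p.Prime] [CharP K p]

variable (Ω) in
/-- a Frobenius semilinear map with two independent fixed roots -/
def Fin2 (p q k : ℕ) [Fact p.Prime] [CharP K p] (c : ℕ → K[X]) (n : ℕ) : Prop :=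
  ∃ s : Ω →+* Ω, (∀ P, s (algebraMap K[X] Ω P) =
      algebraMap K[X] Ω (P.map (iterateFrobenius K p n))) ∧
      ∃ x ∈ VV Ω q k c, ∃ y ∈ VV Ω q k c, s x = x ∧ s y = y ∧ x ≠ 0 ∧
        (∀ b : K, b ^ q = b → y ≠ algebraMap K Ω b * x)

theorem InfData.buniq {a0 : K} {Rp : Ω → K → Prop} (D : InfData E p q k c a0 Rp) (hq : q = p ^ e) 
    {x : Ω} {b b' : K} (hx : Rp x b) (hy : Rp x b') : b = b' := by
  have h2 := D.smul (s := -1) (by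
    have h := neg_pow_q (p := p) hq 1 (1 : K)
    rw [pow_one, one_pow] at h
    exact h) hx
  have h3 := D.add hy h2
  by_contra hne
  apply D.ne0 h3 (by intro h; exact hne (by linear_combination -h))
  rw [map_neg, map_one]; ring

theorem InfData.card [IsAlgClosed K] {a0 : K} {Rp : Ω → K → Prop} (D : InfData E p q k c a0 Rp) (hq : q = p ^ e)
    (he : 0 < e) (ha0 : a0 ≠ 0) : {v | ∃ b, Rp v b}.ncard = q ^ 2 := by
  obtain ⟨c0, hc00, hc0⟩ := exists_c0 (K := K) (p := p) hq he ha0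
  have h1 := card_fixed K p (e * 2) (by omega)
  rw [pow_mul, ← hq] at h1
  have hF : ∀ b, b ^ q ^ 2 = b → (c0 * b) ^ q ^ 2 = a0 * (c0 * b) := by
    intro b hb; rw [mul_pow, hb, hc0]; ring
  choose! f hf using D.ex
  have h2 : {v | ∃ b, Rp v b} = (fun b => f (c0 * b)) '' {x : K | x ^ q ^ 2 = x} := by
    ext v
    constructor
    · rintro ⟨b, hb⟩
      refine ⟨b / c0, ?_, ?_⟩
      · rw [Set.mem_setOf_eq, div_pow, D.eqn hb, hc0, mul_div_mul_left _ _ ha0]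
      · have : c0 * (b / c0) = b := by field_simp
        simp only [this]
        exact D.uniq (hf b (D.eqn hb)) hb
    · rintro ⟨b, hb, rfl⟩
      exact ⟨_, hf _ (hF b hb)⟩
  rw [h2, Set.ncard_image_of_injOn, h1]
  intro b hb b' hb' h
  have e1 := hf _ (hF b hb)
  have e2 := hf _ (hF b' hb')
  have h : f (c0 * b) = f (c0 * b') := h
  rw [h] at e1
  exact mul_left_cancel₀ hc00 (D.buniq hq e1 e2)

theorem VV_card (hq : q = p ^ e) (he : 0 < e) [CharP Ω p] (hc0 : c 0 ≠ 0) (hk : c k = 1)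
    (hspl : (evp q k (fun i => algebraMap K[X] E (c i))).IsSplittingField E Ω) :
    (VV Ω q k c).ncard = q ^ k := by
  refine rts_card_of_splits (p := p) he hq k _ ?_ ?_ ?_
  · rwa [Ne, map_eq_zero_iff _ (algMap_inj (K := K) E Ω)]
  · rw [hk, map_one]; exact one_ne_zero
  · have := hspl.splits
    rw [map_evp] at this
    simpa only [← IsScalarTower.algebraMap_apply] using this

theorem case1 [IsAlgClosed K] [FiniteDimensional E Ω] [CharP Ω p] (hq : q = p ^ e) (he : 0 < e)
    {a0 : K} (ha0 : a0 ≠ 0)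
    (hspl : (evp q 2 (fun i => algebraMap K[X] E (cB a0 i))).IsSplittingField E Ω)
    (n : ℕ) (han : a0 ^ p ^ n = a0) : Fin2 Ω p q 2 (cB a0) n := by
  have hq1 := one_lt_q (p := p) he hq
  have hk : cB a0 2 = 1 := by simp [cB]
  have hcz : cB a0 0 ≠ 0 := by
    simp only [cB, if_true]
    exact neg_ne_zero.mpr (mul_ne_zero (C_ne_zero.mpr ha0) X_ne_zero)
  obtain ⟨t, ht, ⟨pl⟩⟩ := placeB (K := K) (E := E) (Ω := Ω) hq1 a0
  have D := inf_of_place (E := E) (p := p) hq he hk hspl one_pos pl (Or.inl ht)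
    (by simp [phB, ha0]) (resB hq1 a0)
  have hn : ∀ i, (cB a0 i).map (iterateFrobenius K p n) = cB a0 i := by
    intro i
    unfold cB
    split_ifs <;> simp [iterateFrobenius_def, han]
  obtain ⟨t0, ⟨pl0⟩⟩ := placeB0 (K := K) (E := E) (Ω := Ω) hq1 a0
  have hφ0 : PowerSeries.constantCoeff (phB0 q a0 0) ≠ 0 := by simp [phB0, ha0]
  have hres0 : ∀ b, ev q 2 (fun i => PowerSeries.constantCoeff (phB0 q a0 i)) b = a0 * b + b ^ q := by
    intro b
    have hq' : q - 1 ≠ 0 := by omega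
    rw [ev, Finset.sum_range_succ, Finset.sum_range_succ, Finset.sum_range_succ, Finset.sum_range_zero]
    simp [phB0, hq']
  obtain ⟨b, hb⟩ := IsAlgClosed.exists_pow_nat_eq (-a0) (by omega : 0 < q - 1)
  have hb0 : b ≠ 0 := by
    rintro rfl
    rw [zero_pow (by omega)] at hb
    exact ha0 (neg_eq_zero.mp hb.symm)
  have hbq : b ^ q = -a0 * b := by
    rw [← hb, ← pow_succ, Nat.sub_add_cancel (by omega)]
  obtain ⟨w, hw⟩ := pl0.rep_exists he hq hφ0 hk hspl (b := b) (by rw [hres0, hbq]; ring)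
  have hw0 : w ≠ 0 := hw.ne_zero hb0
  have hall : {v | ∃ b, pl.Rep v b} = VV Ω q 2 (cB a0) := by
    refine Set.eq_of_subset_of_ncard_le ?_ ?_ (VV_finite E hq1 hcz)
    · rintro v ⟨b, hb⟩; exact D.mem hb
    · rw [D.card hq he ha0, VV_card (E := E) hq he hcz hk hspl]
  obtain ⟨c0, hc0⟩ : w ∈ {v | ∃ b, pl.Rep v b} := by rw [hall]; exact hw.1
  have hc00 : c0 ≠ 0 := by rintro rfl; exact hw0 (D.zero hc0)
  obtain ⟨c1, hc1, hom⟩ := exists_basis (p := p) hq he hc00 (D.eqn hc0)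
  obtain ⟨y, hy⟩ := D.ex c1 hc1
  have hT := D.transv hq he hc0 hy hom (by
    intro s hs
    obtain ⟨g, h1, h2, -⟩ := pl0.wildG (E := E) (p := p) (e := e) (m := 1) (D := 1) (a := 1) hq he hk hspl one_pos one_pos
      (Nat.Prime.not_dvd_one Fact.out) (lcondB hq1 a0) hφ0 rfl y (D.mem hy) (by
        intro b' hb'
        have h1 := hb'.eqn
        rw [hres0] at h1
        have hs : (b' / b) ^ q = b' / b := by
          rw [div_pow, hbq, show b' ^ q = - a0 * b' by linear_combination h1,
            mul_div_mul_left _ _ (neg_ne_zero.mpr ha0)]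
        have h2 := hw.smul (p := p) hq hs
        rw [div_mul_cancel₀ _ hb0] at h2
        exact D.indep hq he hc0 hy hom _ hs (hb'.unique (p := p) he hq hφ0 h2)) _ _ (hw.smul (p := p) hq hs)
    exact ⟨g, h2 _ _ hw, h1⟩)
  exact fin_gl hq he ha0 D (D.eqn hc0) hc00 hT n hn han
end
end Scat

set_option linter.all false
namespace Scat
open Polynomial
section
variable {K E Ω : Type*} [Field K] [Field E] [Field Ω] [Algebra K[X] E] [IsFractionRing K[X] E]
  [Algebra E Ω] [Algebra K[X] Ω] [IsScalarTower K[X] E Ω] [Algebra K Ω] [IsScalarTower K K[X] Ω]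
variable {q d : ℕ} {a : ℕ → K}
variable {p e : ℕ} [Fact p.Prime] [CharP K p]

theorem VVA (ha2 : a 2 = 0) (hd : 3 ≤ d) {v : Ω} : v ∈ VV Ω q d (cA a) ↔
    ev q d (fun i => algebraMap K Ω (a i)) v = algebraMap K[X] Ω X * v ^ q ^ 2 := by
  have h : ev q d (fun i => algebraMap K[X] Ω (cA a i)) v =
      ev q d (fun i => algebraMap K Ω (a i)) v - algebraMap K[X] Ω X * v ^ q ^ 2 := by
    rw [eq_sub_iff_add_eq, eq_comm, ← sub_eq_iff_eq_add', ev, ev, ← Finset.sum_sub_distrib,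
      Finset.sum_eq_single 2]
    · simp [cA, ha2]
    · intro i _ hi
      rw [cA, if_neg hi, IsScalarTower.algebraMap_apply K K[X] Ω]
      exact sub_self _
    · intro h; simp at h; omega
  show ev _ _ _ _ = 0 ↔ _
  rw [h, sub_eq_zero]

include E in
variable (E) in
theorem transc [IsAlgClosed K] (ha2 : a 2 = 0) (hd : 3 ≤ d) {v : Ω} (hv : v ∈ VV Ω q d (cA a)) (hv0 : v ≠ 0)
    {P : K[X]} (hP : P ≠ 0) : P.eval₂ (algebraMap K Ω) v ≠ 0 := by
  intro h
  have h1 := (IsAlgClosed.splits P).eq_prod_roots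
  rw [h1, eval₂_mul, eval₂_C, ← coe_eval₂RingHom, map_multiset_prod, mul_eq_zero] at h
  obtain ⟨b, hb⟩ : ∃ b, v = algebraMap K Ω b := by
    rcases h with h | h
    · rw [map_eq_zero, leadingCoeff_eq_zero] at h; exact absurd h hP
    · rw [Multiset.map_map, Multiset.prod_eq_zero_iff, Multiset.mem_map] at h
      obtain ⟨b, _, hb⟩ := h
      rw [Function.comp_apply, coe_eval₂RingHom, eval₂_sub, eval₂_X, eval₂_C, sub_eq_zero] at hb
      exact ⟨b, hb⟩
  rw [VVA ha2 hd, hb, ← map_ev, ← map_pow] at hv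
  have hb0 : b ≠ 0 := by rintro rfl; rw [map_zero] at hb; exact hv0 hb
  have h2 : algebraMap K[X] Ω X = algebraMap K[X] Ω (C (ev q d a b / b ^ q ^ 2)) := by
    have : algebraMap K[X] Ω (C (ev q d a b / b ^ q ^ 2)) = algebraMap K Ω (ev q d a b / b ^ q ^ 2) :=
      (IsScalarTower.algebraMap_apply K K[X] Ω _).symm
    rw [this, map_div₀, hv, mul_div_cancel_right₀]
    rw [Ne, map_eq_zero]; exact pow_ne_zero _ hb0
  have h3 := algMap_inj (K := K) E Ω h2
  have := congrArg natDegree h3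
  simp at this

/-- the field embedding `X ↦ u` -/
theorem exists_psi (u : Ω) (hu : ∀ P : K[X], P ≠ 0 → P.eval₂ (algebraMap K Ω) u ≠ 0) :
    ∃ ψ : FractionRing K[X] →+* Ω, ∀ P : K[X], ψ (algebraMap K[X] _ P) = P.eval₂ (algebraMap K Ω) u := by
  have hinj : Function.Injective (eval₂RingHom (algebraMap K Ω) u) := by
    rw [injective_iff_map_eq_zero]
    intro P hP
    by_contra h
    exact hu P h hP
  exact ⟨IsFractionRing.lift hinj, fun P => IsFractionRing.lift_algebraMap hinj P⟩

theorem F1 [IsAlgClosed K] [FiniteDimensional E Ω] [IsGalois E Ω] (hq1 : 1 < q) (ha2 : a 2 = 0) (hd : 3 ≤ d)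
    {v v' : Ω} (hv : v ∈ VV Ω q d (cA a)) (hv0 : v ≠ 0) (hv' : v' ∈ VV Ω q d (cA a)) (hv0' : v' ≠ 0) :
    ∃ g : Ω ≃ₐ[E] Ω, g v = v' := by
  set L := FractionRing K[X]
  let j : K →+* L := (algebraMap K[X] L).comp C
  let x : L := algebraMap K[X] L X
  have hx0 : x ≠ 0 := by
    rw [Ne, map_eq_zero_iff _ (IsFractionRing.injective K[X] L)]; exact X_ne_zero
  let T : L := ev q d (fun i => j (a i)) x / x ^ q ^ 2
  have key : ∀ w : Ω, w ∈ VV Ω q d (cA a) → w ≠ 0 → ∃ ψ : L →+* Ω, ψ x = w ∧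
      ∀ P : K[X], ψ (eval₂ j T P) = algebraMap K[X] Ω P := by
    intro w hw hw0
    obtain ⟨ψ, hψ⟩ := exists_psi (K := K) w (fun P hP => transc E ha2 hd hw hw0 hP)
    have hψj : ∀ b, ψ (j b) = algebraMap K Ω b := fun b => by
      show ψ (algebraMap K[X] L (C b)) = _
      rw [hψ, eval₂_C]
    have hψx : ψ x = w := by
      show ψ (algebraMap K[X] L X) = _
      rw [hψ, eval₂_X]
    refine ⟨ψ, hψx, fun P => ?_⟩
    have hT : ψ T = algebraMap K[X] Ω X := by
      rw [map_div₀, map_ev, map_pow, hψx]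
      simp only [hψj]
      rw [(VVA ha2 hd).mp hw, mul_div_cancel_right₀ _ (pow_ne_zero _ hw0)]
    have : ψ.comp (eval₂RingHom j T) = algebraMap K[X] Ω := by
      refine Polynomial.ringHom_ext (fun b => ?_) ?_
      · rw [RingHom.comp_apply, coe_eval₂RingHom, eval₂_C, hψj]
        exact IsScalarTower.algebraMap_apply K K[X] Ω b
      · rw [RingHom.comp_apply, coe_eval₂RingHom, eval₂_X, hT]
    exact RingHom.congr_fun this P
  obtain ⟨ψ, hψx, hψ⟩ := key v hv hv0
  obtain ⟨ψ', hψx', hψ'⟩ := key v' hv' hv0'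
  have hinj : Function.Injective (eval₂RingHom j T) := by
    intro P Q h
    apply algMap_inj (K := K) E Ω
    rw [← hψ, ← hψ]
    exact congrArg ψ h
  let κ : E →+* L := IsFractionRing.lift hinj
  have hκ : ∀ φ : L →+* Ω, (∀ P : K[X], φ (eval₂ j T P) = algebraMap K[X] Ω P) → φ.comp κ = algebraMap E Ω := by
    intro φ hφ
    apply IsLocalization.ringHom_ext (nonZeroDivisors K[X])
    refine RingHom.ext fun P => ?_
    simp only [RingHom.comp_apply]
    rw [IsFractionRing.lift_algebraMap hinj, coe_eval₂RingHom, hφ, ← IsScalarTower.algebraMap_apply]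
  have hP : aeval v (minpoly E v) = 0 := minpoly.aeval E v
  have h1 : ∀ φ : L →+* Ω, (∀ P : K[X], φ (eval₂ j T P) = algebraMap K[X] Ω P) →
      φ (eval₂ κ x (minpoly E v)) = aeval (φ x) (minpoly E v) := by
    intro φ hφ
    rw [hom_eval₂, hκ φ hφ, aeval_def]
  have h2 := h1 ψ hψ
  rw [hψx, hP, map_eq_zero] at h2
  have h3 := h1 ψ' hψ'
  rw [h2, map_zero, hψx'] at h3
  exact minpoly.exists_algEquiv_of_root' (Algebra.IsAlgebraic.isAlgebraic v) h3.symm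
end
end Scat

set_option linter.all false
namespace Scat
open Polynomial

theorem int_key {A L Ω : Type*} [CommRing A] [IsDomain A] [IsIntegrallyClosed A] [Field L] [Algebra A L]
    [IsFractionRing A L] [Field Ω] (ψ : L →+* Ω) (Z : Finset Ω)
    (hZ : ∀ z ∈ Z, (ψ.comp (algebraMap A L)).IsIntegralElem z)
    (hr : ∀ i, (nmp Z).coeff i ∈ ψ.range) : ∀ i, ∃ r : A, ψ (algebraMap A L r) = (nmp Z).coeff i := by
  letI := ψ.toAlgebra
  letI := (ψ.comp (algebraMap A L)).toAlgebra
  haveI : IsScalarTower A L Ω := IsScalarTower.of_algebraMap_eq (fun _ => rfl)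
  intro i
  have h1 : (nmp Z) ∈ lifts (integralClosure A Ω).val.toRingHom := by
    refine Subsemiring.prod_mem _ fun z hz => ?_
    have : (X - C z : Polynomial Ω) = (X - C (⟨z, hZ z hz⟩ : integralClosure A Ω)).map (integralClosure A Ω).val.toRingHom := by
      simp
    rw [this]
    exact ⟨_, rfl⟩
  obtain ⟨b, hb⟩ := (lifts_iff_coeff_lifts _).mp h1 i
  have h2 : IsIntegral A ((nmp Z).coeff i) := by rw [← hb]; exact b.2
  obtain ⟨l, hl⟩ := hr i
  rw [← hl] at h2 ⊢
  have h3 : IsIntegral A l := (isIntegral_algebraMap_iff (algebraMap L Ω).injective).mp h2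
  obtain ⟨r, hr⟩ := IsIntegrallyClosed.isIntegral_iff.mp h3
  exact ⟨r, by rw [hr]⟩

theorem evp_monic {A : Type*} [CommRing A] {q k : ℕ} {c : ℕ → A} (hq1 : 1 < q) (hk : c k = 1) :
    (evp q k c).Monic := by
  nontriviality A
  have h1 : (evp q k c).natDegree ≤ q ^ k := by
      refine natDegree_sum_le_of_forall_le _ _ fun i hi => ?_
      refine (natDegree_C_mul_X_pow_le _ _).trans ?_
      exact Nat.pow_le_pow_right (by omega) (by simpa [Nat.lt_succ_iff] using hi)
  refine monic_of_natDegree_le_of_coeff_eq_one _ h1 ?_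
  simp only [evp, finsetSum_coeff, coeff_C_mul, coeff_X_pow]
  rw [Finset.sum_eq_single k]
  · simp [hk]
  · intro b _ hb
    rw [if_neg, mul_zero]
    intro h
    exact hb (Nat.pow_right_injective hq1 h).symm
  · intro h; simp at h

section
variable {K E Ω : Type*} [Field K] [Field E] [Field Ω] [Algebra K[X] E] [IsFractionRing K[X] E]
  [Algebra E Ω] [Algebra K[X] Ω] [IsScalarTower K[X] E Ω] [Algebra K Ω] [IsScalarTower K K[X] Ω]
variable {q d : ℕ} {a : ℕ → K}
variable {p e : ℕ} [Fact p.Prime] [CharP K p]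

theorem root_in_K [IsAlgClosed K] {v : Ω} {P : K[X]} (hP : P ≠ 0) (h : P.eval₂ (algebraMap K Ω) v = 0) :
    ∃ b, v = algebraMap K Ω b := by
  have h1 := (IsAlgClosed.splits P).eq_prod_roots
  rw [h1, eval₂_mul, eval₂_C, ← coe_eval₂RingHom, map_multiset_prod, mul_eq_zero] at h
  rcases h with h | h
  · rw [map_eq_zero, leadingCoeff_eq_zero] at h; exact absurd h hP
  · rw [Multiset.map_map, Multiset.prod_eq_zero_iff, Multiset.mem_map] at h
    obtain ⟨b, _, hb⟩ := h
    rw [Function.comp_apply, coe_eval₂RingHom, eval₂_sub, eval₂_X, eval₂_C, sub_eq_zero] at hb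
    exact ⟨b, hb⟩

/-- relation between two roots -/
theorem rel_z (hq1 : 1 < q) (ha2 : a 2 = 0) (hd : 3 ≤ d) {x y z : Ω} (hx : x ∈ VV Ω q d (cA a))
    (hy : y ∈ VV Ω q d (cA a)) (hyz : y = z * x) :
    ∑ i ∈ Finset.range (d + 1), algebraMap K Ω (a i) * (z ^ q ^ i - z ^ q ^ 2) * x ^ q ^ i = 0 := by
  rw [VVA ha2 hd] at hx hy
  rw [hyz, mul_pow] at hy
  have e1 : ev q d (fun i => algebraMap K Ω (a i)) (z * x) - z ^ q ^ 2 * ev q d (fun i => algebraMap K Ω (a i)) x = 0 := by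
    rw [hx, hy]; ring
  rw [← e1, ev, ev, Finset.mul_sum, ← Finset.sum_sub_distrib]
  refine Finset.sum_congr rfl fun i _ => ?_
  rw [mul_pow]; ring

/-- integral equation for the ratio -/
theorem z_integral (hq1 : 1 < q) (ha2 : a 2 = 0) (had : a d = 1) (hd : 3 ≤ d) {x y : Ω} (hx0 : x ≠ 0)
    (hx : x ∈ VV Ω q d (cA a)) (hy : y ∈ VV Ω q d (cA a)) :
    (eval₂RingHom (algebraMap K Ω) x⁻¹).IsIntegralElem (y / x) := by
  have hrel := rel_z hq1 ha2 hd hx hy (div_mul_cancel₀ y hx0).symm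
  let c : ℕ → K[X] := fun i => C (a i) * X ^ (q ^ d - q ^ i) -
    if i = 2 then ∑ j ∈ Finset.range (d + 1), C (a j) * X ^ (q ^ d - q ^ j) else 0
  refine ⟨evp q d c, evp_monic hq1 ?_, ?_⟩
  · simp only [c]
    rw [if_neg (by omega), had]; simp
  · rw [← eval_map, map_evp, eval_evp, ev]
    have hc : ∀ i ≤ d, (eval₂RingHom (algebraMap K Ω) x⁻¹) (C (a i) * X ^ (q ^ d - q ^ i)) =
        algebraMap K Ω (a i) * x ^ q ^ i * (x ^ q ^ d)⁻¹ := by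
      intro i hi
      rw [coe_eval₂RingHom, eval₂_mul, eval₂_C, eval₂_pow, eval₂_X]
      have : x ^ q ^ d = x ^ (q ^ d - q ^ i) * x ^ q ^ i := by
        rw [← pow_add, Nat.sub_add_cancel (Nat.pow_le_pow_right (by omega) hi)]
      rw [this, inv_pow]; field_simp
    have e1 : ∑ i ∈ Finset.range (d + 1), (eval₂RingHom (algebraMap K Ω) x⁻¹) (c i) * (y / x) ^ q ^ i =
        ∑ i ∈ Finset.range (d + 1), algebraMap K Ω (a i) * x ^ q ^ i * (x ^ q ^ d)⁻¹ * (y / x) ^ q ^ i -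
        (∑ i ∈ Finset.range (d + 1), algebraMap K Ω (a i) * x ^ q ^ i * (x ^ q ^ d)⁻¹) * (y / x) ^ q ^ 2 := by
      have e2 : ∀ i ∈ Finset.range (d + 1), (eval₂RingHom (algebraMap K Ω) x⁻¹) (c i) * (y / x) ^ q ^ i =
          algebraMap K Ω (a i) * x ^ q ^ i * (x ^ q ^ d)⁻¹ * (y / x) ^ q ^ i -
          if i = 2 then (∑ i ∈ Finset.range (d + 1), algebraMap K Ω (a i) * x ^ q ^ i * (x ^ q ^ d)⁻¹) * (y / x) ^ q ^ 2 else 0 := by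
        intro i hi
        have hi' : i ≤ d := by simpa [Nat.lt_succ_iff] using hi
        simp only [c]
        rw [map_sub, sub_mul, hc i hi']
        split_ifs with h2
        · rw [map_sum, h2]
          congr 2
          exact Finset.sum_congr rfl fun j hj => hc j (by simpa [Nat.lt_succ_iff] using hj)
        · rw [map_zero, zero_mul]
      rw [Finset.sum_congr rfl e2, Finset.sum_sub_distrib, Finset.sum_ite_eq' _ 2, if_pos (by simp; omega)]
    rw [e1, Finset.sum_mul, ← Finset.sum_sub_distrib]
    have e3 := congrArg (fun w => w * (x ^ q ^ d)⁻¹) hrel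
    simp only [zero_mul, Finset.sum_mul] at e3
    rw [← e3]
    refine Finset.sum_congr rfl fun i _ => ?_
    ring

/-- the field generated by `x` -/
theorem adjoin_range (hq1 : 1 < q) (ha2 : a 2 = 0) (hd : 3 ≤ d) {x : Ω} (hx0 : x ≠ 0)
    (hx : x ∈ VV Ω q d (cA a)) (ψ : FractionRing K[X] →+* Ω)
    (hψ : ∀ P : K[X], ψ (algebraMap K[X] _ P) = P.eval₂ (algebraMap K Ω) x⁻¹)
    {β : Ω} (hβ : β ∈ IntermediateField.adjoin E {x}) : β ∈ ψ.range := by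
  have hK : ∀ b : K, algebraMap K Ω b ∈ ψ.fieldRange := fun b => ⟨algebraMap K[X] _ (C b), by rw [hψ, eval₂_C]⟩
  have hxm : x ∈ ψ.fieldRange := by
    rw [← inv_inv x]
    exact inv_mem ⟨algebraMap K[X] _ X, by rw [hψ, eval₂_X]⟩
  have hT : algebraMap K[X] Ω X ∈ ψ.fieldRange := by
    have h1 : algebraMap K[X] Ω X = ev q d (fun i => algebraMap K Ω (a i)) x / x ^ q ^ 2 := by
      rw [(VVA ha2 hd).mp hx, mul_div_cancel_right₀ _ (pow_ne_zero _ hx0)]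
    rw [h1]
    exact div_mem (sum_mem fun i _ => mul_mem (hK _) (pow_mem hxm _)) (pow_mem hxm _)
  have hP : ∀ P : K[X], algebraMap K[X] Ω P ∈ ψ.fieldRange := by
    intro P
    induction P using Polynomial.induction_on' with
    | add P Q h1 h2 => rw [map_add]; exact add_mem h1 h2
    | monomial n b =>
      rw [← C_mul_X_pow_eq_monomial, map_mul, map_pow]
      refine mul_mem ?_ (pow_mem hT _)
      have := hK b
      rwa [IsScalarTower.algebraMap_apply K K[X] Ω] at this
  have hE : ∀ b : E, algebraMap E Ω b ∈ ψ.fieldRange := by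
    intro b
    obtain ⟨P, Q, _, rfl⟩ := IsFractionRing.div_surjective (A := K[X]) b
    rw [map_div₀, ← IsScalarTower.algebraMap_apply, ← IsScalarTower.algebraMap_apply]
    exact div_mem (hP _) (hP _)
  have hle : IntermediateField.adjoin E {x} ≤ ψ.fieldRange.toIntermediateField hE := by
    rw [IntermediateField.adjoin_le_iff]
    rintro _ rfl
    exact hxm
  exact hle hβ

theorem caseB_const [IsAlgClosed K] [FiniteDimensional E Ω] [IsGalois E Ω] (hq1 : 1 < q) (ha2 : a 2 = 0)
    (ha0 : a 0 ≠ 0) (had : a d = 1) (hd : 3 ≤ d) {N : ℕ} (hN : 0 < N) {φ : ℕ → PowerSeries K} {t : FF K}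
    (pl : Place Ω q d (cA a) (PowerSeries.X ^ N) φ t)
    {x : Ω} {c0 : K} (hx : pl.Rep x c0) (hc0 : c0 ≠ 0)
    (hB : ∀ g : Ω ≃ₐ[E] Ω, g x = x → ∀ y b, pl.Rep y b → ∃ b', pl.Rep (g y) b') :
    ∀ y b, pl.Rep y b → ∃ s : K, y = algebraMap K Ω s * x := by
  classical
  have hx0 : x ≠ 0 := hx.ne_zero hc0
  have hcz : cA a 0 ≠ 0 := by simp [cA, ha0]
  have hfin : {v | ∃ b, pl.Rep v b}.Finite := (VV_finite E hq1 hcz).subset (by rintro v ⟨b, hb⟩; exact hb.1)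
  let Z : Finset Ω := hfin.toFinset.image (fun y => y / x)
  have hZ : ∀ z, z ∈ Z ↔ ∃ y b, pl.Rep y b ∧ y / x = z := by
    intro z
    simp only [Z, Finset.mem_image, Set.Finite.mem_toFinset, Set.mem_setOf_eq]
    constructor
    · rintro ⟨y, ⟨b, hb⟩, rfl⟩; exact ⟨y, b, hb, rfl⟩
    · rintro ⟨y, b, hb, rfl⟩; exact ⟨y, ⟨b, hb⟩, rfl⟩
  have hu : ∀ P : K[X], P ≠ 0 → P.eval₂ (algebraMap K Ω) x⁻¹ ≠ 0 := by
    intro P hP h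
    refine transc E ha2 hd hx.1 hx0 (P := P.reverse) (by rwa [Ne, reverse_eq_zero]) ?_
    letI := invertibleOfNonzero (inv_ne_zero hx0)
    have := eval₂_reverse_eq_zero_iff (algebraMap K Ω) x⁻¹ P
    rw [invOf_eq_inv, inv_inv] at this
    exact this.mpr h
  obtain ⟨ψ, hψ⟩ := exists_psi (K := K) x⁻¹ hu
  have hfix : ∀ g : Ω ≃ₐ[E] Ω, g x = x → ∀ i, g ((nmp Z).coeff i) = (nmp Z).coeff i := by
    intro g hg i
    have h1 : (nmp Z).map (g : Ω →+* Ω) = nmp Z := by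
      have h2 : Z.image g = Z := by
        refine Finset.eq_of_subset_of_card_le ?_ (by rw [Finset.card_image_of_injective _ g.injective])
        intro z hz
        rw [Finset.mem_image] at hz
        obtain ⟨z, hz, rfl⟩ := hz
        rw [hZ] at hz ⊢
        obtain ⟨y, b, hb, rfl⟩ := hz
        obtain ⟨b', hb'⟩ := hB g hg y b hb
        exact ⟨g y, b', hb', by rw [map_div₀, hg]⟩
      rw [nmp, Polynomial.map_prod]
      conv_rhs => rw [← h2, Finset.prod_image (fun _ _ _ _ h => g.injective h)]
      refine Finset.prod_congr rfl fun z _ => ?_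
      simp
    have := congrArg (fun P => P.coeff i) h1
    simpa [coeff_map] using this
  have hmem : ∀ i, (nmp Z).coeff i ∈ ψ.range := by
    intro i
    apply adjoin_range (E := E) hq1 ha2 hd hx0 hx.1 ψ hψ
    rw [← IsGalois.fixedField_fixingSubgroup (IntermediateField.adjoin E {x}), IntermediateField.mem_fixedField_iff]
    intro g hg
    apply hfix
    rw [IntermediateField.mem_fixingSubgroup_iff] at hg
    exact hg x (IntermediateField.mem_adjoin_simple_self E x)
  have hψc : ψ.comp (algebraMap K[X] (FractionRing K[X])) = eval₂RingHom (algebraMap K Ω) x⁻¹ :=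
    RingHom.ext fun P => hψ P
  have hIntg := int_key ψ Z (by
    intro z hz
    rw [hZ] at hz
    obtain ⟨y, b, hb, rfl⟩ := hz
    rw [hψc]
    exact z_integral hq1 ha2 had hd hx0 hx.1 hb.1) hmem
  -- local integrality
  have hloc : ∀ i, ∃ w : PowerSeries K, pl.ι ((nmp Z).coeff i) = algebraMap (PowerSeries K) (AA K) w := by
    intro i
    have h1 : (nmp Z).map pl.ι ∈ lifts (algebraMap (PowerSeries K) (AA K)) := by
      rw [nmp, Polynomial.map_prod]
      refine Subsemiring.prod_mem _ fun z hz => ?_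
      rw [hZ] at hz
      obtain ⟨y, b, hb, rfl⟩ := hz
      obtain ⟨-, z1, hz1, -⟩ := hb
      obtain ⟨-, z2, hz2, hz2c⟩ := hx
      have hz20 : algebraMap (PowerSeries K) (AA K) z2 ≠ 0 := by
        rw [Ne, map_eq_zero_iff _ finj]
        rintro rfl
        rw [map_zero] at hz2c; exact hc0 hz2c.symm
      have hinv : algebraMap (PowerSeries K) (AA K) z2⁻¹ = (algebraMap (PowerSeries K) (AA K) z2)⁻¹ := by
        refine (inv_eq_of_mul_eq_one_right ?_).symm
        rw [← map_mul, PowerSeries.mul_inv_cancel _ (by rw [hz2c]; exact hc0), map_one]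
      refine ⟨X - C (z1 * z2⁻¹), ?_⟩
      have hη := pl.fη0
      have hq : algebraMap (PowerSeries K) (AA K) (z1 * z2⁻¹) = pl.ι (y / x) := by
        rw [map_div₀, hz1, hz2, map_mul _ _ z1, map_mul _ _ z2, map_mul, hinv]
        field_simp
      rw [coe_mapRingHom, Polynomial.map_sub, Polynomial.map_sub, map_X, map_X, map_C, map_C, hq]
    obtain ⟨w, hw⟩ := (lifts_iff_coeff_lifts _).mp h1 i
    exact ⟨w, by rw [hw, coeff_map]⟩
  have hconst : ∀ i, ∃ s : K, algebraMap K Ω s = (nmp Z).coeff i := by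
    intro i
    obtain ⟨r, hr⟩ := hIntg i
    obtain ⟨w, hw⟩ := hloc i
    rw [hψ] at hr
    by_cases hn : r.natDegree = 0
    · rw [natDegree_eq_zero] at hn
      obtain ⟨s, rfl⟩ := hn
      exact ⟨s, by rw [← hr, eval₂_C]⟩
    · exfalso
      set n := r.natDegree with hnd
      have h1 : (nmp Z).coeff i * x ^ n = ∑ j ∈ Finset.range (n + 1), algebraMap K Ω (r.coeff j) * x ^ (n - j) := by
        rw [← hr, eval₂_eq_sum_range, Finset.sum_mul]
        refine Finset.sum_congr rfl fun j hj => ?_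
        have hj' : j ≤ n := by simpa [Nat.lt_succ_iff] using hj
        have : x ^ n = x ^ (n - j) * x ^ j := by rw [← pow_add, Nat.sub_add_cancel hj']
        rw [this, inv_pow]; field_simp
      obtain ⟨-, z2, hz2, -⟩ := hx
      have h2 := congrArg pl.ι h1
      rw [map_mul, map_pow, hw, hz2, map_sum] at h2
      simp only [map_mul pl.ι, map_pow pl.ι, hz2, pl.ι_K] at h2
      simp only [← map_pow, ← map_mul, ← map_sum] at h2
      have h3 := congrArg PowerSeries.constantCoeff (finj h2)
      have hX0 : PowerSeries.constantCoeff ((PowerSeries.X : PowerSeries K) ^ N * z2) = 0 := by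
        rw [map_mul, map_pow, PowerSeries.constantCoeff_X, zero_pow hN.ne', zero_mul]
      rw [map_mul, map_pow, hX0, zero_pow hn, mul_zero, map_sum, Finset.sum_eq_single n] at h3
      · rw [Nat.sub_self, pow_zero, mul_one, PowerSeries.constantCoeff_C] at h3
        have h4 : r = 0 := leadingCoeff_eq_zero.mp h3.symm
        apply hn
        rw [hnd, h4, natDegree_zero]
      · intro j hj hjn
        have hj' : j ≤ n := by simpa [Nat.lt_succ_iff] using hj
        rw [map_mul, map_pow, hX0, zero_pow (by omega), mul_zero]
      · intro h; simp at h
  intro y b hy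
  obtain ⟨P, hP⟩ : (nmp Z) ∈ lifts (algebraMap K Ω) := (lifts_iff_coeff_lifts _).mpr hconst
  have hP0 : P ≠ 0 := by
    rintro rfl
    rw [map_zero] at hP
    exact (nmp_monic Z).ne_zero hP.symm
  have hroot : P.eval₂ (algebraMap K Ω) (y / x) = 0 := by
    rw [← eval_map, ← coe_mapRingHom, hP, eval_nmp, nm_eq_zero, hZ]
    exact ⟨y, b, hy, rfl⟩
  obtain ⟨s, hs⟩ := root_in_K hP0 hroot
  exact ⟨s, by rw [← hs, div_mul_cancel₀ _ hx0]⟩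
end
end Scat

set_option linter.all false
namespace Scat
open Polynomial

theorem duality {k : Type*} [Field k] [Finite k] {p : ℕ} [Fact p.Prime] [CharP k p] (H : AddSubgroup (k × k))
    (h : ∀ α β : k, (α, β) ≠ 0 → ∀ u, ∃ x ∈ H, α * x.1 + β * x.2 = u) : H = ⊤ := by
  letI : Algebra (ZMod p) k := ZMod.algebra k p
  by_contra hne
  let H' : Submodule (ZMod p) (k × k) := AddSubgroup.toZModSubmodule p H
  have hH' : ∀ x, x ∈ H' ↔ x ∈ H := fun x => Iff.rfl
  have hlt : H' < ⊤ := by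
    rw [lt_top_iff_ne_top]
    intro h1
    apply hne
    ext x
    rw [← hH', h1]; simp
  obtain ⟨f, hf, hf2⟩ := Submodule.exists_dual_map_eq_bot_of_lt_top hlt inferInstance
  haveI : Module.Finite (ZMod p) k := Module.Finite.of_finite
  have hB := FiniteField.algebraMap_trace_eq_sum_pow (ZMod p) k
  have hnd : (Algebra.traceForm (ZMod p) k).Nondegenerate := traceForm_nondegenerate (ZMod p) k
  have hrep : ∀ f1 : Module.Dual (ZMod p) k, ∃ α : k, ∀ x, f1 x = Algebra.trace (ZMod p) k (α * x) := by
    intro f1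
    refine ⟨(LinearMap.BilinForm.toDual _ hnd).symm f1, fun x => ?_⟩
    have := LinearMap.BilinForm.apply_toDual_symm_apply (hB := hnd) f1 x
    rw [← this, Algebra.traceForm_apply]
  obtain ⟨α, hα⟩ := hrep (f.comp (LinearMap.inl (ZMod p) k k))
  obtain ⟨β, hβ⟩ := hrep (f.comp (LinearMap.inr (ZMod p) k k))
  have hfx : ∀ x : k × k, f x = Algebra.trace (ZMod p) k (α * x.1 + β * x.2) := by
    intro x
    rw [map_add, ← hα, ← hβ]
    simp only [LinearMap.comp_apply, LinearMap.inl_apply, LinearMap.inr_apply, ← map_add]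
    congr 1
    ext <;> simp
  have hab : (α, β) ≠ 0 := by
    intro h0
    rw [Prod.mk_eq_zero] at h0
    apply hf
    ext x <;> simp [hfx, h0.1, h0.2]
  have htr : ∀ u : k, Algebra.trace (ZMod p) k u = 0 := by
    intro u
    obtain ⟨x, hx, rfl⟩ := h α β hab u
    rw [← hfx]
    have : f x ∈ H'.map f := Submodule.mem_map_of_mem hx
    rw [hf2] at this
    simpa using this
  have : (1 : k) = 0 := by
    apply hnd.1
    intro y
    rw [Algebra.traceForm_apply, htr]
  exact one_ne_zero this

section
variable {K E Ω : Type*} [Field K] [Field E] [Field Ω] [Algebra E Ω] [Algebra K Ω]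

theorem W2 (S : Subfield K) [Finite S] {p : ℕ} [Fact p.Prime] [CharP K p] (V : Set Ω)
    (hVa : ∀ u ∈ V, ∀ v ∈ V, u + v ∈ V) (hVs : ∀ s ∈ S, ∀ v ∈ V, algebraMap K Ω s * v ∈ V)
    (hK : ∀ (g : Ω ≃ₐ[E] Ω) (b : K), g (algebraMap K Ω b) = algebraMap K Ω b)
    (x0 : Ω) (hx0 : x0 ≠ 0)
    (hw : ∀ v ∈ V, (∀ s ∈ S, v ≠ algebraMap K Ω s * x0) → ∀ s ∈ S, ∃ g : Ω ≃ₐ[E] Ω,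
      g v = v + algebraMap K Ω s * x0 ∧ g x0 = x0 ∧ ∀ v' ∈ V, ∃ s' ∈ S, g v' = v' + algebraMap K Ω s' * x0)
    (u1 u2 : Ω) (hu1 : u1 ∈ V) (hu2 : u2 ∈ V)
    (hu : ∀ α ∈ S, ∀ β ∈ S, (α, β) ≠ 0 → ∀ s ∈ S, algebraMap K Ω α * u1 + algebraMap K Ω β * u2 ≠ algebraMap K Ω s * x0)
    (l1 l2 : K) (hl1 : l1 ∈ S) (hl2 : l2 ∈ S) : ∃ g : Ω ≃ₐ[E] Ω, g x0 = x0 ∧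
      g u1 = u1 + algebraMap K Ω l1 * x0 ∧ g u2 = u2 + algebraMap K Ω l2 * x0 := by
  let H : AddSubgroup (S × S) :=
    { carrier := {x | ∃ g : Ω ≃ₐ[E] Ω, g x0 = x0 ∧
        g u1 = u1 + algebraMap K Ω x.1 * x0 ∧ g u2 = u2 + algebraMap K Ω x.2 * x0}
      zero_mem' := ⟨1, rfl, by simp, by simp⟩
      add_mem' := by
        rintro x y ⟨g, h0, h1, h2⟩ ⟨g', h0', h1', h2'⟩
        refine ⟨g * g', ?_, ?_, ?_⟩
        · rw [AlgEquiv.mul_apply, h0', h0]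
        · rw [AlgEquiv.mul_apply, h1', map_add, map_mul, h0, h1, hK]
          simp only [Prod.fst_add, Subfield.coe_add, map_add]; ring
        · rw [AlgEquiv.mul_apply, h2', map_add, map_mul, h0, h2, hK]
          simp only [Prod.snd_add, Subfield.coe_add, map_add]; ring
      neg_mem' := by
        rintro x ⟨g, h0, h1, h2⟩
        refine ⟨g⁻¹, ?_, ?_, ?_⟩
        · apply g.injective
          rw [← AlgEquiv.mul_apply, mul_inv_cancel, h0]; rfl
        · apply g.injective
          rw [← AlgEquiv.mul_apply, mul_inv_cancel, map_add, map_mul, h0, h1, hK]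
          simp
        · apply g.injective
          rw [← AlgEquiv.mul_apply, mul_inv_cancel, map_add, map_mul, h0, h2, hK]
          simp }
  haveI : CharP S p := (algebraMap S K).charP S.subtype_injective p
  have hH : H = ⊤ := by
    refine duality (p := p) H ?_
    intro α β hab u
    have hab' : ((α : K), (β : K)) ≠ 0 := by
      intro h; apply hab
      rw [Prod.mk_eq_zero] at h ⊢
      exact ⟨Subtype.ext h.1, Subtype.ext h.2⟩
    obtain ⟨g, h1, h2, h3⟩ := hw (algebraMap K Ω α * u1 + algebraMap K Ω β * u2)
      (hVa _ (hVs _ α.2 _ hu1) _ (hVs _ β.2 _ hu2)) (hu _ α.2 _ β.2 hab') u u.2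
    obtain ⟨s1, hs1, e1⟩ := h3 u1 hu1
    obtain ⟨s2, hs2, e2⟩ := h3 u2 hu2
    refine ⟨(⟨s1, hs1⟩, ⟨s2, hs2⟩), ⟨g, h2, e1, e2⟩, ?_⟩
    rw [map_add, map_mul, map_mul, hK, hK, e1, e2] at h1
    have h4 : algebraMap K Ω (α * s1 + β * s2) = algebraMap K Ω u := by
      apply mul_right_cancel₀ hx0
      rw [map_add, map_mul, map_mul]
      linear_combination h1
    exact Subtype.ext ((algebraMap K Ω).injective h4)
  have : ((⟨l1, hl1⟩, ⟨l2, hl2⟩) : S × S) ∈ H := by rw [hH]; trivial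
  exact this

theorem stab_trans (S : Subfield K) [Finite S] {p : ℕ} [Fact p.Prime] [CharP K p] (V : Set Ω)
    (hVa : ∀ u ∈ V, ∀ v ∈ V, u + v ∈ V) (hVs : ∀ s ∈ S, ∀ v ∈ V, algebraMap K Ω s * v ∈ V)
    (hK : ∀ (g : Ω ≃ₐ[E] Ω) (b : K), g (algebraMap K Ω b) = algebraMap K Ω b)
    (hVg : ∀ (g : Ω ≃ₐ[E] Ω), ∀ v ∈ V, g v ∈ V)
    (hF1 : ∀ v ∈ V, ∀ v' ∈ V, v ≠ 0 → v' ≠ 0 → ∃ g : Ω ≃ₐ[E] Ω, g v = v')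
    (x0 : Ω) (hx0V : x0 ∈ V) (hx0 : x0 ≠ 0)
    (hw : ∀ v ∈ V, (∀ s ∈ S, v ≠ algebraMap K Ω s * x0) → ∀ s ∈ S, ∃ g : Ω ≃ₐ[E] Ω,
      g v = v + algebraMap K Ω s * x0 ∧ g x0 = x0 ∧ ∀ v' ∈ V, ∃ s' ∈ S, g v' = v' + algebraMap K Ω s' * x0)
    (hz : ∀ x y, ∃ z ∈ V, ∀ α ∈ S, ∀ β ∈ S, z ≠ algebraMap K Ω α * x + algebraMap K Ω β * y)
    (x y y' : Ω) (hx : x ∈ V) (hx00 : x ≠ 0) (hy : y ∈ V) (hy' : y' ∈ V)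
    (hyx : ∀ s ∈ S, y ≠ algebraMap K Ω s * x) (hyx' : ∀ s ∈ S, y' ≠ algebraMap K Ω s * x) :
    ∃ g : Ω ≃ₐ[E] Ω, g x = x ∧ g y = y' := by
  have j0 : ∀ s : K, s ≠ 0 → algebraMap K Ω s ≠ 0 := fun s hs => by rwa [Ne, map_eq_zero]
  have step : ∀ y y' : Ω, y ∈ V → y' ∈ V → (∀ s ∈ S, y ≠ algebraMap K Ω s * x) →
      (∀ α ∈ S, ∀ β ∈ S, y' ≠ algebraMap K Ω α * x + algebraMap K Ω β * y) →
      ∃ g : Ω ≃ₐ[E] Ω, g x = x ∧ g y = y' := by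
    intro y y' hy hy' hyx hyy
    have hw0 : y' - y ≠ 0 := by
      intro h
      apply hyy 0 S.zero_mem 1 S.one_mem
      rw [map_zero, map_one]; linear_combination h
    have hwV : y' - y ∈ V := by
      have := hVa _ hy' _ (hVs (-1) (S.neg_mem S.one_mem) _ hy)
      rw [map_neg, map_one] at this
      rwa [show y' - y = y' + -1 * y by ring]
    obtain ⟨h, hh⟩ := hF1 _ hwV _ hx0V hw0 hx0
    obtain ⟨g, g0, g1, g2⟩ := W2 (p := p) S V hVa hVs hK x0 hx0 hw (h x) (h y) (hVg h _ hx) (hVg h _ hy) (by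
      intro α hα β hβ hab s hs heq
      rw [← hK h, ← hK h β, ← hK h s, ← hh, ← map_mul, ← map_mul, ← map_mul, ← map_add] at heq
      replace heq := h.injective heq
      by_cases hs0 : s = 0
      · rw [hs0, map_zero, zero_mul] at heq
        by_cases hb : β = 0
        · rw [hb, map_zero, zero_mul, add_zero, mul_eq_zero, or_iff_left hx00, map_eq_zero] at heq
          exact hab (by rw [heq, hb]; rfl)
        · apply hyx (-α / β) (S.div_mem (S.neg_mem hα) hβ)
          have := j0 β hb
          rw [map_div₀, map_neg]
          field_simp
          linear_combination heq
      · apply hyy (α / s) (S.div_mem hα hs) (β / s + 1) (S.add_mem (S.div_mem hβ hs) S.one_mem)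
        have := j0 s hs0
        rw [map_add, map_div₀, map_div₀, map_one]
        field_simp
        linear_combination -heq) 0 1 S.zero_mem S.one_mem
    refine ⟨h⁻¹ * g * h, ?_, ?_⟩
    · apply h.injective
      rw [AlgEquiv.mul_apply, AlgEquiv.mul_apply, ← AlgEquiv.mul_apply, mul_inv_cancel, g1, map_zero]
      simp
    · apply h.injective
      rw [AlgEquiv.mul_apply, AlgEquiv.mul_apply, ← AlgEquiv.mul_apply, mul_inv_cancel, g2, map_one, ← hh]
      simp
  by_cases hyy : ∀ α ∈ S, ∀ β ∈ S, y' ≠ algebraMap K Ω α * x + algebraMap K Ω β * y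
  · exact step y y' hy hy' hyx hyy
  · push Not at hyy
    obtain ⟨α, hα, β, hβ, e1⟩ := hyy
    obtain ⟨z, hzV, hz⟩ := hz x y
    have hzx : ∀ s ∈ S, z ≠ algebraMap K Ω s * x := by
      intro s hs h
      apply hz s hs 0 S.zero_mem
      rw [h, map_zero]; ring
    obtain ⟨g, hg, hgy⟩ := step y z hy hzV hyx hz
    obtain ⟨g', hg', hgy'⟩ := step z y' hzV hy' hzx (by
      intro γ hγ δ hδ e2
      by_cases hd : δ = 0
      · apply hyx' γ hγ; rw [e2, hd, map_zero]; ring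
      · apply hz ((α - γ) / δ) (S.div_mem (S.sub_mem hα hγ) hδ) (β / δ) (S.div_mem hβ hδ)
        have := j0 δ hd
        rw [map_div₀, map_div₀, map_sub]
        field_simp
        linear_combination e1 - e2)
    exact ⟨g' * g, by rw [AlgEquiv.mul_apply, hg, hg'], by rw [AlgEquiv.mul_apply, hgy, hgy']⟩
end
end Scat

set_option linter.all false
namespace Scat
open Polynomial
section
variable {K E Ω : Type*} [Field K] [Field E] [Field Ω] [Algebra K[X] E] [IsFractionRing K[X] E]
  [Algebra E Ω] [Algebra K[X] Ω] [IsScalarTower K[X] E Ω] [Algebra K Ω] [IsScalarTower K K[X] Ω]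
variable {q d : ℕ} {a : ℕ → K}
variable {p e : ℕ} [Fact p.Prime] [CharP K p]

/-- the subfield with `q ^ 2` elements -/
def SQ (K : Type*) [Field K] [CharP K p] (hq : q = p ^ e) (he : 0 < e) : Subfield K where
  carrier := {x | x ^ q ^ 2 = x}
  mul_mem' := by
    intro x y hx hy
    rw [Set.mem_setOf_eq] at *
    rw [mul_pow, hx, hy]
  one_mem' := one_pow _
  add_mem' := by
    intro x y hx hy
    rw [Set.mem_setOf_eq] at *
    rw [add_pow_q (p := p) hq, hx, hy]
  zero_mem' := by
    have := one_lt_q (p := p) he hq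
    exact zero_pow (pow_ne_zero _ (by omega))
  neg_mem' := by
    intro x hx
    rw [Set.mem_setOf_eq] at *
    rw [neg_pow_q (p := p) hq, hx]
  inv_mem' := by
    intro x hx
    rw [Set.mem_setOf_eq] at *
    rw [inv_pow, hx]

theorem mem_SQ {hq : q = p ^ e} {he : 0 < e} {x : K} : x ∈ SQ K hq he ↔ x ^ q ^ 2 = x := Iff.rfl

theorem SQ_card [IsAlgClosed K] (hq : q = p ^ e) (he : 0 < e) : (SQ K hq he : Set K).ncard = q ^ 2 := by
  have := card_fixed K p (e * 2) (by omega)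
  rw [pow_mul, ← hq] at this
  exact this

theorem pow_even {s : K} (hs : s ^ q ^ 2 = s) (j : ℕ) : s ^ q ^ (j + j) = s := by
  induction j with
  | zero => simp
  | succ j ih => rw [show j + 1 + (j + 1) = (j + j) + 2 by omega, pow_add, pow_mul, ih, hs]

theorem case3 [IsAlgClosed K] [FiniteDimensional E Ω] [IsGalois E Ω] [CharP Ω p] (hq : q = p ^ e) (he : 0 < e)
    (ha0 : a 0 ≠ 0) (ha2 : a 2 = 0) (had : a d = 1) (hd : 3 ≤ d)
    (hspl : (evp q d (fun i => algebraMap K[X] E (cA a i))).IsSplittingField E Ω)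
    (n : ℕ) (han : ∀ i, a i ^ p ^ n = a i) :
    Fin2 Ω p q d (cA a) n ∨ (d = 4 ∧ a 1 = 0 ∧ a 3 = 0) := by
  have hq1 := one_lt_q (p := p) he hq
  have hk : cA a d = 1 := by rw [cA, if_neg (by omega), had, C_1]
  have hcz : cA a 0 ≠ 0 := by simp [cA, ha0]
  have hN : 0 < q ^ (d - 2) - 1 := by
    have : 1 < q ^ (d - 2) := Nat.one_lt_pow (by omega) hq1
    omega
  have hm : 0 < q ^ d - 1 := by
    have : 1 < q ^ d := Nat.one_lt_pow (by omega) hq1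
    omega
  have hpm : ¬ p ∣ q ^ d - 1 := by
    intro h
    have h1 : p ∣ q ^ d := by
      rw [hq, ← pow_mul]
      exact dvd_pow_self _ (by positivity)
    have h2 := (Nat.dvd_sub h1 h)
    rw [show q ^ d - (q ^ d - 1) = 1 by omega] at h2
    exact Nat.Prime.not_dvd_one Fact.out h2
  obtain ⟨t, ht, ⟨pl⟩⟩ := placeA (K := K) (E := E) (Ω := Ω) hq1 hd a
  have hφ0 : PowerSeries.constantCoeff (phA q d a 0) ≠ 0 := by simp [phA, ha0]
  have D := inf_of_place (E := E) (p := p) hq he hk hspl hN pl (Or.inr ht) hφ0 (resA hq1 hd a)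
  have hn : ∀ i, (cA a i).map (iterateFrobenius K p n) = cA a i := by
    intro i
    unfold cA
    split_ifs <;> simp [iterateFrobenius_def, han]
  have hwild := pl.wildG (E := E) (p := p) (e := e) hq he hk hspl hm (by omega : 0 < d - 2) hpm
    (lcondA hq1 hd a had) hφ0 (by omega)
  obtain ⟨c0, hc00, hc0⟩ := exists_c0 (p := p) hq he ha0
  obtain ⟨x, hx⟩ := D.ex c0 hc0
  have hx0 : x ≠ 0 := D.ne0 hx hc00
  by_cases hB : ∀ g : Ω ≃ₐ[E] Ω, g x = x → ∀ y b, pl.Rep y b → ∃ b', pl.Rep (g y) b'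
  swap
  · left
    push Not at hB
    obtain ⟨g, hgx, y, b, hy, hgy⟩ := hB
    have hom : om q c0 b ≠ 0 := by
      intro h0
      have hs := om_ratio hc00 h0
      have h1 := D.smul hs hx
      rw [div_mul_cancel₀ _ hc00] at h1
      have h2 := D.uniq hy h1
      apply hgy b
      rw [h2, map_mul, gal_K, hgx]
      exact h1
    have hT := D.transv hq he hx hy hom (by
      intro s hs
      obtain ⟨γ, h1, h2, -⟩ := hwild (g y) (gal_VV g hy.1) hgy _ _ (D.smul hs hx)
      refine ⟨g⁻¹ * γ * g, ?_, ?_⟩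
      · apply g.injective
        rw [AlgEquiv.mul_apply, AlgEquiv.mul_apply, ← AlgEquiv.mul_apply, mul_inv_cancel, hgx]
        exact h2 _ _ hx
      · apply g.injective
        rw [AlgEquiv.mul_apply, AlgEquiv.mul_apply, ← AlgEquiv.mul_apply, mul_inv_cancel, map_add,
          map_mul, gal_K, hgx]
        exact h1)
    exact fin_gl hq he ha0 D hc0 hc00 hT n hn (han 0)
  have hc := caseB_const hq1 ha2 ha0 had hd hN pl hx hc00 hB
  have hrel : ∀ s : K, algebraMap K Ω s * x ∈ VV Ω q d (cA a) → ∀ i ≤ d, a i * (s ^ q ^ i - s ^ q ^ 2) = 0 := by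
    intro s hs i hi
    have h1 := rel_z hq1 ha2 hd hx.1 hs rfl
    by_contra hne
    refine transc E ha2 hd hx.1 hx0 (P := evp q d (fun i => a i * (s ^ q ^ i - s ^ q ^ 2)))
      (evp_ne_zero hq1 d _ hi hne) ?_
    rw [← eval_map, map_evp, eval_evp, ev, ← h1]
    refine Finset.sum_congr rfl fun i _ => ?_
    simp only [map_mul, map_sub, map_pow]
  have hc' : ∀ y b, pl.Rep y b → ∃ s ∈ SQ K hq he, y = algebraMap K Ω s * x := by
    intro y b hy
    obtain ⟨s, rfl⟩ := hc y b hy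
    refine ⟨s, ?_, rfl⟩
    have h1 := hrel s hy.1 0 (by omega)
    rw [mul_eq_zero, or_iff_right ha0, pow_zero, pow_one, sub_eq_zero] at h1
    exact h1.symm
  have hodd : ∀ j, j + j + 1 ≤ d → a (j + j + 1) = 0 := by
    intro j hj
    obtain ⟨c1, hc1, hom⟩ := exists_basis (p := p) hq he hc00 hc0
    obtain ⟨y, hy⟩ := D.ex c1 hc1
    obtain ⟨s, hs, rfl⟩ := hc' y c1 hy
    have h1 := hrel s hy.1 _ hj
    rw [mul_eq_zero] at h1
    refine h1.resolve_right fun h2 => ?_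
    rw [pow_succ, pow_mul, pow_even hs, mem_SQ.mp hs, sub_eq_zero] at h2
    exact D.indep hq he hx hy hom s h2 rfl
  by_cases hd4 : d = 4
  · right
    exact ⟨hd4, hodd 0 (by omega), hodd 1 (by omega)⟩
  left
  have hd5 : 5 ≤ d := by
    have : d ≠ 3 := by
      rintro rfl
      have := hodd 1 (by omega)
      rw [had] at this
      exact one_ne_zero this
    omega
  haveI hSfin : Finite (SQ K hq he) := by
    have := SQ_card (K := K) hq he
    have hf : (SQ K hq he : Set K).Finite := by
      apply Set.finite_of_ncard_ne_zero
      rw [this]; positivity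
    exact hf
  have hSfin' : (SQ K hq he : Set K).Finite := hSfin
  have hV0 : {v | ∃ b, pl.Rep v b} = (fun s => algebraMap K Ω s * x) '' (SQ K hq he : Set K) := by
    refine Set.eq_of_subset_of_ncard_le ?_ ?_ (hSfin'.image _)
    · rintro v ⟨b, hb⟩
      obtain ⟨s, hs, h⟩ := hc' v b hb
      exact ⟨s, hs, h.symm⟩
    · rw [D.card hq he ha0]
      exact (Set.ncard_image_le hSfin').trans (SQ_card hq he).le
  have hV0' : ∀ s ∈ SQ K hq he, ∃ b, pl.Rep (algebraMap K Ω s * x) b := by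
    intro s hs
    have : algebraMap K Ω s * x ∈ {v | ∃ b, pl.Rep v b} := by rw [hV0]; exact ⟨s, hs, rfl⟩
    exact this
  have hVa : ∀ u ∈ VV Ω q d (cA a), ∀ v ∈ VV Ω q d (cA a), u + v ∈ VV Ω q d (cA a) := by
    intro u hu v hv
    show ev _ _ _ _ = 0
    rw [ev_add (p := p) hq, show ev _ _ _ u = 0 from hu, show ev _ _ _ v = 0 from hv, add_zero]
  have hVs : ∀ s ∈ SQ K hq he, ∀ v ∈ VV Ω q d (cA a), algebraMap K Ω s * v ∈ VV Ω q d (cA a) := by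
    intro s hs v hv
    rw [VVA ha2 hd] at hv ⊢
    have : ev q d (fun i => algebraMap K Ω (a i)) (algebraMap K Ω s * v) =
        algebraMap K Ω s * ev q d (fun i => algebraMap K Ω (a i)) v := by
      rw [ev, ev, Finset.mul_sum]
      refine Finset.sum_congr rfl fun i hi => ?_
      have hi' : i ≤ d := by simpa [Nat.lt_succ_iff] using hi
      rcases Nat.even_or_odd i with ⟨j, rfl⟩ | ⟨j, rfl⟩
      · rw [mul_pow, ← map_pow, pow_even hs]; ring
      · rw [two_mul] at hi' ⊢
        rw [hodd j hi', map_zero]; ring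
    rw [this, hv, mul_pow, ← map_pow, mem_SQ.mp hs]; ring
  have hz : ∀ x y, ∃ z ∈ VV Ω q d (cA a), ∀ α ∈ SQ K hq he, ∀ β ∈ SQ K hq he,
      z ≠ algebraMap K Ω α * x + algebraMap K Ω β * y := by
    intro x y
    by_contra hcon
    push Not at hcon
    have h1 : VV Ω q d (cA a) ⊆ (fun s : K × K => algebraMap K Ω s.1 * x + algebraMap K Ω s.2 * y) ''
        ((SQ K hq he : Set K) ×ˢ (SQ K hq he : Set K)) := by
      intro z hz
      obtain ⟨α, hα, β, hβ, h⟩ := hcon z hz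
      exact ⟨(α, β), ⟨hα, hβ⟩, h.symm⟩
    have hf := hSfin'.prod hSfin'
    have h2 := (Set.ncard_le_ncard h1 (hf.image _)).trans (Set.ncard_image_le hf)
    rw [VV_card (E := E) hq he hcz hk hspl, Set.ncard_prod, SQ_card hq he, ← pow_add] at h2
    have h3 := (Nat.pow_le_pow_iff_right hq1).mp h2
    omega
  obtain ⟨s0, hs0, hs0R⟩ := D.frob n hn
  have hs0V : ∀ v ∈ VV Ω q d (cA a), s0 v ∈ VV Ω q d (cA a) := by
    intro v hv
    have h1 := congrArg s0 (show ev _ _ _ v = 0 from hv)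
    rw [map_ev, map_zero] at h1
    simp only [hs0, hn] at h1
    exact h1
  have hs0x : s0 x ≠ 0 := by rwa [Ne, map_eq_zero]
  obtain ⟨g1, hg1⟩ := F1 (E := E) hq1 ha2 hd (hs0V x hx.1) hs0x hx.1 hx0
  obtain ⟨y, hy, hyz⟩ := hz x 0
  have hyx : ∀ s ∈ SQ K hq he, y ≠ algebraMap K Ω s * x := by
    intro s hs h
    apply hyz s hs 0 (Subfield.zero_mem _)
    rw [h]; ring
  have hpn : p ^ n ≠ 0 := pow_ne_zero _ (Nat.Prime.ne_zero Fact.out)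
  have hyx' : ∀ s ∈ SQ K hq he, g1 (s0 y) ≠ algebraMap K Ω s * x := by
    intro s hs h
    obtain ⟨t, ht⟩ := IsAlgClosed.exists_pow_nat_eq s (Nat.pos_of_ne_zero hpn)
    have htS : t ∈ SQ K hq he := by
      rw [mem_SQ]
      apply (iterateFrobenius K p n).injective
      rw [iterateFrobenius_def, iterateFrobenius_def, ← pow_mul, mul_comm, pow_mul, ht]
      exact hs
    have h1 : g1 (s0 (algebraMap K Ω t)) = algebraMap K Ω s := by
      have h2 : s0 (algebraMap K Ω t) = algebraMap K Ω s := by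
        rw [IsScalarTower.algebraMap_apply K K[X] Ω, IsScalarTower.algebraMap_apply K K[X] Ω]
        have := hs0 (C t)
        rw [map_C, iterateFrobenius_def, ht] at this
        exact this
      rw [h2, gal_K]
    rw [← h1, ← hg1, ← map_mul, ← map_mul] at h
    have h2 := s0.injective (g1.injective h)
    exact hyx t htS h2
  obtain ⟨g2, hg2, hg2y⟩ := stab_trans (E := E) (p := p) (SQ K hq he) (VV Ω q d (cA a)) hVa hVs
    (fun g b => gal_K g b) (fun g v hv => gal_VV g hv)
    (fun v hv v' hv' h h' => F1 hq1 ha2 hd hv h hv' h') x hx.1 hx0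
    (by
      intro v hv hvx s hs
      obtain ⟨b, hb⟩ := hV0' s hs
      obtain ⟨g, h1, h2, h3⟩ := hwild v hv (by
        intro b hb
        obtain ⟨s, hs, h⟩ := hc' v b hb
        exact hvx s hs h) _ _ hb
      refine ⟨g, h1, h2 _ _ hx, fun v' hv' => ?_⟩
      obtain ⟨w', b', hw', h4⟩ := h3 v' hv'
      obtain ⟨s', hs', rfl⟩ := hc' _ _ hw'
      exact ⟨s', hs', h4⟩) hz x (g1 (s0 y)) y hx.1 hx0 (gal_VV g1 (hs0V y hy)) hy hyx' hyx
  refine ⟨((g2 : Ω →+* Ω).comp (g1 : Ω →+* Ω)).comp s0, ?_, x, hx.1, y, hy, ?_, ?_, hx0, ?_⟩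
  · intro P
    show g2 (g1 (s0 _)) = _
    rw [hs0, gal_poly, gal_poly]
  · show g2 (g1 (s0 _)) = _
    rw [hg1, hg2]
  · exact hg2y
  · intro b hb
    exact hyx b (mem_SQ.mpr (pow_q_pow hb 2))
end
end Scat

set_option linter.all false
namespace Scat
open Polynomial
section
variable {p e q d : ℕ} [Fact p.Prime]

/-- the splitting field used -/
abbrev SpF (K : Type*) [Field K] (q k : ℕ) (c : ℕ → K[X]) : Type _ :=
  SplittingField (evp q k (fun i => algebraMap K[X] (FractionRing K[X]) (c i)))

instance SpF_tower (K : Type*) [Field K] (q k : ℕ) (c : ℕ → K[X]) : IsScalarTower K K[X] (SpF K q k c) :=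
  IsScalarTower.of_algebraMap_eq fun x => by
    rw [IsScalarTower.algebraMap_apply K (FractionRing K[X]) (SpF K q k c),
      IsScalarTower.algebraMap_apply K[X] (FractionRing K[X]) (SpF K q k c),
      IsScalarTower.algebraMap_apply K K[X] (FractionRing K[X])]

theorem core {K : Type*} [Field K] [IsAlgClosed K] [CharP K p] (hq : q = p ^ e) (he : 0 < e) {k : ℕ} {c : ℕ → K[X]}
    (hc0 : c 0 ≠ 0) (hk : c k = 1) (R : Prop) (N : ℕ → Prop) (hN : ∀ n, N n → ∀ i, (c i).map (iterateFrobenius K p n) = c i)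
    (hfin : ∀ n, N n → ∀ [IsGalois (FractionRing K[X]) (SpF K q k c)] [CharP (SpF K q k c) p],
      Fin2 (SpF K q k c) p q k c n ∨ R) :
    ∃ Q0, ∀ n, Q0 ≤ p ^ n → N n → R ∨ ∃ l x0 y0 : K, (c 0).eval l ≠ 0 ∧ x0 ≠ 0 ∧ y0 ≠ 0 ∧ x0 ^ p ^ n = x0 ∧ y0 ^ p ^ n = y0 ∧
      ev q k (fun i => (c i).eval l) x0 = 0 ∧ ev q k (fun i => (c i).eval l) y0 = 0 ∧
      (y0 / x0) ^ q ≠ y0 / x0 := by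
  have hinj := IsFractionRing.injective K[X] (FractionRing K[X])
  haveI : CharP (FractionRing K[X]) p := charP_of_injective_algebraMap hinj p
  haveI : CharP (SpF K q k c) p := charP_of_injective_algebraMap (algebraMap (FractionRing K[X]) (SpF K q k c)).injective p
  haveI : IsGalois (FractionRing K[X]) (SpF K q k c) := by
    refine IsGalois.of_separable_splitting_field (p := evp q k (fun i => algebraMap K[X] (FractionRing K[X]) (c i))) ?_
    refine evp_separable (p := p) he hq k _ ?_
    rwa [Ne, map_eq_zero_iff _ hinj]
  obtain ⟨Q0, hQ0⟩ := cheb2 (K := K) (E := FractionRing K[X]) (Ω := SpF K q k c) (p := p) he hq hc0 hk inferInstance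
  refine ⟨Q0, fun n hn hNn => ?_⟩
  rcases hfin n hNn with h | h
  · right
    obtain ⟨s, hs, x, hx, y, hy, hsx, hsy, hx0, hxy⟩ := h
    exact hQ0 n hn (hN n hNn) s hs x hx y hy hsx hsy hx0 hxy
  · left; exact h
end
end Scat

theorem stmt_7 (p e : ℕ) [Fact p.Prime] (he : 0 < e) (q : ℕ) (hq : q = p ^ e)
    (r : ℕ) (hr : 1 ≤ r)
    (d : ℕ) (a : ℕ → AlgebraicClosure (ZMod p))
    (hsupp : ∀ i, d < i → a i = 0)
    (hmonic : a d = 1)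
    (ha0 : a 0 ≠ 0) (ha2 : a 2 = 0)
    (hcoef : ∀ i, (a i) ^ q ^ r = a i)
    (hexc : {m : ℕ | 0 < m ∧ ∀ x y : AlgebraicClosure (ZMod p),
        x ≠ 0 → y ≠ 0 → x ^ q ^ (r * m) = x → y ^ q ^ (r * m) = y →
        (∑ i ∈ Finset.range (d + 1), a i * x ^ q ^ i) * y ^ q ^ 2 =
          (∑ i ∈ Finset.range (d + 1), a i * y ^ q ^ i) * x ^ q ^ 2 →
        (y / x) ^ q = y / x}.Infinite) :
    d = 0 ∨ (d = 4 ∧ a 1 = 0 ∧ a 3 = 0) := by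
  have hq1 := Scat.one_lt_q (p := p) he hq
  have hpow : ∀ m, q ^ (r * m) = p ^ (e * (r * m)) := fun m => by rw [hq, ← pow_mul]
  have hN : ∀ m i, a i ^ p ^ (e * (r * m)) = a i := by
    intro m i
    rw [← hpow, pow_mul]
    exact Scat.pow_q_pow (hcoef i) m
  have hbig : ∀ Q0, ∃ m, (0 < m ∧ ∀ x y : AlgebraicClosure (ZMod p),
        x ≠ 0 → y ≠ 0 → x ^ q ^ (r * m) = x → y ^ q ^ (r * m) = y →
        (∑ i ∈ Finset.range (d + 1), a i * x ^ q ^ i) * y ^ q ^ 2 =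
          (∑ i ∈ Finset.range (d + 1), a i * y ^ q ^ i) * x ^ q ^ 2 →
        (y / x) ^ q = y / x) ∧ Q0 ≤ p ^ (e * (r * m)) := by
    intro Q0
    obtain ⟨m, hm, hm'⟩ := hexc.exists_gt Q0
    refine ⟨m, hm, ?_⟩
    have h1 : m ≤ e * (r * m) := by
      rw [← mul_assoc]
      exact Nat.le_mul_of_pos_left _ (Nat.mul_pos he hr)
    have h2 := Nat.lt_pow_self (n := e * (r * m)) (Nat.Prime.one_lt (Fact.out : p.Prime))
    omega
  rcases Nat.eq_zero_or_pos d with h0 | hd0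
  · exact Or.inl h0
  by_cases hd1 : d = 1
  · exfalso
    subst hd1
    obtain ⟨Q0, hQ0⟩ := Scat.core (p := p) hq he (k := 2) (c := Scat.cB (a 0)) (by
      simp only [Scat.cB, if_true]
      exact neg_ne_zero.mpr (mul_ne_zero (Polynomial.C_ne_zero.mpr ha0) Polynomial.X_ne_zero)) (by simp [Scat.cB]) False (fun n => a 0 ^ p ^ n = a 0)
      (by
        intro n hn i
        unfold Scat.cB
        split_ifs <;> simp [iterateFrobenius_def, hn])
      (by
        intro n hn _ _
        exact Or.inl (Scat.case1 (E := FractionRing (Polynomial (AlgebraicClosure (ZMod p)))) hq he ha0 inferInstance n hn))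
    obtain ⟨m, ⟨hm0, hm⟩, hmQ⟩ := hbig Q0
    rcases hQ0 _ hmQ (hN m 0) with h | ⟨l, x, y, hl, hx0, hy0, hx, hy, hx1, hy1, hxy⟩
    · exact h
    apply hxy
    rw [← hpow] at hx hy
    refine hm x y hx0 hy0 hx hy ?_
    simp only [Scat.ev, Scat.cB, Finset.sum_range_succ, Finset.sum_range_zero] at hx1 hy1 ⊢
    simp at hx1 hy1 hl
    rw [hmonic]
    simp only [pow_zero, pow_one, zero_add, one_mul]
    linear_combination (a 0 * x + x ^ q) * hy1 - (a 0 * y + y ^ q) * hx1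
  have hd2 : d ≠ 2 := by
    rintro rfl
    rw [ha2] at hmonic
    exact zero_ne_one hmonic
  have hd : 3 ≤ d := by omega
  right
  obtain ⟨Q0, hQ0⟩ := Scat.core (p := p) hq he (k := d) (c := Scat.cA a) (by simp [Scat.cA, ha0])
    (by rw [Scat.cA, if_neg (by omega), hmonic, Polynomial.C_1]) (d = 4 ∧ a 1 = 0 ∧ a 3 = 0)
    (fun n => ∀ i, a i ^ p ^ n = a i)
    (by
      intro n hn i
      unfold Scat.cA
      split_ifs <;> simp [iterateFrobenius_def, hn])
    (by
      intro n hn _ _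
      exact Scat.case3 (E := FractionRing (Polynomial (AlgebraicClosure (ZMod p)))) hq he ha0 ha2 hmonic hd inferInstance n hn)
  obtain ⟨m, ⟨hm0, hm⟩, hmQ⟩ := hbig Q0
  rcases hQ0 _ hmQ (hN m) with h | ⟨l, x, y, hl, hx0, hy0, hx, hy, hx1, hy1, hxy⟩
  · exact h
  exfalso
  apply hxy
  rw [← hpow] at hx hy
  refine hm x y hx0 hy0 hx hy ?_
  have key : ∀ v, Scat.ev q d (fun i => (Scat.cA a i).eval l) v = 0 →
      ∑ i ∈ Finset.range (d + 1), a i * v ^ q ^ i = l * v ^ q ^ 2 := by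
    intro v hv
    rw [Scat.ev] at hv
    rw [← sub_eq_zero, ← hv, eq_comm, eq_sub_iff_add_eq, eq_comm, ← sub_eq_iff_eq_add', ← Finset.sum_sub_distrib,
      Finset.sum_eq_single 2]
    · simp [Scat.cA, ha2]
    · intro i _ hi
      simp [Scat.cA, hi]
    · intro h; simp at h; omega
  rw [key x hx1, key y hy1]; ring
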